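/- Let d ≥ 2 and p > p_c. For every α ∈ (0,1) there exists a constant c(d,α,p) > 0 such that, Q-almost surely on the event {|C| = +∞}, for all sufficiently large n: E_0^ω(α^{N_n}) ≤ exp(−c(d,α,p) n^{d/(d+2)}). -/

import Mathlib

open MeasureTheory
open scoped ENNReal

namespace Perco

/-- Vertices of the lattice `Z^d`. -/
abbrev Zd (d : ℕ) := Fin d → ℤ

/-- A percolation configuration: each (unordered) edge of the lattice is open or closed.
(Only the values on nearest-neighbour pairs matter.) -/
abbrev Config (d : ℕ) := Sym2 (Zd d) → Bool

/-- Lattice adjacency: `(x,y) ∈ E^d`. -/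
def latAdj {d : ℕ} (x y : Zd d) : Prop := (∑ i, |x i - y i|) = 1

/-- Open adjacency in the configuration `ω`. -/
def openAdj {d : ℕ} (ω : Config d) (x y : Zd d) : Prop :=
  latAdj x y ∧ ω s(x, y) = true

/-- `C`: the open cluster of the origin. -/
def cluster {d : ℕ} (ω : Config d) : Set (Zd d) :=
  {y | Relation.ReflTransGen (openAdj ω) 0 y}

/-- `Q` is the product measure making the edge states i.i.d. Bernoulli(p). -/
def IsBernoulli {d : ℕ} (p : ℝ) (Q : Measure (Config d)) : Prop :=
  IsProbabilityMeasure Q ∧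
    ∀ (s : Finset (Sym2 (Zd d))) (f : Sym2 (Zd d) → Bool),
      Q {ω : Config d | ∀ e ∈ s, ω e = f e} =
        ∏ e ∈ s, (if f e then ENNReal.ofReal p else ENNReal.ofReal (1 - p))

/-- The critical probability `p_c`. -/
noncomputable def pc (d : ℕ) : ℝ :=
  sSup {p : ℝ | 0 ≤ p ∧ p ≤ 1 ∧
    ∀ Q : Measure (Config d), IsBernoulli p Q → Q {ω | (cluster ω).Infinite} = 0}

/-- The box `B_n = [-n,n]^d`. -/
def box (d n : ℕ) : Set (Zd d) := {x | ∀ i, |x i| ≤ (n : ℤ)}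

/-- `C_n`: the connected component of `0` in `C ∩ B_n`. -/
def clusterN {d : ℕ} (ω : Config d) (n : ℕ) : Set (Zd d) :=
  {y | Relation.ReflTransGen
    (fun a b => openAdj ω a b ∧ a ∈ box d n ∧ b ∈ box d n) 0 y}

/-- `A` is connected in the open subgraph. -/
def ConnOpen {d : ℕ} (ω : Config d) (A : Set (Zd d)) : Prop :=
  ∀ x ∈ A, ∀ y ∈ A,
    Relation.ReflTransGen (fun a b => openAdj ω a b ∧ a ∈ A ∧ b ∈ A) x y

/-- `A` is connected in the lattice. -/
def ConnLat {d : ℕ} (A : Set (Zd d)) : Prop :=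
  ∀ x ∈ A, ∀ y ∈ A,
    Relation.ReflTransGen (fun a b => latAdj a b ∧ a ∈ A ∧ b ∈ A) x y

/-- The boundary `∂_{C^g} A` = open lattice edges from `A` to its complement. -/
def bdry {d : ℕ} (ω : Config d) (A : Set (Zd d)) : Set (Zd d × Zd d) :=
  {e | openAdj ω e.1 e.2 ∧ e.1 ∈ A ∧ e.2 ∉ A}

/-- The profile `f_c` (at scale `n`, exponent `γ`). -/
noncomputable def fcut (d : ℕ) (γ c : ℝ) (n : ℕ) (x : ℝ) : ℝ :=
  if x < c * (n : ℝ) ^ γ then 1 else x ^ (1 - 1 / (d : ℝ))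

/-- `ν(x)`: number of open neighbours of `x`. -/
noncomputable def nu {d : ℕ} (ω : Config d) (x : Zd d) : ℕ :=
  Set.ncard {y | openAdj ω x y}

-- Transition kernel of the simple random walk on the open subgraph.
open Classical in
noncomputable def step {d : ℕ} (ω : Config d) (x y : Zd d) : ℝ :=
  if openAdj ω x y then ((nu ω x : ℝ))⁻¹ else 0

/-- Weight of a path of length `n`. -/
noncomputable def pathW {d n : ℕ} (ω : Config d) (γ : Fin (n + 1) → Zd d) : ℝ :=
  ∏ i : Fin n, step ω (γ i.castSucc) (γ i.succ)

/-- `N_n`: number of distinct sites visited by the path. -/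
noncomputable def visits {d n : ℕ} (γ : Fin (n + 1) → Zd d) : ℕ :=
  (Set.range γ).ncard

/-- `P_0^ω(E)`, the probability of a path event for the walk started at 0. -/
noncomputable def PWalk {d : ℕ} (ω : Config d) (n : ℕ)
    (E : (Fin (n + 1) → Zd d) → Prop) : ℝ :=
  ∑' γ : Fin (n + 1) → Zd d,
    Set.indicator {γ | γ 0 = 0 ∧ E γ} (fun γ => pathW ω γ) γ

/-- `E_0^ω(α^{N_n})`. -/
noncomputable def LaplaceN {d : ℕ} (ω : Config d) (α : ℝ) (n : ℕ) : ℝ :=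
  ∑' γ : Fin (n + 1) → Zd d,
    Set.indicator {γ | γ 0 = 0} (fun γ => pathW ω γ * α ^ visits γ) γ

/-- `E_0^ω(α^{N_n} 1_{X_n = 0})`. -/
noncomputable def LaplaceNReturn {d : ℕ} (ω : Config d) (α : ℝ) (n : ℕ) : ℝ :=
  ∑' γ : Fin (n + 1) → Zd d,
    Set.indicator {γ | γ 0 = 0 ∧ γ (Fin.last n) = 0}
      (fun γ => pathW ω γ * α ^ visits γ) γ

/-- Vertices of the wreath product `C^g ≀ Z/2Z` (lamplighter states). -/
abbrev Lamp (d : ℕ) := Zd d × (Zd d →₀ ZMod 2)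

/-- Flip a lamp configuration at one point. -/
noncomputable def flipAt {σ : Type*} (f : σ →₀ ZMod 2) (x : σ) : σ →₀ ZMod 2 :=
  f + Finsupp.single x 1

/-- Transition kernel of the lamplighter walk `Z` with parameter `α`. -/
noncomputable def ptilde {d : ℕ} (ω : Config d) (α : ℝ) (u v : Lamp d) : ℝ :=
  Set.indicator
    {q : Lamp d × Lamp d | ∀ x, x ≠ q.1.1 → x ≠ q.2.1 → q.1.2 x = q.2.2 x}
    (fun q => (if q.2.2 q.1.1 = 0 then α else 1 - α) *
      (if q.2.2 q.2.1 = 0 then α else 1 - α) * step ω q.1.1 q.2.1) (u, v)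

/-- `P̃_o^ω(Z_n = o)`: return probability of the lamplighter walk. -/
noncomputable def ZReturn {d : ℕ} (ω : Config d) (α : ℝ) (n : ℕ) : ℝ :=
  ∑' γ : Fin (n + 1) → Lamp d,
    Set.indicator {γ | γ 0 = (0, 0) ∧ γ (Fin.last n) = (0, 0)}
      (fun γ => ∏ i : Fin n, ptilde ω α (γ i.castSucc) (γ i.succ)) γ

/-- Vertex set of the wreath product over a vertex set `V` of the base. -/
def wVert {d : ℕ} (V : Set (Zd d)) : Set (Lamp d) :=
  {u | u.1 ∈ V ∧ ↑u.2.support ⊆ V}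

/-- Adjacency in the wreath product `C^g ≀ Z/2Z`. -/
def wAdj {d : ℕ} (ω : Config d) (u v : Lamp d) : Prop :=
  (u.1 = v.1 ∧ (∀ x, x ≠ u.1 → u.2 x = v.2 x) ∧ u.2 u.1 ≠ v.2 u.1) ∨
    (u.2 = v.2 ∧ openAdj ω u.1 v.1)

/-- Boundary of `U` in the wreath product `C^g ≀ Z/2Z`. -/
def wBdry {d : ℕ} (ω : Config d) (U : Set (Lamp d)) : Set (Lamp d × Lamp d) :=
  {e | e.1 ∈ U ∧ e.2 ∈ wVert (cluster ω) \ U ∧ wAdj ω e.1 e.2}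

/-- Følner function `Fol_{C_n^g}^{C^g}` (with value `⊤` when no set qualifies). -/
noncomputable def FolC {d : ℕ} (ω : Config d) (n : ℕ) (k : ℝ) : ℝ≥0∞ :=
  sInf {m : ℝ≥0∞ | ∃ A : Set (Zd d), A ⊆ clusterN ω n ∧ A.Nonempty ∧
    ((bdry ω A).ncard : ℝ) / (A.ncard : ℝ) ≤ 1 / k ∧ m = (A.ncard : ℝ≥0∞)}

/-- Følner function `Fol_{C_n^g ≀ Z/2Z}^{C^g ≀ Z/2Z}`. -/
noncomputable def FolW {d : ℕ} (ω : Config d) (n : ℕ) (k : ℝ) : ℝ≥0∞ :=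
  sInf {m : ℝ≥0∞ | ∃ U : Set (Lamp d), U ⊆ wVert (clusterN ω n) ∧ U.Nonempty ∧
    ((wBdry ω U).ncard : ℝ) / (U.ncard : ℝ) ≤ 1 / k ∧ m = (U.ncard : ℝ≥0∞)}

/-- Degree of a configuration `f` in the graph `K_U`. -/
noncomputable def Kdeg {d : ℕ} (U : Set (Lamp d)) (f : Zd d →₀ ZMod 2) : ℕ :=
  Set.ncard {g : Zd d →₀ ZMod 2 | ∃ x : Zd d, (x, f) ∈ U ∧ (x, g) ∈ U ∧ g = flipAt f x}

/-- A point `u = (x,f)` of `U` is bad if `(x, f̄_x) ∉ U`. -/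
def badPt {d : ℕ} (U : Set (Lamp d)) (u : Lamp d) : Prop :=
  (u.1, flipAt u.2 u.1) ∉ U

/-- `D(0,x) ≤ r`: the chemical distance from the origin to `x` is at most `r`. -/
def chemLE {d : ℕ} (ω : Config d) (x : Zd d) (r : ℕ) : Prop :=
  ∃ m ≤ r, ∃ γ : ℕ → Zd d, γ 0 = 0 ∧ γ m = x ∧ ∀ i < m, openAdj ω (γ i) (γ (i + 1))

/-- `B_r(C)`: chemical ball of radius `r` around the origin. -/
def chemBall {d : ℕ} (ω : Config d) (r : ℕ) : Set (Zd d) := {x | chemLE ω x r}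

/-- Lattice connected component of `x` inside a vertex set `V`. -/
def latCompIn {d : ℕ} (V : Set (Zd d)) (x : Zd d) : Set (Zd d) :=
  {y | Relation.ReflTransGen (fun a b => latAdj a b ∧ a ∈ V ∧ b ∈ V) x y}

/-- Open connected component of `x` inside a vertex set `V`. -/
def openCompIn {d : ℕ} (ω : Config d) (V : Set (Zd d)) (x : Zd d) : Set (Zd d) :=
  {y | Relation.ReflTransGen (fun a b => openAdj ω a b ∧ a ∈ V ∧ b ∈ V) x y}

/-- `L_n`: a connected component of the open subgraph inside `B_n` of maximal cardinality. -/
def IsLargestComp {d : ℕ} (ω : Config d) (n : ℕ) (L : Set (Zd d)) : Prop :=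
  (∃ x ∈ box d n, L = openCompIn ω (box d n) x) ∧
    ∀ y ∈ box d n, (openCompIn ω (box d n) y).ncard ≤ L.ncard

/-- `\bar L`: the connected component of `L` in the full open subgraph. -/
def closureOf {d : ℕ} (ω : Config d) (L : Set (Zd d)) : Set (Zd d) :=
  {y | ∃ x ∈ L, Relation.ReflTransGen (openAdj ω) x y}

/-- The boundary `∂_{\bar L_n^g} A`. -/
def bdryBar {d : ℕ} (ω : Config d) (n : ℕ) (L A : Set (Zd d)) : Set (Zd d × Zd d) :=
  {e | openAdj ω e.1 e.2 ∧ e.1 ∈ A ∩ closureOf ω L ∧ e.2 ∈ box d (n + 1) \ A}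

/-- `n(A)`: number of connected components of `B_n − L` containing a component of `A`. -/
noncomputable def nComp {d : ℕ} (n : ℕ) (L A : Set (Zd d)) : ℕ :=
  Set.ncard {P : Set (Zd d) |
    (∃ x ∈ box d n \ L, P = latCompIn (box d n \ L) x) ∧
    ∃ x ∈ A, latCompIn A x ⊆ P}

/-- The killed kernel `P^{B_r(C)}` acting on functions. -/
noncomputable def Pball {d : ℕ} (ω : Config d) (r : ℕ) (f : Zd d → ℝ) : Zd d → ℝ :=
  Set.indicator (chemBall ω r) (fun x =>
    ∑' y : Zd d, Set.indicator (chemBall ω r) (fun y => step ω x y * f y) y)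

/-- The Dirichlet form `ξ(f,f) = ((Id − P^{B_r(C)}) 1_{B_r(C)} f | f)_ν`. -/
noncomputable def dirichletForm {d : ℕ} (ω : Config d) (r : ℕ) (f : Zd d → ℝ) : ℝ :=
  ∑' x : Zd d, (nu ω x : ℝ) * f x *
    (Set.indicator (chemBall ω r) f x - Pball ω r (Set.indicator (chemBall ω r) f) x)

/-- `‖f‖²_{l²(ν)}`. -/
noncomputable def normSq {d : ℕ} (ω : Config d) (f : Zd d → ℝ) : ℝ :=
  ∑' x : Zd d, (nu ω x : ℝ) * f x ^ 2

/-- `λ_1(B_r(C))`: smallest Dirichlet eigenvalue of the killed walk. -/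
noncomputable def lambda1 {d : ℕ} (ω : Config d) (r : ℕ) : ℝ :=
  sInf {t : ℝ | ∃ f : Zd d → ℝ, f ≠ 0 ∧ Function.support f ⊆ chemBall ω r ∧
    t = dirichletForm ω r f / normSq ω f}

section

/-! ### Bernoulli product measures -/

/-- The Bernoulli law on `Bool`. -/
noncomputable def ber (a : unitInterval) : Measure Bool :=
  ENNReal.ofReal a • Measure.dirac true + ENNReal.ofReal (1 - a) • Measure.dirac false

lemma ber_true (a : unitInterval) : ber a {true} = ENNReal.ofReal a := by simp [ber]

lemma ber_false (a : unitInterval) : ber a {false} = ENNReal.ofReal (1 - a) := by simp [ber]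

instance (a : unitInterval) : IsProbabilityMeasure (ber a) := by
  constructor
  simp only [ber, Measure.coe_add, Pi.add_apply, Measure.smul_apply, measure_univ, smul_eq_mul,
    mul_one]
  rw [← ENNReal.ofReal_add a.2.1 (by linarith [a.2.2])]
  simp

/-- Independent Bernoulli variables with weights `w`. -/
noncomputable def bern {ι : Type*} (w : ι → unitInterval) : Measure (ι → Bool) :=
  Measure.infinitePi (fun i => ber (w i))

instance {ι : Type*} (w : ι → unitInterval) : IsProbabilityMeasure (bern w) := by
  unfold bern; infer_instance

/-- The event `A` is determined by the coordinates in `S`. -/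
def Dep {ι : Type*} (A : Set (ι → Bool)) (S : Set ι) : Prop :=
  ∀ ω ω', (∀ i ∈ S, ω i = ω' i) → ω ∈ A → ω' ∈ A

lemma Dep.mono {ι : Type*} {A : Set (ι → Bool)} {S T : Set ι} (h : Dep A S) (hST : S ⊆ T) :
    Dep A T := fun ω ω' hh hA => h ω ω' (fun i hi => hh i (hST hi)) hA

lemma Dep.compl {ι : Type*} {A : Set (ι → Bool)} {S : Set ι} (h : Dep A S) : Dep Aᶜ S :=
  fun ω ω' hh hA hA' => hA (h ω' ω (fun i hi => (hh i hi).symm) hA')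

lemma Dep.inter {ι : Type*} {A B : Set (ι → Bool)} {S : Set ι} (h : Dep A S) (h' : Dep B S) :
    Dep (A ∩ B) S := fun ω ω' hh hA => ⟨h ω ω' hh hA.1, h' ω ω' hh hA.2⟩

lemma Dep.iUnion {ι κ : Type*} {A : κ → Set (ι → Bool)} {S : Set ι} (h : ∀ k, Dep (A k) S) :
    Dep (⋃ k, A k) S := by
  intro ω ω' hh hA
  simp only [Set.mem_iUnion] at hA ⊢
  exact hA.imp fun k hk => h k ω ω' hh hk

open Classical in
/-- Keep the coordinates in `S`, set the others to `false`. -/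
noncomputable def keep {ι : Type*} (S : Set ι) (ω : ι → Bool) : ι → Bool :=
  fun i => if i ∈ S then ω i else false

lemma Dep.preimage_keep {ι : Type*} {A : Set (ι → Bool)} {S : Set ι} (h : Dep A S) :
    keep S ⁻¹' A = A := by
  ext ω
  constructor
  · exact h _ _ fun i hi => by simp [keep, hi]
  · exact h _ _ fun i hi => by simp [keep, hi]

lemma Dep.measurableSet_iSup {ι : Type*} {A : Set (ι → Bool)} {S : Set ι} (h : Dep A S)
    (hA : MeasurableSet A) :
    MeasurableSet[⨆ i ∈ S, MeasurableSpace.comap (fun ω : ι → Bool => ω i) inferInstance] A := by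
  rw [← h.preimage_keep]
  have : Measurable[⨆ i ∈ S, MeasurableSpace.comap (fun ω : ι → Bool => ω i) inferInstance]
      (keep S) := by
    refine @measurable_pi_lambda _ _ _ (_) _ _ fun i => ?_
    by_cases hi : i ∈ S
    · simp only [keep, hi, if_true]
      intro s hs
      have hle : MeasurableSpace.comap (fun ω : ι → Bool => ω i) inferInstance ≤
          ⨆ i ∈ S, MeasurableSpace.comap (fun ω : ι → Bool => ω i) inferInstance :=
        le_iSup₂ (f := fun i (_ : i ∈ S) =>
          MeasurableSpace.comap (fun ω : ι → Bool => ω i) inferInstance) i hi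
      exact hle _ ⟨s, hs, rfl⟩
    · simp only [keep, hi, if_false]
      exact @measurable_const _ _ _ (_) _
  exact this hA

lemma Dep.measurableSet {ι : Type*} {A : Set (ι → Bool)} {S : Set ι} (hS : S.Finite)
    (h : Dep A S) : MeasurableSet A := by
  have := hS.fintype
  let f : (ι → Bool) → (S → Bool) := fun ω i => ω i
  have hf : Measurable f := by fun_prop
  have : A = f ⁻¹' (f '' A) := by
    refine Set.Subset.antisymm (Set.subset_preimage_image _ _) ?_
    rintro ω ⟨ω', hω', he⟩
    exact h ω' ω (fun i hi => congrFun he ⟨i, hi⟩) hω'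
  rw [this]
  exact hf (Set.toFinite _).measurableSet

lemma bern_inter {ι : Type*} (w : ι → unitInterval) {A B : Set (ι → Bool)} {S T : Set ι}
    (hA : Dep A S) (hB : Dep B T) (hST : Disjoint S T) (mA : MeasurableSet A)
    (mB : MeasurableSet B) : (bern w).real (A ∩ B) = (bern w).real A * (bern w).real B := by
  have hi : ProbabilityTheory.iIndepFun (fun i (ω : ι → Bool) => ω i) (bern w) :=
    ProbabilityTheory.iIndepFun_infinitePi (X := fun i (b : Bool) => b) (fun i => measurable_id)
  have := ProbabilityTheory.indep_iSup_of_disjoint (fun i => (measurable_pi_apply i).comap_le)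
    hi.iIndep hST
  have h2 := (ProbabilityTheory.Indep_iff _ _ _).1 this A B (hA.measurableSet_iSup mA)
    (hB.measurableSet_iSup mB)
  simp only [Measure.real, h2, ENNReal.toReal_mul]

lemma bern_true {ι : Type*} (w : ι → unitInterval) (i : ι) :
    (bern w).real {ω | ω i = true} = w i := by
  have : (bern w) {ω | ω i = true} = ber (w i) {true} := by
    rw [← Measure.infinitePi_map_eval (fun i => ber (w i)) i, Measure.map_apply (by fun_prop)
      (by measurability)]
    rfl
  rw [Measure.real, this, ber_true, ENNReal.toReal_ofReal (w i).2.1]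

lemma bern_false {ι : Type*} (w : ι → unitInterval) (i : ι) :
    (bern w).real {ω | ω i = false} = 1 - w i := by
  have : (bern w) {ω | ω i = false} = ber (w i) {false} := by
    rw [← Measure.infinitePi_map_eval (fun i => ber (w i)) i, Measure.map_apply (by fun_prop)
      (by measurability)]
    rfl
  rw [Measure.real, this, ber_false, ENNReal.toReal_ofReal (by linarith [(w i).2.2])]

lemma bern_cylinder {ι : Type*} (w : ι → unitInterval) (s : Finset ι) (f : ι → Bool) :
    bern w {ω | ∀ e ∈ s, ω e = f e} =
      ∏ e ∈ s, (if f e then ENNReal.ofReal (w e) else ENNReal.ofReal (1 - w e)) := by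
  have : {ω : ι → Bool | ∀ e ∈ s, ω e = f e} = Set.pi s (fun e => {f e}) := by
    ext; simp [Set.mem_pi]
  rw [this, bern, Measure.infinitePi_pi _ (by measurability)]
  refine Finset.prod_congr rfl fun e _ => ?_
  cases h : f e
  · simp [ber_false]
  · simp [ber_true]

lemma bern_all_true {ι : Type*} (w : ι → unitInterval) (s : Finset ι) :
    (bern w).real {ω | ∀ e ∈ s, ω e = true} = ∏ e ∈ s, (w e : ℝ) := by
  rw [Measure.real, bern_cylinder w s (fun _ => true), ENNReal.toReal_prod]
  refine Finset.prod_congr rfl fun e _ => ?_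
  simp [ENNReal.toReal_ofReal (w e).2.1]

lemma bern_all_false {ι : Type*} (w : ι → unitInterval) (s : Finset ι) :
    (bern w).real {ω | ∀ e ∈ s, ω e = false} = ∏ e ∈ s, (1 - w e : ℝ) := by
  rw [Measure.real, bern_cylinder w s (fun _ => false), ENNReal.toReal_prod]
  refine Finset.prod_congr rfl fun e _ => ?_
  simp [ENNReal.toReal_ofReal (sub_nonneg.2 (w e).2.2)]

lemma eq_bern {ι : Type*} (w : ι → unitInterval) (Q : Measure (ι → Bool))
    [IsProbabilityMeasure Q]
    (h : ∀ (s : Finset ι) (f : ι → Bool), Q {ω | ∀ e ∈ s, ω e = f e} =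
      ∏ e ∈ s, (if f e then ENNReal.ofReal (w e) else ENNReal.ofReal (1 - w e))) :
    Q = bern w := by
  classical
  refine Measure.eq_infinitePi _ fun s t ht => ?_
  by_cases hemp : ∃ i ∈ s, t i = ∅
  · obtain ⟨i, hi, hti⟩ := hemp
    rw [Finset.prod_eq_zero hi (by simp [hti]), Set.pi_eq_empty (i := i) (by simpa using hi) hti]
    simp
  push Not at hemp
  let s' := s.filter (fun i => t i ≠ Set.univ)
  let f : ι → Bool := fun i => decide (true ∈ t i)
  have hsing : ∀ i ∈ s', t i = {f i} := by
    intro i hi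
    have hi' := Finset.mem_filter.1 hi
    have hne := hemp i hi'.1
    have hun := hi'.2
    ext b
    by_cases ht1 : true ∈ t i
    · have hf : f i = true := by simp [f, ht1]
      have hf0 : false ∉ t i := fun h0 => hun (by ext b; cases b <;> simp [h0, ht1])
      rw [hf]; cases b <;> simp [ht1, hf0]
    · have hf : f i = false := by simp [f, ht1]
      have hf0 : false ∈ t i := by
        obtain ⟨b, hb⟩ := hne
        cases b
        · exact hb
        · exact absurd hb ht1
      rw [hf]; cases b <;> simp [ht1, hf0]
  have hset : Set.pi (s : Set ι) t = {ω | ∀ e ∈ s', ω e = f e} := by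
    ext ω
    simp only [Set.mem_pi, Finset.mem_coe, Set.mem_ofPred_eq]
    constructor
    · intro h i hi
      have := h i (Finset.mem_filter.1 hi).1
      rw [hsing i hi] at this
      exact this
    · intro h i hi
      by_cases hu : t i = Set.univ
      · simp [hu]
      · have hi' : i ∈ s' := Finset.mem_filter.2 ⟨hi, hu⟩
        rw [hsing i hi', h i hi']; rfl
  rw [hset, h, ← Finset.prod_filter_mul_prod_filter_not s (fun i => t i ≠ Set.univ)]
  rw [Finset.prod_eq_one (s := s.filter (fun i => ¬ (t i ≠ Set.univ))), mul_one]
  · refine Finset.prod_congr rfl fun i hi => ?_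
    rw [hsing i hi]
    cases f i
    · simp [ber_false]
    · simp [ber_true]
  · intro i hi
    have : t i = Set.univ := not_not.1 (Finset.mem_filter.1 hi).2
    rw [this, measure_univ]

lemma IsBernoulli.eq_bern {d : ℕ} {p : unitInterval} {Q : Measure (Config d)}
    (h : IsBernoulli p Q) : Q = bern (fun _ => p) :=
  haveI := h.1
  Perco.eq_bern _ Q h.2

lemma bern_map_inj {ι κ : Type*} (w : ι → unitInterval) {f : κ → ι} (hf : Function.Injective f) :
    (bern w).map (fun ω i => ω (f i)) = bern (fun i => w (f i)) :=
  Measure.map_infinitePi_infinitePi_of_inj (P := fun i => ber (w i)) hf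

lemma bern_preimage_inj {ι κ : Type*} (w : ι → unitInterval) {f : κ → ι}
    (hf : Function.Injective f) {A : Set (κ → Bool)} (hA : MeasurableSet A) :
    (bern w).real {ω | (fun i => ω (f i)) ∈ A} = (bern (fun i => w (f i))).real A := by
  rw [← bern_map_inj w hf, Measure.real, Measure.real, Measure.map_apply (by fun_prop) hA]
  rfl

/-- Superpose the configurations of all colours. -/
noncomputable def superpose {E K : Type*} (η : E × K → Bool) : E → Bool :=
  open Classical in fun e => decide (∃ k, η (e, k) = true)

lemma superpose_true {E K : Type*} {η : E × K → Bool} {e : E} :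
    superpose η e = true ↔ ∃ k, η (e, k) = true := by simp [superpose]

lemma measurable_superpose {E K : Type*} [Finite K] :
    Measurable (superpose : (E × K → Bool) → (E → Bool)) := by
  refine measurable_pi_lambda _ fun e => ?_
  refine measurable_to_bool ?_
  have : (fun η : E × K → Bool => superpose η e) ⁻¹' {true} =
      ⋃ k, (fun η : E × K → Bool => η (e, k)) ⁻¹' {true} := by
    ext η; simp [superpose_true]
  rw [this]
  exact MeasurableSet.iUnion fun k => measurable_pi_apply _ (measurableSet_singleton _)

lemma map_superpose {E K : Type*} [Fintype K] (w : K → unitInterval) (p : unitInterval)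
    (hp : ∏ k, (1 - w k : ℝ) = 1 - p) :
    (bern (fun i : E × K => w i.2)).map superpose = bern (fun _ => p) := by
  classical
  let g : (K → Bool) → Bool := fun a => decide (∃ k, a k = true)
  have hg : Measurable g := measurable_of_countable _
  have h1 : (superpose : (E × K → Bool) → (E → Bool)) =
      (fun a : E → K → Bool => fun e => g (a e)) ∘ (MeasurableEquiv.curry E K Bool) := by
    funext η e
    rw [Bool.eq_iff_iff, superpose_true]
    exact decide_eq_true_iff.symm
  have h2 := Measure.infinitePi_map_curry (ι := E) (κ := K) (X := Bool)
    (fun _ k => ber (w k))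
  have hm1 : Measurable (fun a : E → K → Bool => fun e => g (a e)) := by
    refine measurable_pi_lambda _ fun e => hg.comp (measurable_pi_apply e)
  rw [h1, ← Measure.map_map hm1 (MeasurableEquiv.measurable _)]
  have h3 : (bern (fun i : E × K => w i.2)).map (MeasurableEquiv.curry E K Bool) =
      Measure.infinitePi fun _ : E => Measure.infinitePi fun k => ber (w k) := h2
  rw [h3, Measure.infinitePi_map_pi _ (fun _ => hg), bern]
  congr 1
  funext _
  have : IsProbabilityMeasure ((Measure.infinitePi fun k => ber (w k)).map g) :=
    Measure.isProbabilityMeasure_map hg.aemeasurable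
  have hf : (Measure.infinitePi fun k => ber (w k)).map g {false} = ber p {false} := by
    rw [Measure.map_apply hg (measurableSet_singleton _)]
    have : g ⁻¹' {false} = {ω | ∀ k ∈ Finset.univ, ω k = (fun _ : K => false) k} := by
      ext a; simp [g]
    rw [this]
    have := bern_cylinder w Finset.univ (fun _ => false)
    rw [bern] at this
    rw [this, ber_false, ← hp]
    simp only [Bool.false_eq_true, if_false]
    rw [ENNReal.ofReal_prod_of_nonneg]
    intro k _
    linarith [(w k).2.2]
  have hs : ∀ b : Bool, (Measure.infinitePi fun k => ber (w k)).map g {b} = ber p {b} := by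
    intro b
    cases b
    · exact hf
    · have hc : ({true} : Set Bool) = {false}ᶜ := by ext b; cases b <;> simp
      rw [hc, prob_compl_eq_one_sub (measurableSet_singleton _),
        prob_compl_eq_one_sub (measurableSet_singleton _), hf]
  exact Measure.ext_of_singleton hs

end

section

/-! ### Positive association and finite decompositions -/

/-- Increasing events. -/
def Incr {ι : Type*} (A : Set (ι → Bool)) : Prop :=
  ∀ ω ω', (∀ i, ω i = true → ω' i = true) → ω ∈ A → ω' ∈ A

lemma Incr.inter {ι : Type*} {A B : Set (ι → Bool)} (h : Incr A) (h' : Incr B) :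
    Incr (A ∩ B) := fun ω ω' hh hA => ⟨h ω ω' hh hA.1, h' ω ω' hh hA.2⟩

lemma bern_split {ι : Type*} [DecidableEq ι] (w : ι → unitInterval) {A : Set (ι → Bool)}
    {F : Finset ι} {i : ι} (hi : i ∉ F) (hA : Dep A (insert i F : Finset ι)) :
    (bern w).real A = w i * (bern w).real {ω | Function.update ω i true ∈ A} +
      (1 - w i) * (bern w).real {ω | Function.update ω i false ∈ A} := by
  have hdep : ∀ b, Dep {ω | Function.update ω i b ∈ A} (F : Set ι) := by
    intro b ω ω' h h1
    refine hA _ _ (fun j hj => ?_) h1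
    by_cases hji : j = i
    · subst hji; simp
    · simp only [Function.update_of_ne hji]
      exact h j (by simpa [hji] using hj)
  have hdi : ∀ b, Dep {ω : ι → Bool | ω i = b} {i} := by
    intro b ω ω' h h1
    have := h i rfl
    simp only [Set.mem_ofPred_eq] at h1 ⊢
    rw [← this, h1]
  have hm : ∀ b, MeasurableSet {ω | Function.update ω i b ∈ A} :=
    fun b => (hdep b).measurableSet F.finite_toSet
  have hmi : ∀ b, MeasurableSet {ω : ι → Bool | ω i = b} :=
    fun b => (hdi b).measurableSet (Set.finite_singleton i)
  have hd : Disjoint ({i} : Set ι) (F : Set ι) := by simpa using hi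
  have hsplit : A = ({ω : ι → Bool | ω i = true} ∩ {ω | Function.update ω i true ∈ A}) ∪
      ({ω : ι → Bool | ω i = false} ∩ {ω | Function.update ω i false ∈ A}) := by
    ext ω
    cases h : ω i
    · have : Function.update ω i false = ω := by rw [← h]; simp
      simp [h, this]
    · have : Function.update ω i true = ω := by rw [← h]; simp
      simp [h, this]
  conv_lhs => rw [hsplit]
  rw [measureReal_union _ ((hmi _).inter (hm _)), bern_inter w (hdi _) (hdep _) hd (hmi _) (hm _),
    bern_inter w (hdi _) (hdep _) hd (hmi _) (hm _), bern_true, bern_false]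
  rw [Set.disjoint_left]
  rintro ω ⟨h1, -⟩ ⟨h2, -⟩
  simp only [Set.mem_ofPred_eq] at h1 h2
  simp [h1] at h2

lemma harris {ι : Type*} (w : ι → unitInterval) (F : Finset ι) :
    ∀ {A B : Set (ι → Bool)}, Dep A F → Dep B F → Incr A → Incr B →
    (bern w).real A * (bern w).real B ≤ (bern w).real (A ∩ B) := by
  classical
  induction F using Finset.induction_on with
  | empty =>
    intro A B hA hB _ _
    have key : ∀ A : Set (ι → Bool), Dep A ((∅ : Finset ι) : Set ι) → A = ∅ ∨ A = Set.univ := by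
      intro A hA
      by_cases h : A.Nonempty
      · right
        obtain ⟨ω, hω⟩ := h
        ext ω'
        simp [hA ω ω' (by simp) hω]
      · left; exact Set.not_nonempty_iff_eq_empty.1 h
    rcases key A hA with h | h <;> rcases key B hB with h' | h' <;> simp [h, h']
  | insert i F hi ih =>
    intro A B hA hB iA iB
    rw [bern_split w hi hA, bern_split w hi hB, bern_split w hi (hA.inter hB)]
    have hdep : ∀ {A}, Dep A ((insert i F : Finset ι) : Set ι) → ∀ b,
        Dep {ω | Function.update ω i b ∈ A} (F : Set ι) := by
      intro A hA b ω ω' h h1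
      refine hA _ _ (fun j hj => ?_) h1
      by_cases hji : j = i
      · subst hji; simp
      · simp only [Function.update_of_ne hji]
        exact h j (by simpa [hji] using hj)
    have hinc : ∀ {A : Set (ι → Bool)}, Incr A → ∀ b, Incr {ω | Function.update ω i b ∈ A} := by
      intro A hA b ω ω' h h1
      refine hA _ _ (fun j hj => ?_) h1
      by_cases hji : j = i
      · subst hji; simpa using hj
      · simp only [Function.update_of_ne hji] at hj ⊢
        exact h j hj
    have hmon : ∀ {A : Set (ι → Bool)}, Incr A → (bern w).real {ω | Function.update ω i false ∈ A}
        ≤ (bern w).real {ω | Function.update ω i true ∈ A} := by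
      intro A hA
      refine measureReal_mono ?_
      intro ω h
      refine hA _ _ (fun j hj => ?_) h
      by_cases hji : j = i
      · subst hji; simp
      · simpa only [Function.update_of_ne hji] using hj
    have h1 := ih (hdep hA true) (hdep hB true) (hinc iA true) (hinc iB true)
    have h0 := ih (hdep hA false) (hdep hB false) (hinc iA false) (hinc iB false)
    have mA := hmon iA
    have mB := hmon iB
    have e1 : {ω | Function.update ω i true ∈ A ∩ B} =
      {ω | Function.update ω i true ∈ A} ∩ {ω | Function.update ω i true ∈ B} := rfl
    have e0 : {ω | Function.update ω i false ∈ A ∩ B} =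
      {ω | Function.update ω i false ∈ A} ∩ {ω | Function.update ω i false ∈ B} := rfl
    rw [e1, e0]
    have hw0 := (w i).2.1
    have hw1 := (w i).2.2
    set a1 := (bern w).real {ω | Function.update ω i true ∈ A}
    set a0 := (bern w).real {ω | Function.update ω i false ∈ A}
    set b1 := (bern w).real {ω | Function.update ω i true ∈ B}
    set b0 := (bern w).real {ω | Function.update ω i false ∈ B}
    generalize ((w i : unitInterval) : ℝ) = q at hw0 hw1 ⊢
    calc (q * a1 + (1 - q) * a0) * (q * b1 + (1 - q) * b0)
        ≤ q * (a1 * b1) + (1 - q) * (a0 * b0) := by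
          nlinarith [mul_nonneg (mul_nonneg hw0 (sub_nonneg.2 hw1))
            (mul_nonneg (sub_nonneg.2 mA) (sub_nonneg.2 mB))]
      _ ≤ _ := by
          gcongr

lemma harris_compl {ι : Type*} (w : ι → unitInterval) (F : Finset ι)
    {A B : Set (ι → Bool)} (hA : Dep A F) (hB : Dep B F) (iA : Incr A) (iB : Incr B) :
    (bern w).real Aᶜ * (bern w).real Bᶜ ≤ (bern w).real (Aᶜ ∩ Bᶜ) := by
  have h := harris w F hA hB iA iB
  have mA := hA.measurableSet F.finite_toSet
  have mB := hB.measurableSet F.finite_toSet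
  rw [← Set.compl_union, probReal_compl_eq_one_sub mA, probReal_compl_eq_one_sub mB,
    probReal_compl_eq_one_sub (mA.union mB)]
  have := measureReal_union_add_inter (μ := bern w) (s := A) (t := B) mB
  nlinarith

lemma harris_biInter {ι κ : Type*} (w : ι → unitInterval) (F : Finset ι) (s : Finset κ)
    {A : κ → Set (ι → Bool)} (hA : ∀ k, Dep (A k) F) (iA : ∀ k, Incr (A k)) :
    ∏ k ∈ s, (bern w).real (A k) ≤ (bern w).real {ω | ∀ k ∈ s, ω ∈ A k} := by
  classical
  induction s using Finset.induction_on with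
  | empty => simp
  | insert k s hk ih =>
    rw [Finset.prod_insert hk]
    have e : {ω | ∀ j ∈ insert k s, ω ∈ A j} = A k ∩ {ω | ∀ j ∈ s, ω ∈ A j} := by
      ext ω; simp
    rw [e]
    refine le_trans ?_ (harris w F (hA k) ?_ (iA k) ?_)
    · gcongr
    · exact fun ω ω' h h1 j hj => hA j ω ω' h (h1 j hj)
    · exact fun ω ω' h h1 j hj => iA j ω ω' h (h1 j hj)

lemma harris_biInter_compl {ι κ : Type*} (w : ι → unitInterval) (F : Finset ι) (s : Finset κ)
    {A : κ → Set (ι → Bool)} (hA : ∀ k, Dep (A k) F) (iA : ∀ k, Incr (A k)) :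
    ∏ k ∈ s, (bern w).real (A k)ᶜ ≤ (bern w).real {ω | ∀ k ∈ s, ω ∉ A k} := by
  classical
  induction s using Finset.induction_on with
  | empty => simp
  | insert k s hk ih =>
    rw [Finset.prod_insert hk]
    have e : {ω | ∀ j ∈ insert k s, ω ∉ A j} = (A k)ᶜ ∩ {ω | ∃ j ∈ s, ω ∈ A j}ᶜ := by
      ext ω; simp
    have e' : {ω | ∀ j ∈ s, ω ∉ A j} = {ω | ∃ j ∈ s, ω ∈ A j}ᶜ := by
      ext ω; simp
    rw [e]
    rw [e'] at ih
    refine le_trans ?_ (harris_compl w F (hA k) ?_ (iA k) ?_)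
    · gcongr
    · rintro ω ω' h ⟨j, hj, h1⟩
      exact ⟨j, hj, hA j ω ω' h h1⟩
    · rintro ω ω' h ⟨j, hj, h1⟩
      exact ⟨j, hj, iA j ω ω' h h1⟩

/-- The square root trick, for `q` increasing events of equal probability. -/
lemma sqrt_trick {ι κ : Type*} (w : ι → unitInterval) (F : Finset ι) (s : Finset κ)
    {A : κ → Set (ι → Bool)} (hA : ∀ k, Dep (A k) F) (iA : ∀ k, Incr (A k)) {a : ℝ}
    (h : ∀ k ∈ s, (bern w).real (A k) = a) {ε : ℝ}
    (hε : (bern w).real {ω | ∀ k ∈ s, ω ∉ A k} ≤ ε) : (1 - a) ^ s.card ≤ ε := by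
  refine le_trans ?_ hε
  refine le_trans (le_of_eq ?_) (harris_biInter_compl w F s hA iA)
  rw [Finset.prod_congr rfl (g := fun _ => 1 - a), Finset.prod_const]
  intro k hk
  rw [probReal_compl_eq_one_sub ((hA k).measurableSet F.finite_toSet), h k hk]

lemma real_eq_sum {Ω β : Type*} [MeasurableSpace Ω] (μ : Measure Ω) [IsFiniteMeasure μ]
    (X : Ω → β) (U : Finset β) {A : Set Ω} (hU : ∀ ω ∈ A, X ω ∈ U)
    (hm : ∀ T ∈ U, MeasurableSet {ω | ω ∈ A ∧ X ω = T}) :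
    μ.real A = ∑ T ∈ U, μ.real {ω | ω ∈ A ∧ X ω = T} := by
  rw [← measureReal_biUnion_finset _ hm]
  · congr 1
    ext ω
    simp only [Set.mem_iUnion, Set.mem_ofPred_eq, exists_prop]
    exact ⟨fun h => ⟨_, hU ω h, h, rfl⟩, fun ⟨_, _, h, _⟩ => h⟩
  · intro S _ T _ hST
    rw [Function.onFun, Set.disjoint_left]
    rintro ω ⟨-, h1⟩ ⟨-, h2⟩
    exact hST (h1.symm.trans h2)

/-- Closing a random set of fresh coordinates. -/
lemma random_closed {ι E : Type*} (w : ι → unitInterval) (U : Finset E)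
    (X : (ι → Bool) → Finset E) (G : Set (ι → Bool)) {S : Set ι} (hS : S.Finite)
    (hX : ∀ ω ∈ G, X ω ⊆ U) (g : E → ι) (hg : Function.Injective g) {a : ℝ}
    (ha : ∀ e ∈ U, (w (g e) : ℝ) = a)
    (hdep : ∀ T, Dep {ω | ω ∈ G ∧ X ω = T} S) (hdisj : ∀ e ∈ U, g e ∉ S) :
    (bern w).real {ω | ω ∈ G ∧ ∀ e ∈ X ω, ω (g e) = false} =
      ∑ T ∈ U.powerset, (bern w).real {ω | ω ∈ G ∧ X ω = T} * (1 - a) ^ T.card := by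
  classical
  have hd2 : ∀ T : Finset E, Dep {ω : ι → Bool | ∀ i ∈ T.image g, ω i = false}
      (T.image g : Set ι) := by
    intro T ω ω' h h1 i hi
    rw [← h i (by exact_mod_cast hi)]
    exact h1 i hi
  have hrw : ∀ T, {ω | (ω ∈ {ω | ω ∈ G ∧ ∀ e ∈ X ω, ω (g e) = false}) ∧ X ω = T} =
      {ω | ω ∈ G ∧ X ω = T} ∩ {ω : ι → Bool | ∀ i ∈ T.image g, ω i = false} := by
    intro T
    ext ω
    simp only [Set.mem_ofPred_eq, Set.mem_inter_iff, Finset.mem_image, forall_exists_index,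
      and_imp, forall_apply_eq_imp_iff₂]
    constructor
    · rintro ⟨⟨h1, h2⟩, rfl⟩
      exact ⟨⟨h1, rfl⟩, h2⟩
    · rintro ⟨⟨h1, rfl⟩, h2⟩
      exact ⟨⟨h1, h2⟩, rfl⟩
  have hm1 : ∀ T, MeasurableSet {ω | ω ∈ G ∧ X ω = T} := fun T => (hdep T).measurableSet hS
  have hm2 : ∀ T : Finset E, MeasurableSet {ω : ι → Bool | ∀ i ∈ T.image g, ω i = false} :=
    fun T => (hd2 T).measurableSet (Finset.finite_toSet _)
  rw [real_eq_sum (bern w) X U.powerset]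
  · refine Finset.sum_congr rfl fun T hT => ?_
    rw [hrw, bern_inter w (hdep T) (hd2 T) _ (hm1 T) (hm2 T), bern_all_false,
      Finset.prod_image (fun x _ y _ h => hg h)]
    · congr 1
      rw [Finset.prod_congr rfl (g := fun _ => 1 - a), Finset.prod_const]
      intro e he
      rw [ha e (Finset.mem_powerset.1 hT he)]
    · rw [Set.disjoint_right]
      intro i hi
      obtain ⟨e, he, rfl⟩ := Finset.mem_image.1 (Finset.mem_coe.1 hi)
      exact hdisj e (Finset.mem_powerset.1 hT he)
  · exact fun ω hω => Finset.mem_powerset.2 (hX ω hω.1)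
  · intro T _
    rw [hrw]
    exact (hm1 T).inter (hm2 T)

end

section

/-! ### Open connections -/

variable {d : ℕ}

lemma latAdj.symm {x y : Zd d} (h : latAdj x y) : latAdj y x := by
  unfold latAdj at *
  rw [← h]
  exact Finset.sum_congr rfl fun i _ => abs_sub_comm _ _

lemma openAdj.symm {ω : Config d} {x y : Zd d} (h : openAdj ω x y) : openAdj ω y x :=
  ⟨h.1.symm, by rw [Sym2.eq_swap]; exact h.2⟩

lemma latAdj.abs_le {x y : Zd d} (h : latAdj x y) (i : Fin d) : |x i - y i| ≤ 1 := by
  rw [← h]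
  exact Finset.single_le_sum (f := fun i => |x i - y i|) (fun _ _ => abs_nonneg _)
    (Finset.mem_univ i)

/-- `x` and `y` are connected by an open path inside `S`. -/
def Conn (ω : Config d) (S : Set (Zd d)) (x y : Zd d) : Prop :=
  x ∈ S ∧ Relation.ReflTransGen (fun a b => openAdj ω a b ∧ b ∈ S) x y

lemma Conn.refl {ω : Config d} {S : Set (Zd d)} {x : Zd d} (h : x ∈ S) : Conn ω S x x :=
  ⟨h, .refl⟩

lemma Conn.mem_left {ω : Config d} {S : Set (Zd d)} {x y : Zd d} (h : Conn ω S x y) : x ∈ S := h.1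

lemma Conn.mem_right {ω : Config d} {S : Set (Zd d)} {x y : Zd d} (h : Conn ω S x y) :
    y ∈ S := by
  rcases h.2.cases_tail with h1 | ⟨_, _, h2⟩
  · rw [h1]; exact h.1
  · exact h2.2

lemma Conn.tail {ω : Config d} {S : Set (Zd d)} {x y z : Zd d} (h : Conn ω S x y)
    (h' : openAdj ω y z) (hz : z ∈ S) : Conn ω S x z := ⟨h.1, h.2.tail ⟨h', hz⟩⟩

lemma Conn.trans {ω : Config d} {S : Set (Zd d)} {x y z : Zd d} (h : Conn ω S x y)
    (h' : Conn ω S y z) : Conn ω S x z := ⟨h.1, h.2.trans h'.2⟩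

lemma Conn.single {ω : Config d} {S : Set (Zd d)} {x y : Zd d} (hx : x ∈ S) (hy : y ∈ S)
    (h : openAdj ω x y) : Conn ω S x y := (Conn.refl hx).tail h hy

/-- Induction along an open path. -/
lemma Conn.induct {ω : Config d} {S : Set (Zd d)} {x : Zd d} {P : Zd d → Prop} (h0 : P x)
    (hs : ∀ y z, Conn ω S x y → P y → openAdj ω y z → z ∈ S → P z) {y : Zd d}
    (h : Conn ω S x y) : P y := by
  obtain ⟨hx, h⟩ := h
  induction h with
  | refl => exact h0
  | tail h1 h2 ih => exact hs _ _ ⟨hx, h1⟩ ih h2.1 h2.2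

lemma Conn.symm {ω : Config d} {S : Set (Zd d)} {x y : Zd d} (h : Conn ω S x y) :
    Conn ω S y x := by
  refine h.induct (P := fun y => Conn ω S y x) (Conn.refl h.1) ?_
  intro y z hy ih hyz hz
  exact (Conn.single hz hy.mem_right hyz.symm).trans ih

lemma Conn.mono_set {ω : Config d} {S T : Set (Zd d)} (hST : S ⊆ T) {x y : Zd d}
    (h : Conn ω S x y) : Conn ω T x y :=
  ⟨hST h.1, Relation.ReflTransGen.mono (fun _ _ h => ⟨h.1, hST h.2⟩) _ _ h.2⟩

/-- The pairs with both endpoints in `S`. -/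
def Ed (S : Set (Zd d)) : Set (Sym2 (Zd d)) := {e | ∀ v ∈ e, v ∈ S}

lemma mk_mem_Ed {S : Set (Zd d)} {x y : Zd d} : s(x, y) ∈ Ed S ↔ x ∈ S ∧ y ∈ S := by
  simp [Ed]

lemma Ed_mono {S T : Set (Zd d)} (h : S ⊆ T) : Ed S ⊆ Ed T := fun _ he v hv => h (he v hv)

lemma Ed_finite {S : Set (Zd d)} (hS : S.Finite) : (Ed S).Finite := by
  have : Ed S = (hS.toFinset.sym2 : Set (Sym2 (Zd d))) := by
    ext e
    rw [Finset.mem_coe, Finset.mem_sym2_iff]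
    simp only [Ed, Set.mem_ofPred_eq, Set.Finite.mem_toFinset]
  rw [this]; exact Finset.finite_toSet _

lemma Conn.congr {ω ω' : Config d} {S : Set (Zd d)} {x y : Zd d} (h : Conn ω S x y)
    (hh : ∀ e ∈ Ed S, ω e = true → ω' e = true) : Conn ω' S x y := by
  refine h.induct (P := fun y => Conn ω' S x y) (Conn.refl h.1) ?_
  intro y z hy ih hyz hz
  exact ih.tail ⟨hyz.1, hh _ (mk_mem_Ed.2 ⟨hy.mem_right, hz⟩) hyz.2⟩ hz

lemma conn_congr {ω ω' : Config d} {S : Set (Zd d)} (hh : ∀ e ∈ Ed S, ω e = ω' e) {x y : Zd d} :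
    Conn ω S x y ↔ Conn ω' S x y :=
  ⟨fun h => h.congr fun e he h => by rw [← hh e he]; exact h,
    fun h => h.congr fun e he h => by rw [hh e he]; exact h⟩

lemma dep_conn (S : Set (Zd d)) (x y : Zd d) : Dep {ω : Config d | Conn ω S x y} (Ed S) :=
  fun _ _ h h1 => (conn_congr h).1 h1

lemma incr_conn (S : Set (Zd d)) (x y : Zd d) : Incr {ω : Config d | Conn ω S x y} :=
  fun _ _ h h1 => h1.congr fun e _ => h e

/-- Sup-norm balls. -/
def Bx (c : Zd d) (n : ℕ) : Set (Zd d) := {x | ∀ i, |x i - c i| ≤ n}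

lemma mem_Bx {c x : Zd d} {n : ℕ} : x ∈ Bx c n ↔ ∀ i, |x i - c i| ≤ n := Iff.rfl

lemma Bx_eq_Icc (c : Zd d) (n : ℕ) :
    Bx c n = Set.Icc (fun i => c i - n) (fun i => c i + n) := by
  ext x
  simp only [Bx, Set.mem_ofPred_eq, Set.mem_Icc, Pi.le_def, abs_le]
  constructor
  · exact fun h => ⟨fun i => by linarith [(h i).1], fun i => by linarith [(h i).2]⟩
  · exact fun h i => ⟨by linarith [h.1 i], by linarith [h.2 i]⟩

lemma Bx_finite (c : Zd d) (n : ℕ) : (Bx c n).Finite := by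
  rw [Bx_eq_Icc]; exact Set.finite_Icc _ _

lemma self_mem_Bx (c : Zd d) (n : ℕ) : c ∈ Bx c n := fun i => by simp

lemma Bx_mono (c : Zd d) {m n : ℕ} (h : m ≤ n) : Bx c m ⊆ Bx c n :=
  fun _ hx i => (hx i).trans (by exact_mod_cast h)

lemma Bx_ncard (c : Zd d) (n : ℕ) : (Bx c n).ncard = (2 * n + 1) ^ d := by
  have : Bx c n = (Finset.Icc (fun i => c i - (n : ℤ)) (fun i => c i + n) : Finset (Zd d)) := by
    rw [Bx_eq_Icc]; simp
  rw [this, Set.ncard_coe_finset, Pi.card_Icc]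
  simp only [Int.card_Icc]
  rw [Finset.prod_congr rfl (g := fun _ => 2 * n + 1), Finset.prod_const, Finset.card_univ,
    Fintype.card_fin]
  intro i _
  omega

lemma exists_Bx (S : Set (Zd d)) (hS : S.Finite) : ∃ n, S ⊆ Bx 0 n := by
  obtain ⟨B, hB⟩ := (hS.image fun x => ∑ i, (x i).natAbs).bddAbove
  refine ⟨B, fun x hx i => ?_⟩
  have h1 : ∑ i, (x i).natAbs ≤ B := hB ⟨x, hx, rfl⟩
  have h2 : (x i).natAbs ≤ ∑ i, (x i).natAbs :=
    Finset.single_le_sum (f := fun i => (x i).natAbs) (fun _ _ => Nat.zero_le _)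
      (Finset.mem_univ i)
  simp only [Pi.zero_apply, sub_zero, Int.abs_eq_natAbs]
  omega

lemma latAdj.mem_Bx {x y : Zd d} (h : latAdj x y) : y ∈ Bx x 1 := fun i => by
  rw [abs_sub_comm]; exact_mod_cast h.abs_le i

lemma latAdj.mem_Bx_succ {c x y : Zd d} {n : ℕ} (h : latAdj x y) (hx : x ∈ Bx c n) :
    y ∈ Bx c (n + 1) := fun i => by
  have h1 := h.abs_le i
  have h2 := hx i
  push_cast
  rw [_root_.abs_le] at h1 h2 ⊢
  constructor <;> linarith [h1.1, h1.2, h2.1, h2.2]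

lemma conn_univ_iff {ω : Config d} {x y : Zd d} :
    Conn ω Set.univ x y ↔ ∃ n, Conn ω (Bx 0 n) x y := by
  constructor
  · intro h
    refine h.induct (P := fun y => ∃ n, Conn ω (Bx 0 n) x y) ?_ ?_
    · obtain ⟨n, hn⟩ := exists_Bx {x} (Set.finite_singleton x)
      exact ⟨n, Conn.refl (hn rfl)⟩
    · rintro y z - ⟨n, hn⟩ hyz -
      exact ⟨n + 1, (hn.mono_set (Bx_mono 0 (Nat.le_succ n))).tail hyz
        (hyz.1.mem_Bx_succ hn.mem_right)⟩
  · rintro ⟨n, h⟩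
    exact h.mono_set (Set.subset_univ _)

lemma measurableSet_conn_univ (x y : Zd d) :
    MeasurableSet {ω : Config d | Conn ω Set.univ x y} := by
  have : {ω : Config d | Conn ω Set.univ x y} = ⋃ n, {ω | Conn ω (Bx 0 n) x y} := by
    ext ω; simp [conn_univ_iff]
  rw [this]
  exact MeasurableSet.iUnion fun n => (dep_conn _ _ _).measurableSet (Ed_finite (Bx_finite 0 n))

lemma mem_cluster_iff {ω : Config d} {y : Zd d} : y ∈ cluster ω ↔ Conn ω Set.univ 0 y := by
  simp [cluster, Conn]

/-- First exit from `A` of an open path. -/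
lemma Conn.exists_exit {ω : Config d} {S A : Set (Zd d)} {x y : Zd d} (h : Conn ω S x y)
    (hx : x ∈ A) (hy : y ∉ A) :
    ∃ u v, Conn ω (S ∩ A) x u ∧ openAdj ω u v ∧ v ∈ S ∧ v ∉ A := by
  have : Conn ω (S ∩ A) x y ∨ ∃ u v, Conn ω (S ∩ A) x u ∧ openAdj ω u v ∧ v ∈ S ∧ v ∉ A := by
    refine h.induct (P := fun y => Conn ω (S ∩ A) x y ∨ _) (Or.inl (Conn.refl ⟨h.1, hx⟩)) ?_
    rintro y z - ih hyz hz
    rcases ih with ih | ih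
    · by_cases hzA : z ∈ A
      · exact Or.inl (ih.tail hyz ⟨hz, hzA⟩)
      · exact Or.inr ⟨y, z, ih, hyz, hz, hzA⟩
    · exact Or.inr ih
  rcases this with h1 | h1
  · exact absurd h1.mem_right.2 hy
  · exact h1

/-! ### Lattice symmetries -/

/-- The symmetry `x ↦ b + σ · (x ∘ π)`. -/
def isom (b : Zd d) (σ : Fin d → ℤˣ) (π : Equiv.Perm (Fin d)) : Zd d ≃ Zd d where
  toFun x := fun j => b j + σ j * x (π j)
  invFun y := fun j => σ (π.symm j) * (y (π.symm j) - b (π.symm j))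
  left_inv x := by
    funext j
    simp only [Equiv.apply_symm_apply, add_sub_cancel_left, ← mul_assoc]
    rw [← Units.val_mul, Int.units_mul_self]; simp
  right_inv y := by
    funext j
    simp only [Equiv.symm_apply_apply, ← mul_assoc]
    rw [← Units.val_mul, Int.units_mul_self]; simp

lemma isom_apply (b : Zd d) (σ : Fin d → ℤˣ) (π : Equiv.Perm (Fin d)) (x : Zd d) (j : Fin d) :
    isom b σ π x j = b j + σ j * x (π j) := rfl

lemma abs_unit_mul (u : ℤˣ) (a : ℤ) : |(u : ℤ) * a| = |a| := by
  rcases Int.units_eq_one_or u with h | h <;> simp [h]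

lemma latAdj_isom (b : Zd d) (σ : Fin d → ℤˣ) (π : Equiv.Perm (Fin d)) (x y : Zd d) :
    latAdj (isom b σ π x) (isom b σ π y) ↔ latAdj x y := by
  unfold latAdj
  have : ∑ i, |isom b σ π x i - isom b σ π y i| = ∑ i, |x (π i) - y (π i)| := by
    refine Finset.sum_congr rfl fun i _ => ?_
    rw [isom_apply, isom_apply, ← abs_unit_mul (σ i) (x (π i) - y (π i))]
    congr 1; ring
  rw [this, Equiv.sum_comp π (fun i => |x i - y i|)]

lemma isom_mem_Bx (b : Zd d) (σ : Fin d → ℤˣ) (π : Equiv.Perm (Fin d)) (c x : Zd d) (n : ℕ) :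
    isom b σ π x ∈ Bx (isom b σ π c) n ↔ x ∈ Bx c n := by
  simp only [mem_Bx, isom_apply]
  have : ∀ i, |b i + σ i * x (π i) - (b i + σ i * c (π i))| = |x (π i) - c (π i)| := by
    intro i
    rw [← abs_unit_mul (σ i) (x (π i) - c (π i))]
    congr 1; ring
  simp only [this]
  exact ⟨fun h i => by simpa using h (π.symm i), fun h i => h _⟩

/-- Pull back a configuration by a bijection of the vertices. -/
def pull (φ : Zd d ≃ Zd d) (ω : Config d) : Config d := fun e => ω (Sym2.map φ e)

lemma openAdj_pull {φ : Zd d ≃ Zd d} (hφ : ∀ x y, latAdj (φ x) (φ y) ↔ latAdj x y) (ω : Config d)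
    (x y : Zd d) : openAdj (pull φ ω) x y ↔ openAdj ω (φ x) (φ y) := by
  simp [openAdj, pull, hφ]

lemma Conn.of_pull {φ : Zd d ≃ Zd d} (hφ : ∀ x y, latAdj (φ x) (φ y) ↔ latAdj x y) {ω : Config d}
    {S T : Set (Zd d)} (hST : ∀ x, φ x ∈ T ↔ x ∈ S) {x y : Zd d} :
    Conn (pull φ ω) S x y ↔ Conn ω T (φ x) (φ y) := by
  constructor
  · intro h
    refine h.induct (P := fun y => Conn ω T (φ x) (φ y)) (Conn.refl ((hST x).2 h.1)) ?_
    intro y z _ ih hyz hz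
    exact ih.tail ((openAdj_pull hφ ω y z).1 hyz) ((hST z).2 hz)
  · intro h
    have hx := (hST x).1 h.1
    have := h.induct (P := fun y => Conn (pull φ ω) S x (φ.symm y)) (by simpa using Conn.refl hx)
      (by
        intro y z _ ih hyz hz
        refine ih.tail ((openAdj_pull hφ ω _ _).2 (by simpa using hyz)) ?_
        rw [← hST]; simpa using hz)
    simpa using this

lemma bern_pull (p : unitInterval) (φ : Zd d ≃ Zd d) {A : Set (Config d)} (hA : MeasurableSet A) :
    (bern (fun _ : Sym2 (Zd d) => p)).real {ω | pull φ ω ∈ A} = (bern fun _ => p).real A :=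
  bern_preimage_inj (fun _ => p) (Sym2.map.injective φ.injective) hA

end

section

/-! ### Large boxes touch the infinite cluster -/

variable {d : ℕ}

/-- The ball `Bx 0 m` is connected to infinity. -/
def Jev (d m : ℕ) : Set (Config d) :=
  {ω | ∀ n, ∃ x ∈ Bx 0 m, ∃ y ∉ Bx 0 n, Conn ω Set.univ x y}

lemma cluster_infinite_subset : {ω : Config d | (cluster ω).Infinite} ⊆ Jev d 0 := by
  intro ω hω n
  obtain ⟨y, hy, hyn⟩ := hω.exists_notMem_finite (Bx_finite 0 n)
  exact ⟨0, self_mem_Bx 0 0, y, hyn, mem_cluster_iff.1 hy⟩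

lemma dep_Jev (m : ℕ) : Dep (Jev d m) (Ed (Bx 0 m))ᶜ := by
  intro ω ω' h hω n
  obtain ⟨x, hx, y, hy, hxy⟩ := hω n
  have : ∃ x' ∈ Bx 0 m, Conn ω' Set.univ x' y := by
    refine hxy.induct (P := fun y => ∃ x' ∈ Bx 0 m, Conn ω' Set.univ x' y)
      ⟨x, hx, Conn.refl trivial⟩ ?_
    rintro a b - ⟨x', hx', ih⟩ hab -
    by_cases hb : b ∈ Bx 0 m
    · exact ⟨b, hb, Conn.refl trivial⟩
    · refine ⟨x', hx', ih.tail ⟨hab.1, ?_⟩ trivial⟩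
      rw [← h _ fun he => hb (mk_mem_Ed.1 he).2]
      exact hab.2
  obtain ⟨x', hx', h'⟩ := this
  exact ⟨x', hx', y, hy, h'⟩

lemma measurableSet_Jev (m : ℕ) : MeasurableSet (Jev d m) := by
  have : Jev d m = ⋂ n, ⋃ x ∈ Bx 0 m, ⋃ y ∈ (Bx 0 n)ᶜ, {ω | Conn ω Set.univ x y} := by
    ext ω; simp [Jev]
  rw [this]
  exact MeasurableSet.iInter fun n => MeasurableSet.biUnion (Set.to_countable _) fun x _ =>
    MeasurableSet.biUnion (Set.to_countable _) fun y _ => measurableSet_conn_univ x y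

lemma Jev_mono : Monotone (Jev d) := by
  intro m m' h ω hω n
  obtain ⟨x, hx, y, hy, hxy⟩ := hω n
  exact ⟨x, Bx_mono 0 h hx, y, hy, hxy⟩

lemma bern_iUnion_Jev (p : unitInterval) :
    bern (fun _ : Sym2 (Zd d) => p) (⋃ m, Jev d m) = 0 ∨
      bern (fun _ : Sym2 (Zd d) => p) (⋃ m, Jev d m) = 1 := by
  have hi : ProbabilityTheory.iIndepFun (fun i (ω : Config d) => ω i) (bern fun _ => p) :=
    ProbabilityTheory.iIndepFun_infinitePi (X := fun i (b : Bool) => b) (fun i => measurable_id)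
  refine ProbabilityTheory.measure_zero_or_one_of_measurableSet_limsup
    (f := Filter.cofinite)
    (s := fun e : Sym2 (Zd d) => MeasurableSpace.comap (fun ω : Config d => ω e) inferInstance)
    (p := fun t => t.Finite) (ns := fun n : ℕ => Ed (Bx 0 n))
    (fun i => (measurable_pi_apply i).comap_le) hi.iIndep ?_ ?_ ?_ ?_ ?_
  · intro t ht
    exact Filter.mem_cofinite.2 (by simpa using ht)
  · exact Monotone.directed_le fun m n h => Ed_mono (Bx_mono 0 h)
  · exact fun n => Ed_finite (Bx_finite 0 n)
  · intro e
    induction e using Sym2.inductionOn with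
    | hf x y =>
      obtain ⟨n, hn⟩ := exists_Bx {x, y} (by simp)
      exact ⟨n, mk_mem_Ed.2 ⟨hn (by simp), hn (by simp)⟩⟩
  · rw [Filter.limsup_eq_iInf_iSup, MeasurableSpace.measurableSet_iInf]
    intro t
    rw [MeasurableSpace.measurableSet_iInf]
    intro ht
    have hfin : (⋃ e ∈ tᶜ, {v : Zd d | v ∈ e}).Finite := by
      refine Set.Finite.biUnion (Filter.mem_cofinite.1 ht) fun e _ => ?_
      induction e using Sym2.inductionOn with
      | hf x y =>
        have : {v | v ∈ s(x, y)} = {x, y} := by ext v; simp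
        rw [this]; simp
    obtain ⟨m, hm⟩ := exists_Bx _ hfin
    have hU : (⋃ n, Jev d n) = ⋃ n, Jev d (n + m) := by
      refine Set.Subset.antisymm (Set.iUnion_subset fun n => ?_) (Set.iUnion_subset fun n => ?_)
      · exact (Jev_mono (Nat.le_add_right n m)).trans (Set.subset_iUnion (fun n => Jev d (n + m)) n)
      · exact Set.subset_iUnion (Jev d) (n + m)
    rw [hU]
    refine Dep.measurableSet_iSup (Dep.iUnion fun n => (dep_Jev (n + m)).mono ?_)
      (MeasurableSet.iUnion fun n => measurableSet_Jev _)
    intro e he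
    by_contra het
    refine he fun v hv => Bx_mono 0 (Nat.le_add_left m n) (hm ?_)
    simp only [Set.mem_iUnion]
    exact ⟨e, het, hv⟩

lemma tendsto_Jev {p : unitInterval}
    (h : bern (fun _ : Sym2 (Zd d) => p) {ω | (cluster ω).Infinite} ≠ 0) :
    Filter.Tendsto (fun m => (bern fun _ => p).real (Jev d m)) Filter.atTop (nhds 1) := by
  have h1 : bern (fun _ : Sym2 (Zd d) => p) (⋃ m, Jev d m) = 1 := by
    refine (bern_iUnion_Jev p).resolve_left fun h0 => h ?_
    exact measure_mono_null (cluster_infinite_subset.trans (Set.subset_iUnion _ _)) h0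
  have h2 := tendsto_measure_iUnion_atTop (μ := bern fun _ => p) (Jev_mono (d := d))
  rw [h1] at h2
  have := (ENNReal.tendsto_toReal ENNReal.one_ne_top).comp h2
  rw [ENNReal.toReal_one] at this
  exact this

end

section

/-! ### Many connections from a large box to the faces of a larger box -/

variable {d : ℕ}

/-- The points of `∂Λ_n` connected to `Λ_m` in `Λ_n`. -/
def touched (m n : ℕ) (ω : Config d) : Set (Zd d) :=
  {z | (∃ i, |z i| = n) ∧ ∃ a ∈ Bx 0 m, Conn ω (Bx 0 n) a z}

lemma touched_subset (m n : ℕ) (ω : Config d) : touched m n ω ⊆ Bx 0 n :=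
  fun _ hz => hz.2.choose_spec.2.mem_right

lemma touched_finite (m n : ℕ) (ω : Config d) : (touched m n ω).Finite :=
  (Bx_finite 0 n).subset (touched_subset m n ω)

lemma touched_congr {m n : ℕ} {ω ω' : Config d} (h : ∀ e ∈ Ed (Bx 0 n), ω e = ω' e) :
    touched m n ω = touched m n ω' := by
  ext z
  simp only [touched, Set.mem_ofPred_eq, conn_congr h]

lemma dep_touched (m n : ℕ) (P : Set (Zd d) → Prop) :
    Dep {ω | P (touched m n ω)} (Ed (Bx (0 : Zd d) n)) := by
  intro ω ω' h h1
  simp only [Set.mem_ofPred_eq] at h1 ⊢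
  rwa [← touched_congr h]

/-- The pairs joining `touched m n ω` to the complement of `Λ_n`. -/
def outEdges (m n : ℕ) (ω : Config d) : Set (Sym2 (Zd d)) :=
  {e | ∃ z ∈ touched m n ω, ∃ z' ∉ Bx (0 : Zd d) n, latAdj z z' ∧ e = s(z, z')}

lemma outEdges_subset (m n : ℕ) (ω : Config d) :
    outEdges m n ω ⊆ Ed (Bx 0 (n + 1)) \ Ed (Bx 0 n) := by
  rintro e ⟨z, hz, z', hz', hzz, rfl⟩
  have h1 := touched_subset m n ω hz
  exact ⟨mk_mem_Ed.2 ⟨Bx_mono 0 (Nat.le_succ n) h1, hzz.mem_Bx_succ h1⟩,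
    fun h => hz' (mk_mem_Ed.1 h).2⟩

lemma outEdges_finite (m n : ℕ) (ω : Config d) : (outEdges m n ω).Finite :=
  ((Ed_finite (Bx_finite 0 (n + 1))).subset Set.sdiff_subset).subset (outEdges_subset m n ω)

lemma outEdges_ncard_le (m n : ℕ) (ω : Config d) :
    (outEdges m n ω).ncard ≤ 3 ^ d * (touched m n ω).ncard := by
  classical
  set T := (touched_finite m n ω).toFinset with hT
  have hsub : outEdges m n ω ⊆
      ((T.biUnion fun z => (Bx_finite z 1).toFinset.image fun z' => s(z, z') :
        Finset (Sym2 (Zd d))) : Set (Sym2 (Zd d))) := by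
    rintro e ⟨z, hz, z', hz', hzz, rfl⟩
    simp only [Finset.coe_biUnion, Set.mem_iUnion, Finset.mem_coe, Finset.mem_image,
      Set.Finite.mem_toFinset]
    exact ⟨z, by simpa [hT] using hz, z', hzz.mem_Bx, rfl⟩
  refine (Set.ncard_le_ncard hsub (Finset.finite_toSet _)).trans ?_
  rw [Set.ncard_coe_finset, Set.ncard_eq_toFinset_card _ (touched_finite m n ω), mul_comm]
  refine Finset.card_biUnion_le_card_mul _ _ _ fun z _ => Finset.card_image_le.trans ?_
  rw [← Set.ncard_eq_toFinset_card _ (Bx_finite z 1), Bx_ncard]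

lemma touched_succ_empty {m n : ℕ} (hmn : m ≤ n) {ω : Config d}
    (h : ∀ e ∈ outEdges m n ω, ω e = false) : touched m (n + 1) ω = ∅ := by
  by_contra hne
  obtain ⟨z, ⟨i, hi⟩, a, ha, haz⟩ := Set.nonempty_iff_ne_empty.2 hne
  have hzn : z ∉ Bx 0 n := by
    intro hz
    have := hz i
    simp only [Pi.zero_apply, sub_zero, hi] at this
    push_cast at this
    linarith
  obtain ⟨u, v, h1, h2, h3, h4⟩ := haz.exists_exit (Bx_mono 0 hmn ha) hzn
  have h5 : u ∈ touched m n ω := by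
    have hu : Conn ω (Bx 0 n) a u := h1.mono_set Set.inter_subset_right
    refine ⟨?_, a, ha, hu⟩
    by_contra hcon
    push Not at hcon
    refine h4 fun j => ?_
    have h6 := hu.mem_right j
    have h7 := hcon j
    have h8 := h2.1.abs_le j
    simp only [Pi.zero_apply, sub_zero] at h6 ⊢
    have h9 : |u j| + 1 ≤ n := by omega
    have h10 : |v j| ≤ |u j| + |u j - v j| := by
      have := abs_sub_abs_le_abs_sub (v j) (u j)
      rw [abs_sub_comm] at this
      linarith
    linarith
  have := h _ ⟨u, h5, v, h4, h2.1, rfl⟩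
  rw [h2.2] at this
  exact absurd this (by simp)

lemma touched_succ_empty' {m n : ℕ} (hmn : m ≤ n) {ω : Config d} (h : touched m n ω = ∅) :
    touched m (n + 1) ω = ∅ := by
  refine touched_succ_empty hmn ?_
  rintro e ⟨z, hz, -⟩
  simp [h] at hz

lemma Jev_subset_touched {m n : ℕ} (hmn : m ≤ n) :
    Jev d m ⊆ {ω | (touched m n ω).Nonempty} := by
  intro ω hω
  obtain ⟨x, hx, y, hy, hxy⟩ := hω n
  obtain ⟨u, v, h1, h2, -, h4⟩ := hxy.exists_exit (Bx_mono 0 hmn hx) hy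
  rw [Set.univ_inter] at h1
  refine ⟨u, ?_, x, hx, h1⟩
  by_contra hcon
  push Not at hcon
  refine h4 fun j => ?_
  have h6 := h1.mem_right j
  have h7 := hcon j
  have h8 := h2.1.abs_le j
  simp only [Pi.zero_apply, sub_zero] at h6 ⊢
  have h9 : |u j| + 1 ≤ n := by omega
  have h10 : |v j| ≤ |u j| + |u j - v j| := by
    have := abs_sub_abs_le_abs_sub (v j) (u j)
    rw [abs_sub_comm] at this
    linarith
  linarith

lemma measurable_touched (m n : ℕ) (P : Set (Zd d) → Prop) :
    MeasurableSet {ω | P (touched m n ω)} :=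
  (dep_touched m n P).measurableSet (Ed_finite (Bx_finite 0 n))

lemma few_touched_le (p : unitInterval) (m n k : ℕ) (hmn : m ≤ n) :
    (bern (fun _ => p)).real
      {ω : Config d | (touched m n ω).Nonempty ∧ (touched m n ω).ncard < k} *
      (1 - p : ℝ) ^ (3 ^ d * k) ≤
    (bern (fun _ => p)).real {ω : Config d | (touched m n ω).Nonempty} -
      (bern (fun _ => p)).real {ω : Config d | (touched m (n + 1) ω).Nonempty} := by
  classical
  set G := {ω : Config d | (touched m n ω).Nonempty ∧ (touched m n ω).ncard < k} with hG
  let X : Config d → Finset (Sym2 (Zd d)) := fun ω => (outEdges_finite m n ω).toFinset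
  have hfin := (Ed_finite (Bx_finite (0 : Zd d) (n + 1))).subset
    (Set.sdiff_subset (t := Ed (Bx 0 n)))
  have hdepX : ∀ T, Dep {ω | ω ∈ G ∧ X ω = T} (Ed (Bx (0 : Zd d) n)) := by
    intro T ω ω' h h1
    have h2 := touched_congr (m := m) h
    have h3 : X ω = X ω' := by
      simp only [X, outEdges, h2]
    simp only [hG, Set.mem_ofPred_eq] at h1 ⊢
    rwa [← h2, ← h3]
  have h1 := random_closed (fun _ => p) hfin.toFinset X G (Ed_finite (Bx_finite 0 n))
    (fun ω _ e he => by
      simp only [X, Set.Finite.mem_toFinset] at he ⊢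
      exact outEdges_subset m n ω he) id Function.injective_id (a := p) (fun _ _ => rfl) hdepX
    (fun e he => (by simpa using he : e ∈ Ed (Bx 0 (n + 1)) ∧ e ∉ Ed (Bx 0 n)).2)
  have h2 : (bern (fun _ => p)).real G = ∑ T ∈ hfin.toFinset.powerset,
      (bern fun _ => p).real {ω | ω ∈ G ∧ X ω = T} := by
    refine real_eq_sum _ X _ (fun ω _ => ?_) (fun T _ => ?_)
    · rw [Finset.mem_powerset]
      intro e he
      simp only [X, Set.Finite.mem_toFinset] at he ⊢
      exact outEdges_subset m n ω he
    · exact (hdepX T).measurableSet (Ed_finite (Bx_finite 0 n))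
  have hp0 : 0 ≤ (1 - p : ℝ) := sub_nonneg.2 p.2.2
  have hp1 : (1 - p : ℝ) ≤ 1 := by linarith [p.2.1]
  have h3 : (bern (fun _ => p)).real G * (1 - p : ℝ) ^ (3 ^ d * k) ≤
      (bern fun _ => p).real {ω | ω ∈ G ∧ ∀ e ∈ X ω, ω (id e) = false} := by
    rw [h1, h2, Finset.sum_mul]
    refine Finset.sum_le_sum fun T _ => ?_
    by_cases hne : ∃ ω, ω ∈ G ∧ X ω = T
    · obtain ⟨ω, hω, rfl⟩ := hne
      gcongr ?_ * ?_
      refine pow_le_pow_of_le_one hp0 hp1 ?_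
      rw [← Set.ncard_eq_toFinset_card _ (outEdges_finite m n ω)]
      exact (outEdges_ncard_le m n ω).trans (Nat.mul_le_mul_left _ hω.2.le)
    · have : {ω | ω ∈ G ∧ X ω = T} = ∅ := by
        ext ω; simp only [Set.mem_ofPred_eq, Set.mem_empty_iff_false, iff_false]
        exact fun h => hne ⟨ω, h⟩
      simp [this]
  refine h3.trans ?_
  have hsub : {ω : Config d | (touched m (n + 1) ω).Nonempty} ⊆
      {ω : Config d | (touched m n ω).Nonempty} := by
    intro ω hω
    by_contra hcon
    have := touched_succ_empty' hmn (Set.not_nonempty_iff_eq_empty.1 hcon)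
    simp [this] at hω
  rw [← measureReal_sdiff hsub (measurable_touched _ _ _)]
  refine measureReal_mono ?_
  rintro ω ⟨h4, h5⟩
  refine ⟨h4.1, ?_⟩
  simp only [Set.mem_ofPred_eq, Set.not_nonempty_iff_eq_empty]
  exact touched_succ_empty hmn fun e he => h5 e (by simpa [X] using he)

/-- For `m` large, then `n` large, many points of `∂Λ_n` are connected to `Λ_m`. -/
lemma many_touched {p : unitInterval} (hp : (p : ℝ) < 1)
    (h : bern (fun _ : Sym2 (Zd d) => p) {ω | (cluster ω).Infinite} ≠ 0) {η : ℝ} (hη : 0 < η) :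
    ∃ m0, ∀ m ≥ m0, ∀ k, ∃ n0, ∀ n ≥ n0,
      (bern (fun _ => p)).real {ω : Config d | (touched m n ω).ncard < k} ≤ η := by
  have h1 := (tendsto_Jev h).eventually (lt_mem_nhds (show 1 - η / 2 < 1 by linarith))
  obtain ⟨m0, hm0⟩ := Filter.eventually_atTop.1 h1
  refine ⟨m0, fun m hm k => ?_⟩
  let f : ℕ → ℝ := fun n =>
    (bern (fun _ => p)).real {ω : Config d | (touched m (m + n) ω).Nonempty}
  have hc : 0 < (1 - p : ℝ) ^ (3 ^ d * k) := pow_pos (by linarith) _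
  have hanti : Antitone f := by
    refine antitone_nat_of_succ_le fun n => ?_
    have := few_touched_le (d := d) p m (m + n) k (Nat.le_add_right _ _)
    have h0 := mul_nonneg (measureReal_nonneg (μ := bern (fun _ => p))
      (s := {ω : Config d | (touched m (m + n) ω).Nonempty ∧ (touched m (m + n) ω).ncard < k}))
      hc.le
    simp only [f]
    rw [← add_assoc]
    linarith
  have hlim := tendsto_atTop_ciInf hanti ⟨0, by rintro _ ⟨n, rfl⟩; exact measureReal_nonneg⟩
  have hdiff := hlim.sub (hlim.comp (Filter.tendsto_add_atTop_nat 1))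
  rw [sub_self] at hdiff
  have h2 := hdiff.eventually (gt_mem_nhds
    (show 0 < η / 2 * (1 - p : ℝ) ^ (3 ^ d * k) by positivity))
  obtain ⟨n0, hn0⟩ := Filter.eventually_atTop.1 h2
  refine ⟨m + n0, fun n hn => ?_⟩
  obtain ⟨n', rfl⟩ := Nat.exists_eq_add_of_le (show m ≤ n by omega)
  have h3 := hn0 n' (by omega)
  have h4 := few_touched_le (d := d) p m (m + n') k (Nat.le_add_right _ _)
  have h5 : (bern (fun _ => p)).real {ω : Config d | (touched m (m + n') ω).Nonempty ∧
      (touched m (m + n') ω).ncard < k} < η / 2 := by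
    refine lt_of_mul_lt_mul_right (h4.trans_lt ?_) hc.le
    exact h3
  have h6 : (bern (fun _ => p)).real (Jev d m)ᶜ ≤ η / 2 := by
    rw [probReal_compl_eq_one_sub (measurableSet_Jev m)]
    linarith [hm0 m hm]
  refine (measureReal_mono (s₂ := (Jev d m)ᶜ ∪ {ω : Config d | (touched m (m + n') ω).Nonempty ∧
      (touched m (m + n') ω).ncard < k}) ?_).trans ((measureReal_union_le _ _).trans (by linarith))
  intro ω hω
  by_cases hJ : ω ∈ Jev d m
  · exact Or.inr ⟨Jev_subset_touched (Nat.le_add_right m n') hJ, hω⟩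
  · exact Or.inl hJ

end

section

/-! ### Quadrants of faces -/

variable {d : ℕ}

/-- A quadrant of the face of `Bx b n` orthogonal to axis `i`. -/
def Face (b : Zd d) (n : ℕ) (i : Fin d) (σ : Fin d → ℤˣ) : Set (Zd d) :=
  {z | σ i * (z i - b i) = n ∧ ∀ j, 0 ≤ σ j * (z j - b j) ∧ σ j * (z j - b j) ≤ n}

lemma Face_subset (b : Zd d) (n : ℕ) (i : Fin d) (σ : Fin d → ℤˣ) : Face b n i σ ⊆ Bx b n := by
  intro z hz j
  rw [← abs_unit_mul (σ j), abs_of_nonneg (hz.2 j).1]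
  exact (hz.2 j).2

/-- The points of the quadrant connected to `Bx b m` in `Bx b n`. -/
def tface (b : Zd d) (m n : ℕ) (i : Fin d) (σ : Fin d → ℤˣ) (ω : Config d) : Set (Zd d) :=
  {z | z ∈ Face b n i σ ∧ ∃ a ∈ Bx b m, Conn ω (Bx b n) a z}

lemma tface_subset (b : Zd d) (m n : ℕ) (i : Fin d) (σ : Fin d → ℤˣ) (ω : Config d) :
    tface b m n i σ ω ⊆ Bx b n := fun _ hz => Face_subset b n i σ hz.1

lemma tface_finite (b : Zd d) (m n : ℕ) (i : Fin d) (σ : Fin d → ℤˣ) (ω : Config d) :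
    (tface b m n i σ ω).Finite := (Bx_finite b n).subset (tface_subset b m n i σ ω)

lemma tface_congr {b : Zd d} {m n : ℕ} {i : Fin d} {σ : Fin d → ℤˣ} {ω ω' : Config d}
    (h : ∀ e ∈ Ed (Bx b n), ω e = ω' e) : tface b m n i σ ω = tface b m n i σ ω' := by
  ext z
  simp only [tface, Set.mem_ofPred_eq, conn_congr h]

lemma tface_mono {b : Zd d} {m n : ℕ} {i : Fin d} {σ : Fin d → ℤˣ} {ω ω' : Config d}
    (h : ∀ e, ω e = true → ω' e = true) : tface b m n i σ ω ⊆ tface b m n i σ ω' := by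
  rintro z ⟨hz, a, ha, haz⟩
  exact ⟨hz, a, ha, haz.congr fun e _ => h e⟩

lemma dep_tface (b : Zd d) (m n : ℕ) (i : Fin d) (σ : Fin d → ℤˣ) (P : Set (Zd d) → Prop) :
    Dep {ω | P (tface b m n i σ ω)} (Ed (Bx b n)) := by
  intro ω ω' h h1
  simp only [Set.mem_ofPred_eq] at h1 ⊢
  rwa [← tface_congr h]

lemma tface_pull (b : Zd d) (m n : ℕ) (i i₀ : Fin d) (σ : Fin d → ℤˣ) (ω : Config d) :
    tface 0 m n i₀ 1 (pull (isom b σ (Equiv.swap i i₀)) ω) =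
      isom b σ (Equiv.swap i i₀) ⁻¹' tface b m n i σ ω := by
  set φ := isom b σ (Equiv.swap i i₀) with hφ
  have h0 : φ 0 = b := by funext j; simp [hφ, isom_apply]
  have hlat : ∀ x y, latAdj (φ x) (φ y) ↔ latAdj x y := latAdj_isom _ _ _
  have hBx : ∀ k x, φ x ∈ Bx b k ↔ x ∈ Bx 0 k := by
    intro k x
    rw [← h0]; exact isom_mem_Bx _ _ _ _ _ _
  have hc : ∀ x j, (σ j : ℤ) * (φ x j - b j) = x (Equiv.swap i i₀ j) := by
    intro x j
    rw [hφ, isom_apply, add_sub_cancel_left, ← mul_assoc, ← Units.val_mul, Int.units_mul_self]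
    simp
  ext z
  simp only [tface, Face, Set.mem_ofPred_eq, Set.mem_preimage, hc, Pi.one_apply, Units.val_one,
    one_mul, Pi.zero_apply, sub_zero, Equiv.swap_apply_left]
  refine and_congr (and_congr Iff.rfl ?_) ?_
  · exact ⟨fun h j => h _, fun h j => by simpa using h (Equiv.swap i i₀ j)⟩
  · constructor
    · rintro ⟨a, ha, h⟩
      exact ⟨φ a, (hBx m a).2 ha, (Conn.of_pull hlat (hBx n)).1 h⟩
    · rintro ⟨a, ha, h⟩
      refine ⟨φ.symm a, (hBx m _).1 (by simpa using ha), ?_⟩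
      rw [Conn.of_pull hlat (hBx n)]
      simpa using h

lemma prob_tface_eq (p : unitInterval) (b : Zd d) (m n k : ℕ) (i i₀ : Fin d) (σ : Fin d → ℤˣ) :
    (bern (fun _ => p)).real {ω : Config d | k ≤ (tface b m n i σ ω).ncard} =
      (bern (fun _ => p)).real {ω : Config d | k ≤ (tface 0 m n i₀ 1 ω).ncard} := by
  rw [← bern_pull p (isom b σ (Equiv.swap i i₀))
    ((dep_tface 0 m n i₀ 1 fun s => k ≤ s.ncard).measurableSet (Ed_finite (Bx_finite _ _)))]
  congr 1
  ext ω
  simp only [Set.mem_ofPred_eq, tface_pull]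
  rw [Set.ncard_preimage_of_injective_subset_range (Equiv.injective _) (by simp)]

/-- The touched points are covered by the quadrants. -/
lemma touched_subset_tface (m n : ℕ) (ω : Config d) :
    touched m n ω ⊆ ⋃ q ∈ (Finset.univ : Finset (Fin d × (Fin d → ℤˣ))),
      tface 0 m n q.1 q.2 ω := by
  rintro z ⟨⟨i, hi⟩, a, ha, haz⟩
  simp only [Set.mem_iUnion]
  refine ⟨(i, fun j => if 0 ≤ z j then 1 else -1), Finset.mem_univ _, ?_, a, ha, haz⟩
  have hz : ∀ j, ((if 0 ≤ z j then 1 else -1 : ℤˣ) : ℤ) * (z j - (0 : Zd d) j) = |z j| := by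
    intro j
    split_ifs with h0
    · simp [abs_of_nonneg h0]
    · simp [abs_of_neg (not_le.1 h0)]
  refine ⟨by rw [hz, hi], fun j => ?_⟩
  rw [hz]
  refine ⟨abs_nonneg _, ?_⟩
  simpa using haz.mem_right j

lemma few_tface_le (hd : 0 < d) (p : unitInterval) {η : ℝ} (hη : 0 < η) {m n k : ℕ}
    (h1 : (bern (fun _ => p)).real {ω : Config d | ∀ q : Fin d × (Fin d → ℤˣ),
      (tface 0 m n q.1 q.2 ω).ncard < k} ≤ η ^ Fintype.card (Fin d × (Fin d → ℤˣ)))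
    (b : Zd d) (i : Fin d) (σ : Fin d → ℤˣ) :
    (bern (fun _ => p)).real {ω : Config d | (tface b m n i σ ω).ncard < k} ≤ η := by
  classical
  set Q := Fintype.card (Fin d × (Fin d → ℤˣ)) with hQ
  have : Nonempty (Fin d × (Fin d → ℤˣ)) := ⟨⟨⟨0, hd⟩, 1⟩⟩
  have hQ0 : Q ≠ 0 := Fintype.card_ne_zero
  let A : Fin d × (Fin d → ℤˣ) → Set (Config d) :=
    fun q => {ω | k ≤ (tface 0 m n q.1 q.2 ω).ncard}
  let F := (Ed_finite (Bx_finite (0 : Zd d) n)).toFinset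
  have hA : ∀ q, Dep (A q) F := fun q => by
    simpa [F] using dep_tface 0 m n q.1 q.2 fun s => k ≤ s.ncard
  have iA : ∀ q, Incr (A q) := by
    intro q ω ω' h h1
    exact le_trans h1 (Set.ncard_le_ncard (tface_mono h) (tface_finite _ _ _ _ _ _))
  set a := (bern (fun _ => p)).real {ω : Config d | k ≤ (tface 0 m n i 1 ω).ncard} with ha
  have hAa : ∀ q ∈ Finset.univ, (bern (fun _ => p)).real (A q) = a := fun q _ =>
    prob_tface_eq p 0 m n k q.1 i q.2
  have h2 := sqrt_trick (fun _ => p) F Finset.univ hA iA hAa (ε := η ^ Q) (by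
    refine (measureReal_mono ?_).trans h1
    intro ω hω q
    simpa [A] using hω q (Finset.mem_univ q))
  rw [Finset.card_univ, ← hQ] at h2
  have h3 : 1 - a ≤ η := le_of_pow_le_pow_left₀ hQ0 hη.le h2
  have h4 : {ω : Config d | (tface b m n i σ ω).ncard < k} =
      {ω : Config d | k ≤ (tface b m n i σ ω).ncard}ᶜ := by
    ext ω; simp
  rw [h4, probReal_compl_eq_one_sub
    ((dep_tface b m n i σ fun s => k ≤ s.ncard).measurableSet (Ed_finite (Bx_finite _ _))),
    prob_tface_eq p b m n k i i σ]
  exact h3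

lemma many_tface (hd : 0 < d) {p : unitInterval} (hp : (p : ℝ) < 1)
    (h : bern (fun _ : Sym2 (Zd d) => p) {ω | (cluster ω).Infinite} ≠ 0) {η : ℝ} (hη : 0 < η) :
    ∃ m0, ∀ m ≥ m0, ∀ k, ∃ n0, ∀ n ≥ n0, ∀ b i σ,
      (bern (fun _ => p)).real {ω : Config d | (tface b m n i σ ω).ncard < k} ≤ η := by
  set Q := Fintype.card (Fin d × (Fin d → ℤˣ)) with hQ
  have : Nonempty (Fin d × (Fin d → ℤˣ)) := ⟨⟨⟨0, hd⟩, 1⟩⟩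
  obtain ⟨m0, hm0⟩ := many_touched hp h (pow_pos hη Q)
  refine ⟨m0, fun m hm k => ?_⟩
  obtain ⟨n0, hn0⟩ := hm0 m hm (Q * k)
  refine ⟨n0, fun n hn => few_tface_le hd p hη ((measureReal_mono ?_).trans (hn0 n hn))⟩
  intro ω hlt
  have hle : (touched m n ω).ncard ≤ ∑ q ∈ (Finset.univ : Finset (Fin d × (Fin d → ℤˣ))),
      (tface 0 m n q.1 q.2 ω).ncard :=
    (Set.ncard_le_ncard (touched_subset_tface m n ω) (Set.Finite.biUnion (Finset.finite_toSet _)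
      fun q _ => tface_finite _ _ _ _ _ _)).trans (Finset.set_ncard_biUnion_le _ _)
  refine hle.trans_lt ?_
  refine (Finset.sum_lt_sum_of_nonempty Finset.univ_nonempty fun q _ => hlt q).trans_le ?_
  simp [hQ]

/-- A large box touches every quadrant of every larger box with high probability. -/
lemma exists_tface_nonempty (hd : 0 < d) {p : unitInterval}
    (h : bern (fun _ : Sym2 (Zd d) => p) {ω | (cluster ω).Infinite} ≠ 0) {η : ℝ} (hη : 0 < η) :
    ∃ m0, ∀ m ≥ m0, ∀ n ≥ m, ∀ i σ,
      (bern (fun _ => p)).real {ω : Config d | tface 0 m n i σ ω = ∅} ≤ η := by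
  have h1 := (tendsto_Jev h).eventually (lt_mem_nhds (show
    1 - η ^ Fintype.card (Fin d × (Fin d → ℤˣ)) < 1 by
      have := pow_pos hη (Fintype.card (Fin d × (Fin d → ℤˣ)))
      linarith))
  obtain ⟨m0, hm0⟩ := Filter.eventually_atTop.1 h1
  refine ⟨m0, fun m hm n hn i σ => ?_⟩
  have h2 := few_tface_le (m := m) (n := n) (k := 1) hd p hη ?_ 0 i σ
  · refine (measureReal_mono ?_).trans h2
    intro ω hω
    simp only [Set.mem_ofPred_eq] at hω ⊢
    simp [hω]
  · have h3 := hm0 m hm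
    have h4 : {ω : Config d | ∀ q : Fin d × (Fin d → ℤˣ), (tface 0 m n q.1 q.2 ω).ncard < 1} ⊆
        (Jev d m)ᶜ := by
      intro ω hω hJ
      obtain ⟨z, hz⟩ := Jev_subset_touched hn hJ
      obtain ⟨q, -, hq⟩ := Set.mem_iUnion₂.1 (touched_subset_tface m n ω hz)
      have := hω q
      rw [Nat.lt_one_iff, Set.ncard_eq_zero (tface_finite _ _ _ _ _ _)] at this
      rw [this] at hq
      exact hq
    refine (measureReal_mono h4).trans ?_
    rw [probReal_compl_eq_one_sub (measurableSet_Jev m)]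
    linarith

end

section

/-! ### Coloured configurations -/

variable {d : ℕ} {K : Type*}

/-- The restriction of a coloured configuration to one colour. -/
def col (η : Sym2 (Zd d) × Option K → Bool) (k : Option K) : Config d := fun e => η (e, k)

/-- The weights of a base configuration of density `p` and sprinklings of density `δ`. -/
def wts (p δ : unitInterval) : Sym2 (Zd d) × Option K → unitInterval :=
  fun i => i.2.elim p fun _ => δ

/-- The centre of the seed attached to `z`. -/
def seedC (m : ℕ) (i : Fin d) (σ : Fin d → ℤˣ) (z : Zd d) : Zd d :=
  Function.update z i (z i + σ i * (m + 1))

/-- The edges of the seed attached to `z`. -/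
def seedEd (m : ℕ) (i : Fin d) (σ : Fin d → ℤˣ) (z : Zd d) : Set (Sym2 (Zd d)) :=
  Ed (Bx (seedC m i σ z) m) ∪ {s(z, Function.update z i (z i + σ i))}

/-- All the edges of the seed attached to `z` are open. -/
def seedOpen (m : ℕ) (i : Fin d) (σ : Fin d → ℤˣ) (z : Zd d) (ω : Config d) : Prop :=
  ∀ e ∈ seedEd m i σ z, ω e = true

lemma seedEd_finite (m : ℕ) (i : Fin d) (σ : Fin d → ℤˣ) (z : Zd d) : (seedEd m i σ z).Finite :=
  (Ed_finite (Bx_finite _ _)).union (Set.finite_singleton _)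

lemma Ed_ncard_le {S : Set (Zd d)} (hS : S.Finite) : (Ed S).ncard ≤ S.ncard ^ 2 := by
  have : Ed S ⊆ (fun q : Zd d × Zd d => s(q.1, q.2)) '' (S ×ˢ S) := by
    intro e he
    induction e with
    | h x y => exact ⟨(x, y), mk_mem_Ed.1 he, rfl⟩
  refine (Set.ncard_le_ncard this ((hS.prod hS).image _)).trans ?_
  refine (Set.ncard_image_le (hS.prod hS)).trans ?_
  rw [Set.ncard_prod, sq]

lemma seedEd_ncard_le (m : ℕ) (i : Fin d) (σ : Fin d → ℤˣ) (z : Zd d) :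
    (seedEd m i σ z).ncard ≤ ((2 * m + 1) ^ d) ^ 2 + 1 := by
  refine (Set.ncard_union_le _ _).trans ?_
  rw [Set.ncard_singleton]
  gcongr
  refine (Ed_ncard_le (Bx_finite _ _)).trans ?_
  rw [Bx_ncard]

lemma int_unit_sq (u : ℤˣ) : (u : ℤ) * u = 1 := by
  rw [← Units.val_mul, Int.units_mul_self]; rfl

lemma mem_seedEd {m : ℕ} {i : Fin d} {σ : Fin d → ℤˣ} {z x : Zd d} {e : Sym2 (Zd d)}
    (he : e ∈ seedEd m i σ z) (hx : x ∈ e) : ∀ j ≠ i, |x j - z j| ≤ m := by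
  intro j hj
  rcases he with he | he
  · simpa [seedC, hj] using he x hx j
  · rw [Set.mem_singleton_iff] at he
    subst he
    rcases Sym2.mem_iff.1 hx with rfl | rfl
    · simp
    · simp [hj]

lemma seedEd_outside {m n : ℕ} {b : Zd d} {i : Fin d} {σ : Fin d → ℤˣ} {z : Zd d}
    (hz : z ∈ Face b n i σ) {e : Sym2 (Zd d)} (he : e ∈ seedEd m i σ z) : e ∉ Ed (Bx b n) := by
  have hout : ∀ x : Zd d, (n : ℤ) + 1 ≤ σ i * (x i - b i) → x ∉ Bx b n := by
    intro x hx h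
    have := h i
    rw [← abs_unit_mul (σ i)] at this
    have := (le_abs_self _).trans this
    omega
  have hz1 := hz.1
  have hs := int_unit_sq (σ i)
  intro h
  rcases he with he | he
  · induction e with
    | h x y =>
    refine hout x ?_ (h x (by simp))
    have h1 := he x (by simp) i
    rw [← abs_unit_mul (σ i)] at h1
    have h2 := (_root_.abs_le.1 h1).1
    have h3 : (σ i : ℤ) * (x i - seedC m i σ z i) = σ i * (x i - b i) - n - (m + 1) := by
      rw [← hz1]
      simp only [seedC, Function.update_self]
      linear_combination (-(m:ℤ) - 1) * hs
    rw [h3] at h2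
    linarith
  · rw [Set.mem_singleton_iff] at he
    subst he
    refine hout _ ?_ (h (Function.update z i (z i + σ i)) (by simp))
    simp only [Function.update_self]
    have : (σ i : ℤ) * (z i + σ i - b i) = n + 1 := by rw [← hz1]; linear_combination hs
    rw [this]

/-- The probability that none of many disjoint seeds is open. -/
lemma prob_no_seed {p δ : unitInterval} {m : ℕ} {i : Fin d} {σ : Fin d → ℤˣ} (κ : K)
    (s : Finset (Zd d))
    (hd : ∀ z ∈ s, ∀ z' ∈ s, z ≠ z' → Disjoint (seedEd m i σ z) (seedEd m i σ z')) :
    (bern (wts p δ)).real {η | ∀ z ∈ s, ¬ seedOpen m i σ z (col η (some κ))} ≤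
      (1 - (δ : ℝ) ^ (((2 * m + 1) ^ d) ^ 2 + 1)) ^ s.card := by
  classical
  have hdep : ∀ z, Dep {η : Sym2 (Zd d) × Option K → Bool | ¬ seedOpen m i σ z (col η (some κ))}
      ((fun e => (e, some κ)) '' seedEd m i σ z) := by
    intro z η η' h h1 h2
    refine h1 fun e he => ?_
    have := h (e, some κ) ⟨e, he, rfl⟩
    have h3 := h2 e he
    simp only [col] at h3 ⊢
    rw [this]; exact h3
  have hfin : ∀ z, ((fun e => (e, some κ)) '' seedEd m i σ z).Finite := fun z =>
    (seedEd_finite m i σ z).image _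
  have hone : ∀ z, (bern (wts p δ)).real {η : Sym2 (Zd d) × Option K → Bool |
      ¬ seedOpen m i σ z (col η (some κ))} ≤ 1 - (δ : ℝ) ^ (((2 * m + 1) ^ d) ^ 2 + 1) := by
    intro z
    have h1 := bern_all_true (wts p δ : Sym2 (Zd d) × Option K → unitInterval) (hfin z).toFinset
    have h2 : {η : Sym2 (Zd d) × Option K → Bool | ¬ seedOpen m i σ z (col η (some κ))} =
        {η | ∀ e ∈ (hfin z).toFinset, η e = true}ᶜ := by
      ext η
      simp [seedOpen, col]
    have hmeas := ((hdep z).measurableSet (hfin z)).compl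
    rw [h2, compl_compl] at hmeas
    rw [h2, probReal_compl_eq_one_sub hmeas, h1]
    have h3 : ∏ e ∈ (hfin z).toFinset, ((wts p δ e : unitInterval) : ℝ) =
        (δ : ℝ) ^ (hfin z).toFinset.card := by
      rw [← Finset.prod_const]
      refine Finset.prod_congr rfl fun e he => ?_
      simp only [Set.Finite.mem_toFinset, Set.mem_image] at he
      obtain ⟨e', -, rfl⟩ := he
      rfl
    rw [h3]
    have h4 : (hfin z).toFinset.card ≤ ((2 * m + 1) ^ d) ^ 2 + 1 := by
      rw [← Set.ncard_eq_toFinset_card _ (hfin z)]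
      exact (Set.ncard_image_le (seedEd_finite m i σ z)).trans (seedEd_ncard_le m i σ z)
    have := pow_le_pow_of_le_one δ.2.1 δ.2.2 h4
    linarith
  induction s using Finset.induction_on with
  | empty => simp
  | insert z s hz ih =>
    have e : {η : Sym2 (Zd d) × Option K → Bool |
        ∀ z' ∈ insert z s, ¬ seedOpen m i σ z' (col η (some κ))} =
        {η | ¬ seedOpen m i σ z (col η (some κ))} ∩
        {η | ∀ z' ∈ s, ¬ seedOpen m i σ z' (col η (some κ))} := by
      ext η; simp
    have hdep2 : Dep {η : Sym2 (Zd d) × Option K → Bool |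
        ∀ z' ∈ s, ¬ seedOpen m i σ z' (col η (some κ))}
        (⋃ z' ∈ s, (fun e => (e, some κ)) '' seedEd m i σ z') := by
      intro η η' h h1 z' hz'
      exact hdep z' η η' (fun j hj => h j (Set.mem_biUnion hz' hj)) (h1 z' hz')
    have hdis : Disjoint ((fun e => ((e, some κ) : Sym2 (Zd d) × Option K)) '' seedEd m i σ z)
        (⋃ z' ∈ s, (fun e => (e, some κ)) '' seedEd m i σ z') := by
      rw [Set.disjoint_iUnion₂_right]
      intro z' hz'
      refine (Set.disjoint_image_iff fun a b h => (Prod.mk.inj h).1).2 ?_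
      exact hd z (by simp) z' (by simp [hz']) (by rintro rfl; exact hz hz')
    rw [e, bern_inter _ (hdep z) hdep2 hdis ((hdep z).measurableSet (hfin z))
      (hdep2.measurableSet (s.finite_toSet.biUnion fun z' _ => hfin z')),
      Finset.card_insert_of_notMem hz, pow_succ, mul_comm]
    have hn : (0 : ℝ) ≤ 1 - (δ : ℝ) ^ (((2 * m + 1) ^ d) ^ 2 + 1) := by
      have := pow_le_one₀ (n := ((2 * m + 1) ^ d) ^ 2 + 1) δ.2.1 δ.2.2
      linarith
    exact mul_le_mul (ih fun z hz z' hz' => hd z (by simp [hz]) z' (by simp [hz'])) (hone z)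
      measureReal_nonneg (pow_nonneg hn _)

/-- Many points of a face contain many points with disjoint seeds. -/
lemma exists_disjoint_seeds {m n k : ℕ} {b : Zd d} {i : Fin d} {σ : Fin d → ℤˣ}
    {T : Set (Zd d)} (hT : T ⊆ Face b n i σ) (hk : (2 * m + 2) ^ d * k ≤ T.ncard) :
    ∃ s : Finset (Zd d), (s : Set (Zd d)) ⊆ T ∧ k ≤ s.card ∧
      ∀ z ∈ s, ∀ z' ∈ s, z ≠ z' → Disjoint (seedEd m i σ z) (seedEd m i σ z') := by
  classical
  have hfin : T.Finite := (Bx_finite b n).subset (hT.trans (Face_subset b n i σ))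
  let f : Zd d → (Fin d → ZMod (2 * m + 2)) := fun z j => (z j : ZMod (2 * m + 2))
  have hcard : (Finset.univ : Finset (Fin d → ZMod (2 * m + 2))).card • k ≤ hfin.toFinset.card := by
    rw [← Set.ncard_eq_toFinset_card _ hfin, Finset.card_univ, Fintype.card_pi, smul_eq_mul]
    simpa [ZMod.card] using hk
  obtain ⟨y, -, hy⟩ := Finset.exists_le_card_fiber_of_nsmul_le_card_of_maps_to
    (s := hfin.toFinset) (f := f) (t := Finset.univ) (fun _ _ => Finset.mem_univ _)
    Finset.univ_nonempty hcard
  refine ⟨_, fun z hz => ?_, hy, ?_⟩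
  · simp only [Finset.coe_filter, Set.Finite.mem_toFinset] at hz
    exact hz.1
  · intro z hz z' hz' hne
    simp only [Finset.mem_filter, Set.Finite.mem_toFinset] at hz hz'
    rw [Set.disjoint_left]
    intro e he he'
    obtain ⟨x, hx⟩ : ∃ x, x ∈ e := by
      induction e with
      | h x y => exact ⟨x, by simp⟩
    have hi : z i = z' i := by
      have h1 := (hT hz.1).1
      have h2 := (hT hz'.1).1
      have h3 : (σ i : ℤ) * (z i - b i) = σ i * (z' i - b i) := h1.trans h2.symm
      have := mul_left_cancel₀ (Units.ne_zero (σ i)) h3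
      linarith
    refine hne (funext fun j => ?_)
    by_cases hj : j = i
    · rw [hj, hi]
    have h1 := mem_seedEd he hx j hj
    have h2 := mem_seedEd he' hx j hj
    have h3 : ((z j - z' j : ℤ) : ZMod (2 * m + 2)) = 0 := by
      have := congrFun (hz.2.trans hz'.2.symm) j
      simp only [f] at this
      push_cast
      rw [this, sub_self]
    have h4 := (ZMod.intCast_zmod_eq_zero_iff_dvd _ _).1 h3
    have h5 : |z j - z' j| < (2 * m + 2 : ℕ) := by
      have := abs_sub_le (z j) (x j) (z' j)
      rw [abs_sub_comm (z j) (x j)] at this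
      push_cast
      linarith
    have := Int.eq_zero_of_abs_lt_dvd h4 h5
    linarith

end

section

/-! ### Growing a connection by sprinkling -/

variable {d : ℕ} {K : Type*}

/-- The points reached from `R` by a sprinkled edge and base edges, inside `Bx b n`. -/
def grown (b : Zd d) (n : ℕ) (κ : K) (R : Set (Zd d)) (η : Sym2 (Zd d) × Option K → Bool) :
    Set (Zd d) :=
  {y | ∃ r ∈ R ∩ Bx b n, ∃ y₀, latAdj r y₀ ∧ η (s(r, y₀), some κ) = true ∧
    Conn (col η none) (Bx b n \ R) y₀ y}

/-- No seed on the quadrant is reached. -/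
def stepFail (b : Zd d) (m n : ℕ) (i : Fin d) (σ : Fin d → ℤˣ) (κ : K) (R : Set (Zd d)) :
    Set (Sym2 (Zd d) × Option K → Bool) :=
  {η | ∀ z ∈ Face b n i σ, z ∈ R ∪ grown b n κ R η → ¬ seedOpen m i σ z (col η (some κ))}

/-- The base event that no open seed of the quadrant is reached from `Bx b m`. -/
lemma prob_not_reached {p δ : unitInterval} {m n k₁ k₂ : ℕ} {b : Zd d} {i : Fin d}
    {σ : Fin d → ℤˣ} (κ : K) (hk : (2 * m + 2) ^ d * k₂ ≤ k₁) :
    (bern (wts p δ)).real {η : Sym2 (Zd d) × Option K → Bool |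
      ∀ z ∈ tface b m n i σ (col η none), ¬ seedOpen m i σ z (col η (some κ))} ≤
    (bern (fun _ => p)).real {ω : Config d | (tface b m n i σ ω).ncard < k₁} +
      (1 - (δ : ℝ) ^ (((2 * m + 1) ^ d) ^ 2 + 1)) ^ k₂ := by
  classical
  set c := (1 - (δ : ℝ) ^ (((2 * m + 1) ^ d) ^ 2 + 1)) with hc
  have hc0 : 0 ≤ c := by
    have := pow_le_one₀ (n := ((2 * m + 1) ^ d) ^ 2 + 1) δ.2.1 δ.2.2
    linarith
  have hc1 : c ≤ 1 := by
    have := pow_nonneg δ.2.1 (((2 * m + 1) ^ d) ^ 2 + 1)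
    linarith
  have hinj : Function.Injective (fun e : Sym2 (Zd d) => ((e, none) : Sym2 (Zd d) × Option K)) :=
    fun a b h => (Prod.mk.inj h).1
  let B : Set (Sym2 (Zd d) × Option K → Bool) :=
    {η | k₁ ≤ (tface b m n i σ (col η none)).ncard ∧
      ∀ z ∈ tface b m n i σ (col η none), ¬ seedOpen m i σ z (col η (some κ))}
  have h1 : (bern (wts p δ)).real {η : Sym2 (Zd d) × Option K → Bool |
      ∀ z ∈ tface b m n i σ (col η none), ¬ seedOpen m i σ z (col η (some κ))} ≤
      (bern (wts p δ)).real {η : Sym2 (Zd d) × Option K → Bool |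
        (tface b m n i σ (col η none)).ncard < k₁} + (bern (wts p δ)).real B := by
    refine (measureReal_mono ?_).trans (measureReal_union_le _ _)
    intro η hη
    by_cases h : (tface b m n i σ (col η none)).ncard < k₁
    · exact Or.inl h
    · exact Or.inr ⟨not_lt.1 h, hη⟩
  refine h1.trans (add_le_add ?_ ?_)
  · refine le_of_eq ?_
    exact bern_preimage_inj (wts p δ) hinj
      (A := {ω : Config d | (tface b m n i σ ω).ncard < k₁})
      ((dep_tface b m n i σ fun s => s.ncard < k₁).measurableSet (Ed_finite (Bx_finite _ _)))
  have hF := Bx_finite b n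
  let U : Finset (Finset (Zd d)) := hF.toFinset.powerset
  let X : (Sym2 (Zd d) × Option K → Bool) → Finset (Zd d) :=
    fun η => (tface_finite b m n i σ (col η none)).toFinset
  have hX : ∀ η, (X η : Set (Zd d)) = tface b m n i σ (col η none) := fun η => by simp [X]
  have hdepX : ∀ T, Dep {η | X η = T} ((fun e => (e, none)) '' Ed (Bx b n)) := by
    intro T η η' h h1
    have : tface b m n i σ (col η none) = tface b m n i σ (col η' none) :=
      tface_congr fun e he => h _ ⟨e, he, rfl⟩
    have h2 : X η = X η' := by
      apply Finset.coe_injective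
      rw [hX, hX, this]
    simp only [Set.mem_ofPred_eq] at h1 ⊢
    rw [← h2, h1]
  have hfinX : ((fun e => ((e, none) : Sym2 (Zd d) × Option K)) '' Ed (Bx b n)).Finite :=
    (Ed_finite hF).image _
  let V : Finset (Zd d) → Set (Sym2 (Zd d) × Option K → Bool) := fun T =>
    {η | ∀ z ∈ T, ¬ seedOpen m i σ z (col η (some κ))}
  have hdepV : ∀ T : Finset (Zd d), Dep (V T) (⋃ z ∈ T, (fun e => (e, some κ)) '' seedEd m i σ z) := by
    intro T η η' h h1 z hz h2
    refine h1 z hz fun e he => ?_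
    have h3 := h (e, some κ) (Set.mem_biUnion hz ⟨e, he, rfl⟩)
    have h4 := h2 e he
    simp only [col] at h4 ⊢
    rw [h3]; exact h4
  have hmV : ∀ T, MeasurableSet (V T) := fun T => (hdepV T).measurableSet
    (T.finite_toSet.biUnion fun z _ => (seedEd_finite m i σ z).image _)
  have hmX : ∀ T, MeasurableSet {η | X η = T} := fun T => (hdepX T).measurableSet hfinX
  have hBT : ∀ T, {η | η ∈ B ∧ X η = T} ⊆ {η | X η = T} ∩ V T := by
    rintro T η ⟨h1, h2⟩
    refine ⟨h2, fun z hz => h1.2 z ?_⟩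
    rw [← hX, h2]; exact hz
  have hBT' : ∀ T, {η | η ∈ B ∧ X η = T} =
      if k₁ ≤ T.card then {η | X η = T} ∩ V T else ∅ := by
    intro T
    ext η
    have hcard : X η = T → (tface b m n i σ (col η none)).ncard = T.card := by
      intro h; rw [← hX, Set.ncard_coe_finset, h]
    split_ifs with h
    · refine ⟨fun h1 => hBT T h1, fun h1 => ⟨⟨?_, fun z hz => h1.2 z ?_⟩, h1.1⟩⟩
      · rw [hcard h1.1]; exact h
      · rw [← hX, h1.1] at hz; exact hz
    · refine ⟨fun h1 => h ?_, fun h1 => h1.elim⟩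
      rw [← hcard h1.2]; exact h1.1.1
  rw [real_eq_sum _ X U (A := B) (fun η _ => ?_) (fun T _ => ?_)]
  · have hterm : ∀ T ∈ U, (bern (wts p δ)).real {η | η ∈ B ∧ X η = T} ≤
        (bern (wts p δ)).real {η | X η = T} * c ^ k₂ := by
      intro T _
      by_cases hne : ((bern (wts p δ)).real {η | η ∈ B ∧ X η = T}) = 0
      · rw [hne]; exact mul_nonneg measureReal_nonneg (pow_nonneg hc0 _)
      obtain ⟨η, hη⟩ : {η | η ∈ B ∧ X η = T}.Nonempty := by
        rw [Set.nonempty_iff_ne_empty]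
        intro h; rw [h] at hne; simp at hne
      have hTf : (T : Set (Zd d)) ⊆ Face b n i σ := by
        rw [← hη.2, hX]; exact fun z hz => hz.1
      have hTk : (2 * m + 2) ^ d * k₂ ≤ (T : Set (Zd d)).ncard := by
        rw [← hη.2, hX]; exact hk.trans hη.1.1
      obtain ⟨s, hs, hsk, hsd⟩ := exists_disjoint_seeds hTf hTk
      have h2 := prob_no_seed (p := p) (δ := δ) κ s hsd
      refine (measureReal_mono (hBT T)).trans ?_
      rw [bern_inter _ (hdepX T) (hdepV T) ?_ (hmX T) (hmV T)]
      · refine mul_le_mul_of_nonneg_left ?_ measureReal_nonneg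
        refine (measureReal_mono ?_).trans (h2.trans (pow_le_pow_of_le_one hc0 hc1 hsk))
        exact fun η hη z hz => hη z (hs hz)
      · rw [Set.disjoint_left]
        rintro _ ⟨e, -, rfl⟩ h
        simp at h
    refine (Finset.sum_le_sum hterm).trans ?_
    rw [← Finset.sum_mul]
    refine mul_le_of_le_one_left (pow_nonneg hc0 _) ?_
    rw [← measureReal_biUnion_finset (fun T _ T' _ hne => Set.disjoint_left.2
      fun η h h' => hne (h.symm.trans h')) fun T _ => hmX T]
    exact measureReal_le_one
  · simp only [U, Finset.mem_powerset]
    intro z hz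
    have : z ∈ (X η : Set (Zd d)) := hz
    rw [hX] at this
    simpa using tface_subset b m n i σ _ this
  · rw [hBT']
    split_ifs
    · exact (hmX T).inter (hmV T)
    · exact MeasurableSet.empty

/-- The main estimate for one exploration step. -/
lemma prob_stepFail {p δ : unitInterval} {m n k k₁ k₂ : ℕ} {b : Zd d} {i : Fin d}
    {σ : Fin d → ℤˣ} (κ : K) {R : Set (Zd d)} (hR : Bx b m ⊆ R) (hp : (p : ℝ) < 1)
    (hk : (2 * m + 2) ^ d * k₂ ≤ k₁) :
    (bern (wts p δ)).real (stepFail b m n i σ κ R) ≤ (1 - (δ : ℝ)) ^ k + ((1 - (p : ℝ)) ^ k)⁻¹ *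
    ((bern (fun _ => p)).real {ω : Config d | (tface b m n i σ ω).ncard < k₁} +
      (1 - (δ : ℝ) ^ (((2 * m + 1) ^ d) ^ 2 + 1)) ^ k₂) := by
  classical
  have hFd : (Ed (Bx b n)).Finite := Ed_finite (Bx_finite b n)
  let G : Set (Sym2 (Zd d) × Option K → Bool) :=
    {η | ∀ z ∈ Face b n i σ ∩ R, ¬ seedOpen m i σ z (col η (some κ))}
  let P : (Sym2 (Zd d) × Option K → Bool) → Sym2 (Zd d) → Prop := fun η e =>
    ∃ r y z, e = s(r, y) ∧ latAdj r y ∧ r ∈ R ∧ y ∉ R ∧ z ∈ Face b n i σ ∧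
      seedOpen m i σ z (col η (some κ)) ∧ Conn (col η none) (Bx b n \ R) z y
  let U : Finset (Sym2 (Zd d)) := hFd.toFinset.filter fun e => (∃ r ∈ e, r ∈ R)
  let X : (Sym2 (Zd d) × Option K → Bool) → Finset (Sym2 (Zd d)) := fun η => U.filter (P η)
  have hface : (Face b n i σ).Finite := (Bx_finite b n).subset (Face_subset b n i σ)
  let S : Set (Sym2 (Zd d) × Option K) := (fun e => (e, none)) '' Ed (Bx b n \ R) ∪
    ⋃ z ∈ Face b n i σ, (fun e => (e, some κ)) '' seedEd m i σ z
  have hS : S.Finite := ((Ed_finite ((Bx_finite b n).subset Set.sdiff_subset)).image _).union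
    (hface.biUnion fun z _ => (seedEd_finite m i σ z).image _)
  have hseed : ∀ η η' : Sym2 (Zd d) × Option K → Bool, (∀ j ∈ S, η j = η' j) →
      ∀ z ∈ Face b n i σ, (seedOpen m i σ z (col η (some κ)) ↔
        seedOpen m i σ z (col η' (some κ))) := by
    intro η η' h z hz
    refine forall₂_congr fun e he => ?_
    have : η (e, some κ) = η' (e, some κ) := h _ (Or.inr (Set.mem_biUnion hz ⟨e, he, rfl⟩))
    simp only [col, this]
  have hPP : ∀ η η' : Sym2 (Zd d) × Option K → Bool, (∀ j ∈ S, η j = η' j) →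
      ∀ e, P η e → P η' e := by
    rintro η η' h e ⟨r, y, z, he, hry, hr, hy, hz, hs, hc⟩
    refine ⟨r, y, z, he, hry, hr, hy, hz, (hseed η η' h z hz).1 hs, hc.congr fun e he h1 => ?_⟩
    have : η (e, none) = η' (e, none) := h _ (Or.inl ⟨e, he, rfl⟩)
    simp only [col, this] at h1 ⊢
    exact h1
  have hdep : ∀ T, Dep {η | η ∈ G ∧ X η = T} S := by
    rintro T η η' h ⟨h1, h2⟩
    refine ⟨fun z hz hs => h1 z hz ((hseed η η' h z hz.1).2 hs), ?_⟩
    rw [← h2]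
    ext e
    simp only [X, Finset.mem_filter]
    exact and_congr_right fun _ => ⟨hPP η' η (fun j hj => (h j hj).symm) e, hPP η η' h e⟩
  have hinjn : Function.Injective (fun e : Sym2 (Zd d) => ((e, none) : Sym2 (Zd d) × Option K)) :=
    fun a b h => (Prod.mk.inj h).1
  have hinjs : Function.Injective
      (fun e : Sym2 (Zd d) => ((e, some κ) : Sym2 (Zd d) × Option K)) :=
    fun a b h => (Prod.mk.inj h).1
  have hUR : ∀ e ∈ U, e ∈ Ed (Bx b n) ∧ ∃ r ∈ e, r ∈ R := by
    intro e he
    simpa [U] using he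
  have e1 := random_closed (wts p δ) U X G hS (fun η _ => Finset.filter_subset _ _)
    (fun e => (e, none)) hinjn (a := p) (fun e _ => rfl) hdep (by
      rintro e he (⟨e', he', h⟩ | h)
      · obtain rfl := hinjn h
        obtain ⟨-, r, hr, hrR⟩ := hUR _ he
        exact (he' r hr).2 hrR
      · simp at h)
  have e2 := random_closed (wts p δ) U X G hS (fun η _ => Finset.filter_subset _ _)
    (fun e => (e, some κ)) hinjs (a := δ) (fun e _ => rfl) hdep (by
      rintro e he (⟨e', he', h⟩ | h)
      · simp at h
      · simp only [Set.mem_iUnion] at h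
        obtain ⟨z, hz, e', he', h⟩ := h
        obtain rfl := hinjs h
        exact seedEd_outside hz he' (hUR _ he).1)
  have s1 : stepFail b m n i σ κ R ⊆ {η | η ∈ G ∧ ∀ e ∈ X η, η (e, some κ) = false} := by
    intro η hη
    refine ⟨fun z hz => hη z hz.1 (Or.inl hz.2), fun e he => ?_⟩
    simp only [X, Finset.mem_filter] at he
    obtain ⟨heU, r, y, z, rfl, hry, hr, hy, hz, hs, hc⟩ := he
    by_contra hne
    refine hη z hz (Or.inr ⟨r, ⟨hr, (mk_mem_Ed.1 (hUR _ heU).1).1⟩, y, hry, ?_, hc.symm⟩) hs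
    simpa using hne
  have s2 : {η | η ∈ G ∧ ∀ e ∈ X η, η (e, none) = false} ⊆
      {η : Sym2 (Zd d) × Option K → Bool |
      ∀ z ∈ tface b m n i σ (col η none), ¬ seedOpen m i σ z (col η (some κ))} := by
    rintro η ⟨hG, hX⟩ z ⟨hz, a, ha, haz⟩ hs
    have hzR : z ∈ Rᶜ := fun h => hG z ⟨hz, h⟩ hs
    obtain ⟨u, v, huv, ho, hv, hvR⟩ := haz.symm.exists_exit hzR (fun h => h (hR ha))
    rw [Set.mem_compl_iff, not_not] at hvR
    have hc : Conn (col η none) (Bx b n \ R) z u := huv.mono_set fun x hx => hx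
    have := hX s(v, u) (by
      simp only [X, U, Finset.mem_filter, Set.Finite.mem_toFinset]
      exact ⟨⟨mk_mem_Ed.2 ⟨hv, hc.mem_right.1⟩, v, by simp, hvR⟩, v, u, z, rfl, ho.1.symm, hvR,
        hc.mem_right.2, hz, hs, hc⟩)
    have h2 := ho.symm.2
    simp only [col] at h2
    rw [h2] at this
    exact absurd this (by simp)
  have hN := (measureReal_mono s2 (μ := bern (wts p δ))).trans
    (prob_not_reached (p := p) (δ := δ) κ hk)
  rw [e1] at hN
  refine (measureReal_mono s1).trans ?_
  rw [e2]
  have hq0 : 0 < 1 - (p : ℝ) := by linarith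
  have hδ0 : 0 ≤ 1 - (δ : ℝ) := by linarith [δ.2.2]
  have hδ1 : 1 - (δ : ℝ) ≤ 1 := by linarith [δ.2.1]
  have hp1 : 1 - (p : ℝ) ≤ 1 := by linarith [p.2.1]
  have hterm : ∀ T ∈ U.powerset, (bern (wts p δ)).real {η | η ∈ G ∧ X η = T} *
      (1 - (δ : ℝ)) ^ T.card ≤
      (bern (wts p δ)).real {η | η ∈ G ∧ X η = T} * (1 - (δ : ℝ)) ^ k + ((1 - (p : ℝ)) ^ k)⁻¹ *
      ((bern (wts p δ)).real {η | η ∈ G ∧ X η = T} * (1 - (p : ℝ)) ^ T.card) := by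
    intro T _
    set q := (bern (wts p δ)).real {η | η ∈ G ∧ X η = T} with hq
    have hq1 : 0 ≤ q := measureReal_nonneg
    rcases le_total k T.card with h | h
    · have h1 := mul_le_mul_of_nonneg_left (pow_le_pow_of_le_one hδ0 hδ1 h) hq1
      have : 0 ≤ ((1 - (p : ℝ)) ^ k)⁻¹ * (q * (1 - (p : ℝ)) ^ T.card) := by positivity
      linarith
    · have h1 : 1 ≤ ((1 - (p : ℝ)) ^ k)⁻¹ * (1 - (p : ℝ)) ^ T.card := by
        rw [inv_mul_eq_div, le_div_iff₀ (pow_pos hq0 _), one_mul]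
        exact pow_le_pow_of_le_one hq0.le hp1 h
      have h2 : (1 - (δ : ℝ)) ^ T.card ≤ 1 := pow_le_one₀ hδ0 hδ1
      have h3 := mul_le_mul_of_nonneg_left (h2.trans h1) hq1
      have h4 : 0 ≤ q * (1 - (δ : ℝ)) ^ k := by positivity
      have h5 : q * (((1 - (p : ℝ)) ^ k)⁻¹ * (1 - (p : ℝ)) ^ T.card) =
        ((1 - (p : ℝ)) ^ k)⁻¹ * (q * (1 - (p : ℝ)) ^ T.card) := by ring
      linarith
  refine (Finset.sum_le_sum hterm).trans ?_
  rw [Finset.sum_add_distrib, ← Finset.sum_mul, ← Finset.mul_sum]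
  refine add_le_add (mul_le_of_le_one_left (pow_nonneg hδ0 _) ?_)
    (mul_le_mul_of_nonneg_left hN (by positivity))
  rw [← real_eq_sum (bern (wts p δ)) X U.powerset (A := G)
    (fun η _ => Finset.mem_powerset.2 (Finset.filter_subset _ _))
    (fun T _ => (hdep T).measurableSet hS)]
  exact measureReal_le_one

/-- One exploration step succeeds with high probability. -/
lemma exists_step (hd : 0 < d) {p δ : unitInterval} (hp : (p : ℝ) < 1) (hδ : 0 < (δ : ℝ))
    (h : bern (fun _ => p) {ω : Config d | (cluster ω).Infinite} ≠ 0) {ε : ℝ} (hε : 0 < ε) :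
    ∃ m n, m ≤ n ∧ ∀ (b : Zd d) (i : Fin d) (σ : Fin d → ℤˣ) (κ : K) (R : Set (Zd d)),
      Bx b m ⊆ R → (bern (wts p δ)).real (stepFail b m n i σ κ R) ≤ ε := by
  have hq0 : 0 < 1 - (p : ℝ) := by linarith
  have hδ0 : 0 ≤ 1 - (δ : ℝ) := by linarith [δ.2.2]
  obtain ⟨k, hk⟩ := exists_pow_lt_of_lt_one (show 0 < ε / 3 by positivity)
    (show 1 - (δ : ℝ) < 1 by linarith)
  set η := (1 - (p : ℝ)) ^ k * (ε / 3) with hη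
  have hη0 : 0 < η := by positivity
  obtain ⟨m, hm⟩ := many_tface hd hp h hη0
  have hs : 1 - (δ : ℝ) ^ (((2 * m + 1) ^ d) ^ 2 + 1) < 1 := by
    have := pow_pos hδ (((2 * m + 1) ^ d) ^ 2 + 1)
    linarith
  obtain ⟨k₂, hk₂⟩ := exists_pow_lt_of_lt_one hη0 hs
  obtain ⟨n, hn⟩ := hm m le_rfl ((2 * m + 2) ^ d * k₂)
  refine ⟨m, max m n, le_max_left _ _, fun b i σ κ R hR => ?_⟩
  refine (prob_stepFail κ hR hp (k := k) (k₂ := k₂) le_rfl).trans ?_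
  have h1 := hn (max m n) (le_max_right _ _) b i σ
  have h2 : ((1 - (p : ℝ)) ^ k)⁻¹ * (η + η) = 2 * (ε / 3) := by
    rw [hη]
    field_simp
    ring
  have h3 := mul_le_mul_of_nonneg_left (add_le_add h1 hk₂.le)
    (show 0 ≤ ((1 - (p : ℝ)) ^ k)⁻¹ by positivity)
  linarith

end

section

/-! ### Paths in boxes -/

variable {d : ℕ}

/-- Integer boxes are connected in the lattice. -/
lemma conn_Icc {l u x y : Zd d} (hx : x ∈ Set.Icc l u) (hy : y ∈ Set.Icc l u) :
    Conn (fun _ => true) (Set.Icc l u) x y := by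
  induction hN : ∑ i, (x i - y i).natAbs using Nat.strong_induction_on generalizing x with
  | _ N ih =>
  by_cases hxy : x = y
  · subst hxy; exact Conn.refl hx
  obtain ⟨i, hi⟩ := Function.ne_iff.1 hxy
  obtain ⟨τ, hτ1, hτ2⟩ : ∃ τ : ℤ, (τ = 1 ∨ τ = -1) ∧ (x i + τ - y i).natAbs + 1 = (x i - y i).natAbs := by
    rcases lt_or_gt_of_ne hi with h | h
    · exact ⟨1, by simp, by omega⟩
    · exact ⟨-1, by simp, by omega⟩
  set x' := Function.update x i (x i + τ) with hx'
  have hadj : latAdj x x' := by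
    unfold latAdj
    rw [Finset.sum_eq_single i]
    · rcases hτ1 with h | h <;> simp [hx', h]
    · intro j _ hj; simp [hx', hj]
    · simp
  have hmem : x' ∈ Set.Icc l u := by
    have h1 : l i ≤ x i := hx.1 i
    have h2 : x i ≤ u i := hx.2 i
    have h3 : l i ≤ y i := hy.1 i
    have h4 : y i ≤ u i := hy.2 i
    constructor <;> intro j <;> by_cases hj : j = i
    · subst hj
      simp only [hx', Function.update_self]
      change l j ≤ x j + τ
      omega
    · simpa [hx', hj] using hx.1 j
    · subst hj
      simp only [hx', Function.update_self]
      change x j + τ ≤ u j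
      omega
    · simpa [hx', hj] using hx.2 j
  have hlt : ∑ j, (x' j - y j).natAbs < N := by
    rw [← hN]
    refine Finset.sum_lt_sum (fun j _ => ?_) ⟨i, Finset.mem_univ _, ?_⟩
    · by_cases hj : j = i
      · subst hj; simp only [hx', Function.update_self]; omega
      · simp [hx', hj]
    · simp only [hx', Function.update_self]; omega
  exact (Conn.single hx hmem ⟨hadj, rfl⟩).trans (ih _ hlt hmem rfl)

lemma conn_Bx {c x y : Zd d} {n : ℕ} (hx : x ∈ Bx c n) (hy : y ∈ Bx c n) :
    Conn (fun _ => true) (Bx c n) x y := by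
  rw [Bx_eq_Icc] at *; exact conn_Icc hx hy

/-- Exploring a random set leaves the remaining coordinates fresh. -/
lemma fresh_lower {ι β : Type*} (w : ι → unitInterval) (U : Finset β) (X : (ι → Bool) → β)
    (G : Set (ι → Bool)) (E : β → Set (ι → Bool)) (S S' : β → Set ι) {q : ℝ}
    (hU : ∀ ω ∈ G, X ω ∈ U) (hS : ∀ T, (S T).Finite) (hS' : ∀ T, (S' T).Finite)
    (hdep : ∀ T, Dep {ω | ω ∈ G ∧ X ω = T} (S T)) (hE : ∀ T, Dep (E T) (S' T))
    (hdis : ∀ T ∈ U, Disjoint (S T) (S' T)) (hq : ∀ ω ∈ G, q ≤ (bern w).real (E (X ω))) :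
    (bern w).real G * q ≤ (bern w).real {ω | ω ∈ G ∧ ω ∈ E (X ω)} := by
  have hset : ∀ T, {ω | ω ∈ {ω | ω ∈ G ∧ ω ∈ E (X ω)} ∧ X ω = T} =
      {ω | ω ∈ G ∧ X ω = T} ∩ E T := by
    intro T; ext ω
    simp only [Set.mem_ofPred_eq, Set.mem_inter_iff]
    constructor
    · rintro ⟨⟨h1, h2⟩, rfl⟩; exact ⟨⟨h1, rfl⟩, h2⟩
    · rintro ⟨⟨h1, rfl⟩, h2⟩; exact ⟨⟨h1, h2⟩, rfl⟩
  have hm : ∀ T, MeasurableSet {ω | ω ∈ G ∧ X ω = T} := fun T => (hdep T).measurableSet (hS T)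
  have hmE : ∀ T, MeasurableSet (E T) := fun T => (hE T).measurableSet (hS' T)
  rw [real_eq_sum (bern w) X U hU fun T _ => hm T, Finset.sum_mul,
    real_eq_sum (bern w) X U (A := {ω | ω ∈ G ∧ ω ∈ E (X ω)}) (fun ω h => hU ω h.1)
      fun T _ => by rw [hset]; exact (hm T).inter (hmE T)]
  refine Finset.sum_le_sum fun T hT => ?_
  rw [hset, bern_inter w (hdep T) (hE T) (hdis T hT) (hm T) (hmE T)]
  rcases Set.eq_empty_or_nonempty {ω | ω ∈ G ∧ X ω = T} with h | ⟨ω, h1, h2⟩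
  · rw [h]; simp
  · refine mul_le_mul_of_nonneg_left ?_ measureReal_nonneg
    rw [← h2]; exact hq ω h1

/-- Adjacency in the coarse plane. -/
def adj2 (u v : ℤ × ℤ) : Prop := |u.1 - v.1| + |u.2 - v.2| = 1

/-- Reaching `x` from `O` through `O` and the open sites of `V`. -/
def siteReach (O V : Finset (ℤ × ℤ)) (x : ℤ × ℤ) : Set (ℤ × ℤ → Bool) :=
  {θ | ∃ o ∈ O, Relation.ReflTransGen
    (fun a b => adj2 a b ∧ (b ∈ O ∨ (b ∈ V ∧ θ b = true))) o x}

lemma siteReach_mono {O O' V : Finset (ℤ × ℤ)} (h : O ⊆ O') (x : ℤ × ℤ) :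
    siteReach O V x ⊆ siteReach O' V x := by
  rintro θ ⟨o, ho, h1⟩
  exact ⟨o, h ho, Relation.ReflTransGen.mono (fun _ _ h2 => ⟨h2.1, h2.2.imp_left fun h3 => h h3⟩) _ _ h1⟩

lemma dep_siteReach (O V : Finset (ℤ × ℤ)) (x : ℤ × ℤ) : Dep (siteReach O V x) (V : Set (ℤ × ℤ)) := by
  rintro θ θ' h ⟨o, ho, h1⟩
  refine ⟨o, ho, Relation.ReflTransGen.mono (fun _ b h2 => ⟨h2.1, h2.2.imp_right fun h3 => ?_⟩) _ _ h1⟩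
  exact ⟨h3.1, by rw [← h b h3.1]; exact h3.2⟩

lemma siteReach_split (s : unitInterval) {O V : Finset (ℤ × ℤ)} {x v : ℤ × ℤ} (hv : v ∈ V) :
    (bern fun _ => s).real (siteReach O V x) ≤
      s * (bern fun _ => s).real (siteReach (insert v O) (V.erase v) x) +
      (1 - s) * (bern fun _ => s).real (siteReach O (V.erase v) x) := by
  have hA : Dep (siteReach O V x) (insert v (V.erase v) : Finset (ℤ × ℤ)) := by
    rw [Finset.insert_erase hv]; exact dep_siteReach O V x
  rw [bern_split (fun _ => s) (Finset.notMem_erase v V) hA]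
  have hs := s.2.1
  have hs' : 0 ≤ 1 - (s : ℝ) := by linarith [s.2.2]
  refine add_le_add (mul_le_mul_of_nonneg_left (measureReal_mono ?_) hs)
    (mul_le_mul_of_nonneg_left (measureReal_mono ?_) hs')
  · rintro θ ⟨o, ho, h⟩
    refine ⟨o, by simp [ho], Relation.ReflTransGen.mono (fun _ b h2 => ⟨h2.1, ?_⟩) _ _ h⟩
    rcases h2.2 with h3 | h3
    · exact Or.inl (by simp [h3])
    · by_cases hb : b = v
      · exact Or.inl (by simp [hb])
      · refine Or.inr ⟨by simp [hb, h3.1], ?_⟩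
        simpa [Function.update_of_ne hb] using h3.2
  · rintro θ ⟨o, ho, h⟩
    refine ⟨o, ho, Relation.ReflTransGen.mono (fun _ b h2 => ⟨h2.1, ?_⟩) _ _ h⟩
    rcases h2.2 with h3 | h3
    · exact Or.inl h3
    · by_cases hb : b = v
      · subst hb; simp at h3
      · refine Or.inr ⟨by simp [hb, h3.1], ?_⟩
        simpa [Function.update_of_ne hb] using h3.2

/-- Centres of the coarse sites of the plane through `z₀` with axes `i₁`, `i₂`. -/
def cen (z₀ : Zd d) (M : ℕ) (i₁ i₂ : Fin d) (u : ℤ × ℤ) : Zd d :=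
  fun j => z₀ j + M * (if j = i₁ then u.1 else if j = i₂ then u.2 else 0)

/-- The colour of a coarse site. -/
def chi (v : ℤ × ℤ) : ZMod 7 × ZMod 7 := (v.1, v.2)

lemma chi_disjoint {z₀ : Zd d} {M : ℕ} {i₁ i₂ : Fin d} (hi : i₁ ≠ i₂) (hM : 0 < M)
    {v w : ℤ × ℤ} (h : chi v = chi w) {x : Zd d}
    (hv : x ∈ Bx (cen z₀ M i₁ i₂ v) (3 * M)) (hw : x ∈ Bx (cen z₀ M i₁ i₂ w) (3 * M)) : v = w := by
  have key : ∀ (a b X Z : ℤ), (a : ZMod 7) = b → |X - (Z + M * a)| ≤ (3 * M : ℕ) →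
      |X - (Z + M * b)| ≤ (3 * M : ℕ) → a = b := by
    intro a b X Z h h1 h2
    have h3 : ((a - b : ℤ) : ZMod 7) = 0 := by push_cast; rw [h, sub_self]
    have h4 := (ZMod.intCast_zmod_eq_zero_iff_dvd _ _).1 h3
    have h5 : |(M : ℤ) * (a - b)| ≤ 6 * M := by
      have := abs_sub_le (Z + M * a) X (Z + M * b)
      rw [abs_sub_comm (Z + M * a) X] at this
      have e : (Z + M * a) - (Z + M * b) = (M : ℤ) * (a - b) := by ring
      rw [e] at this
      push_cast at h1 h2
      linarith
    rw [abs_mul, Nat.abs_cast] at h5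
    have hM' : (0 : ℤ) < M := by exact_mod_cast hM
    have h6 : |a - b| ≤ 6 := by
      by_contra hlt
      push Not at hlt
      nlinarith
    have := Int.eq_zero_of_abs_lt_dvd h4 (by push_cast; linarith)
    linarith
  obtain ⟨h1, h2⟩ := Prod.mk.inj h
  refine Prod.ext (key _ _ (x i₁) (z₀ i₁) h1 ?_ ?_) (key _ _ (x i₂) (z₀ i₂) h2 ?_ ?_)
  · simpa [cen] using hv i₁
  · simpa [cen] using hw i₁
  · simpa [cen, hi.symm] using hv i₂
  · simpa [cen, hi.symm] using hw i₂

/-- Geometry of one coarse step. -/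
lemma step_geometry {m n : ℕ} (z₀ : Zd d) {i₁ i₂ : Fin d} (hi : i₁ ≠ i₂) {u v : ℤ × ℤ}
    (huv : adj2 u v) {b : Zd d} (hb : b ∈ Bx (cen z₀ (n + m + 1) i₁ i₂ u) n) :
    ∃ i σ, Bx b n ⊆ Bx (cen z₀ (n + m + 1) i₁ i₂ v) (3 * (n + m + 1)) ∧
      Bx b n ⊆ Bx (cen z₀ (n + m + 1) i₁ i₂ u) (2 * (n + m + 1)) ∧
      ∀ z ∈ Face b n i σ, seedC m i σ z ∈ Bx (cen z₀ (n + m + 1) i₁ i₂ v) n ∧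
        seedEd m i σ z ⊆ Ed (Bx (cen z₀ (n + m + 1) i₁ i₂ v) (3 * (n + m + 1))) := by
  set M := n + m + 1 with hM
  set c := cen z₀ M i₁ i₂ with hc
  obtain ⟨i, τ, hτ, hi', hj⟩ : ∃ (i : Fin d) (τ : ℤˣ), True ∧ c v i = c u i + τ * M ∧
      ∀ j ≠ i, c v j = c u j := by
    unfold adj2 at huv
    have : (u.2 = v.2 ∧ (v.1 = u.1 + 1 ∨ v.1 = u.1 - 1)) ∨
        (u.1 = v.1 ∧ (v.2 = u.2 + 1 ∨ v.2 = u.2 - 1)) := by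
      rw [Int.abs_eq_natAbs, Int.abs_eq_natAbs] at huv; omega
    rcases this with ⟨h1, h2 | h2⟩ | ⟨h1, h2 | h2⟩
    · refine ⟨i₁, 1, trivial, ?_, fun j hj => ?_⟩
      · simp [hc, cen, h2]; ring
      · simp [hc, cen, hj, h1]
    · refine ⟨i₁, -1, trivial, ?_, fun j hj => ?_⟩
      · simp [hc, cen, h2]; ring
      · simp [hc, cen, hj, h1]
    · refine ⟨i₂, 1, trivial, ?_, fun j hj => ?_⟩
      · simp [hc, cen, h2, hi.symm]; ring
      · simp [hc, cen, hj, h1]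
    · refine ⟨i₂, -1, trivial, ?_, fun j hj => ?_⟩
      · simp [hc, cen, h2, hi.symm]; ring
      · simp [hc, cen, hj, h1]
  clear hτ
  have hτ : (τ : ℤ) = 1 ∨ (τ : ℤ) = -1 := by
    rcases Int.units_eq_one_or τ with h | h <;> simp [h]
  have hcv : ∀ j, |c v j - c u j| ≤ M := by
    intro j
    by_cases h : j = i
    · subst h
      rw [hi']
      rcases hτ with h | h <;> simp [h]
    · rw [hj j h]; simp
  have h1 : Bx b n ⊆ Bx (c v) (2 * n + M) := by
    intro x hx j
    have a1 := _root_.abs_le.1 (hx j)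
    have a2 := _root_.abs_le.1 (hb j)
    have a3 := _root_.abs_le.1 (hcv j)
    rw [_root_.abs_le]
    push_cast
    constructor <;> linarith
  refine ⟨i, fun j => if j = i then τ else if 0 < b j - c u j then -1 else 1,
    h1.trans (Bx_mono _ (by omega)), ?_, ?_⟩
  · intro x hx j
    have a1 := _root_.abs_le.1 (hx j)
    have a2 := _root_.abs_le.1 (hb j)
    rw [_root_.abs_le]
    push_cast [hM] at *
    constructor <;> linarith
  intro z hz
  have hs : seedC m i (fun j => if j = i then τ else if 0 < b j - c u j then -1 else 1) z ∈
      Bx (c v) n := by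
    intro j
    have a2 := _root_.abs_le.1 (hb j)
    by_cases h : j = i
    · subst h
      have hz1 := hz.1
      simp only [seedC, if_true, Function.update_self] at hz1 ⊢
      rw [_root_.abs_le, hi']
      push_cast [hM] at *
      rcases hτ with h | h <;> rw [h] at hz1 ⊢ <;> constructor <;> linarith
    · have hz1 := hz.2 j
      simp only [seedC, if_neg h, Function.update_of_ne h] at hz1 ⊢
      rw [_root_.abs_le, hj j h]
      split_ifs at hz1 with h0
      · push_cast at hz1
        constructor <;> linarith
      · push_cast at hz1
        constructor <;> linarith
  refine ⟨hs, ?_⟩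
  rintro e (he | he)
  · refine Ed_mono ?_ he
    intro x hx j
    have a1 := _root_.abs_le.1 (hx j)
    have a2 := _root_.abs_le.1 (hs j)
    rw [_root_.abs_le]
    push_cast [hM] at *
    constructor <;> linarith
  · rw [Set.mem_singleton_iff] at he
    subst he
    have hz1 := h1 (Face_subset _ _ _ _ hz)
    refine mk_mem_Ed.2 ⟨Bx_mono _ (by omega) hz1, ?_⟩
    intro j
    have a1 := _root_.abs_le.1 (hz1 j)
    by_cases h : j = i
    · subst h
      simp only [Function.update_self, if_true]
      rw [_root_.abs_le]
      push_cast [hM] at *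
      rcases hτ with h | h <;> rw [h] <;> constructor <;> linarith
    · simp only [Function.update_of_ne h]
      rw [_root_.abs_le]
      push_cast [hM] at *
      constructor <;> linarith

end

section

/-! ### The exploration of coarse sites -/

variable {d : ℕ}

/-- The colours used in the exploration. -/
abbrev Col : Type := ZMod 7 × ZMod 7

open Classical in
/-- The configuration still to be explored: base edges avoiding `R`, and the sprinkled edges
reserved to the coarse sites of `V`. -/
noncomputable def mix (c : ℤ × ℤ → Zd d) (M : ℕ) (R : Set (Zd d)) (V : Finset (ℤ × ℤ))
    (η : Sym2 (Zd d) × Option Col → Bool) : Config d :=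
  fun e => decide ((e ∈ Ed Rᶜ ∧ η (e, none) = true) ∨
    ∃ v ∈ V, e ∈ Ed (Bx (c v) (3 * M)) ∧ η (e, some (chi v)) = true)

lemma mix_true {c : ℤ × ℤ → Zd d} {M : ℕ} {R : Set (Zd d)} {V : Finset (ℤ × ℤ)}
    {η : Sym2 (Zd d) × Option Col → Bool} {e : Sym2 (Zd d)} : mix c M R V η e = true ↔
    (e ∈ Ed Rᶜ ∧ η (e, none) = true) ∨
    ∃ v ∈ V, e ∈ Ed (Bx (c v) (3 * M)) ∧ η (e, some (chi v)) = true := by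
  simp [mix]

/-- The target box is reached from `R` through unexplored edges. -/
def reachEv (c : ℤ × ℤ → Zd d) (M : ℕ) (Reg T : Set (Zd d)) (R : Set (Zd d))
    (V : Finset (ℤ × ℤ)) : Set (Sym2 (Zd d) × Option Col → Bool) :=
  {η | ∃ r ∈ R, ∃ t ∈ T, Conn (mix c M R V η) Reg r t}

/-- The coordinates on which `reachEv` depends. -/
def freshSet (c : ℤ × ℤ → Zd d) (M : ℕ) (Reg R : Set (Zd d)) (V : Finset (ℤ × ℤ)) :
    Set (Sym2 (Zd d) × Option Col) :=
  (fun e => (e, none)) '' (Ed Reg ∩ Ed Rᶜ) ∪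
    ⋃ v ∈ V, (fun e => (e, some (chi v))) '' (Ed (Bx (c v) (3 * M)))

lemma freshSet_finite {c : ℤ × ℤ → Zd d} {M : ℕ} {Reg : Set (Zd d)} (hReg : Reg.Finite)
    (R : Set (Zd d)) (V : Finset (ℤ × ℤ)) : (freshSet c M Reg R V).Finite :=
  (((Ed_finite hReg).inter_of_left _).image _).union
    (V.finite_toSet.biUnion fun _ _ => (Ed_finite (Bx_finite _ _)).image _)

lemma dep_reachEv (c : ℤ × ℤ → Zd d) (M : ℕ) (Reg T R : Set (Zd d)) (V : Finset (ℤ × ℤ)) :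
    Dep (reachEv c M Reg T R V) (freshSet c M Reg R V) := by
  rintro η η' h ⟨r, hr, t, ht, hc⟩
  refine ⟨r, hr, t, ht, hc.congr fun e he h1 => ?_⟩
  rw [mix_true] at h1 ⊢
  rcases h1 with ⟨h1, h2⟩ | ⟨v, hv, h1, h2⟩
  · left
    refine ⟨h1, ?_⟩
    rw [← h (e, none) (Or.inl ⟨e, ⟨he, h1⟩, rfl⟩)]
    exact h2
  · right
    refine ⟨v, hv, h1, ?_⟩
    rw [← h (e, some (chi v)) (Or.inr (Set.mem_biUnion hv ⟨e, h1, rfl⟩))]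
    exact h2

/-- The explored region after one step. -/
def nextR (b : Zd d) (m n : ℕ) (i : Fin d) (σ : Fin d → ℤˣ) (κ : Col) (R : Set (Zd d))
    (η : Sym2 (Zd d) × Option Col → Bool) : Set (Zd d) :=
  R ∪ grown b n κ R η ∪ {x | ∃ z ∈ Face b n i σ, z ∈ R ∪ grown b n κ R η ∧
    seedOpen m i σ z (col η (some κ)) ∧ x ∈ Bx (seedC m i σ z) m}

/-- The coordinates revealed by one step. -/
def usedSet (b c : Zd d) (n M : ℕ) (κ : Col) (ρ : Set (Zd d)) :
    Set (Sym2 (Zd d) × Option Col) :=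
  (fun e => (e, none)) '' (Ed (Bx b n) \ Ed ρᶜ) ∪ (fun e => (e, some κ)) '' Ed (Bx c (3 * M))

lemma usedSet_finite (b c : Zd d) (n M : ℕ) (κ : Col) (ρ : Set (Zd d)) :
    (usedSet b c n M κ ρ).Finite :=
  ((Ed_finite (Bx_finite b n)).sdiff.image _).union ((Ed_finite (Bx_finite c _)).image _)

lemma step_congr {b c : Zd d} {m n M : ℕ} {i : Fin d} {σ : Fin d → ℤˣ} {κ : Col}
    {R : Set (Zd d)} (hb : Bx b n ⊆ Bx c (3 * M))
    (hs : ∀ z ∈ Face b n i σ, seedEd m i σ z ⊆ Ed (Bx c (3 * M)))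
    {η η' : Sym2 (Zd d) × Option Col → Bool}
    (h : ∀ j ∈ usedSet b c n M κ (nextR b m n i σ κ R η), η j = η' j) :
    nextR b m n i σ κ R η' = nextR b m n i σ κ R η ∧
      (η' ∈ stepFail b m n i σ κ R ↔ η ∈ stepFail b m n i σ κ R) := by
  have hspr : ∀ e ∈ Ed (Bx c (3 * M)), η (e, some κ) = η' (e, some κ) := fun e he =>
    h _ (Or.inr ⟨e, he, rfl⟩)
  have hbase : ∀ x y, x ∈ Bx b n → y ∈ Bx b n → x ∈ grown b n κ R η →
      η (s(x, y), none) = η' (s(x, y), none) := by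
    intro x y hx hy hg
    refine h _ (Or.inl ⟨_, ⟨mk_mem_Ed.2 ⟨hx, hy⟩, fun hh => ?_⟩, rfl⟩)
    exact (mk_mem_Ed.1 hh).1 (Or.inl (Or.inr hg))
  have hedge : ∀ r y, r ∈ Bx b n → y ∈ Bx b n → η (s(r, y), some κ) = η' (s(r, y), some κ) :=
    fun r y hr hy => hspr _ (mk_mem_Ed.2 ⟨hb hr, hb hy⟩)
  have hgrown : grown b n κ R η' = grown b n κ R η := by
    ext y
    constructor
    · rintro ⟨r, hr, y₀, ha, ho, hc⟩
      have hy₀ := hc.mem_left.1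
      refine hc.induct (P := fun y => y ∈ grown b n κ R η) ⟨r, hr, y₀, ha, ?_, .refl hc.1⟩ ?_
      · rw [hedge r y₀ hr.2 hy₀]; exact ho
      · rintro x z hx ⟨r', hr', y', ha', ho', hc'⟩ hxz hz
        refine ⟨r', hr', y', ha', ho', hc'.tail ⟨hxz.1, ?_⟩ hz⟩
        have := hbase x z hx.mem_right.1 hz.1 ⟨r', hr', y', ha', ho', hc'⟩
        simp only [col]
        rw [this]; exact hxz.2
    · rintro ⟨r, hr, y₀, ha, ho, hc⟩
      have hy₀ := hc.mem_left.1
      refine ⟨r, hr, y₀, ha, ?_, ?_⟩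
      · rw [← hedge r y₀ hr.2 hy₀]; exact ho
      · refine (hc.induct (P := fun y => Conn (col η none) (Bx b n \ R) y₀ y ∧
          Conn (col η' none) (Bx b n \ R) y₀ y) ⟨.refl hc.1, .refl hc.1⟩ ?_).2
        rintro x z hx ⟨h1, h2⟩ hxz hz
        refine ⟨h1.tail hxz hz, h2.tail ⟨hxz.1, ?_⟩ hz⟩
        have := hbase x z hx.mem_right.1 hz.1 ⟨r, hr, y₀, ha, ho, h1⟩
        simp only [col]
        rw [← this]; exact hxz.2
  have hseed : ∀ z ∈ Face b n i σ, (seedOpen m i σ z (col η' (some κ)) ↔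
      seedOpen m i σ z (col η (some κ))) := by
    intro z hz
    refine forall₂_congr fun e he => ?_
    simp only [col, hspr e (hs z hz he)]
  refine ⟨?_, ?_⟩
  · unfold nextR
    rw [hgrown]
    congr 1
    ext x
    simp only [Set.mem_ofPred_eq]
    refine exists_congr fun z => and_congr_right fun hz => ?_
    rw [hseed z hz]
  · simp only [stepFail, Set.mem_ofPred_eq, hgrown]
    refine forall₂_congr fun z hz => ?_
    rw [hseed z hz]

lemma reach_step {c : ℤ × ℤ → Zd d} {M m n : ℕ} {Reg T R : Set (Zd d)} {V : Finset (ℤ × ℤ)}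
    {v : ℤ × ℤ} (hv : v ∈ V) {b : Zd d} {i : Fin d} {σ : Fin d → ℤˣ}
    (hb : Bx b n ⊆ Bx (c v) (3 * M)) (hbR : Bx b n ⊆ Reg)
    (hs : ∀ z ∈ Face b n i σ, seedEd m i σ z ⊆ Ed (Bx (c v) (3 * M)))
    (hsR : ∀ z ∈ Face b n i σ, Bx (seedC m i σ z) m ⊆ Reg) (hR : R ⊆ Reg)
    {η : Sym2 (Zd d) × Option Col → Bool}
    (h : η ∈ reachEv c M Reg T (nextR b m n i σ (chi v) R η) (V.erase v)) :
    η ∈ reachEv c M Reg T R V := by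
  obtain ⟨r', hr', t, ht, hc⟩ := h
  have hspr : ∀ e ∈ Ed (Bx (c v) (3 * M)), η (e, some (chi v)) = true →
      mix c M R V η e = true := fun e he h => mix_true.2 (Or.inr ⟨v, hv, he, h⟩)
  have hg : ∀ z ∈ R ∪ grown b n (chi v) R η, z ∈ Reg → ∃ r ∈ R, Conn (mix c M R V η) Reg r z := by
    rintro z (hz | ⟨r, hr, y₀, ha, ho, hc⟩) hzR
    · exact ⟨z, hz, .refl hzR⟩
    · refine ⟨r, hr.1, (Conn.single (hR hr.1) (hbR hc.mem_left.1) ⟨ha, hspr _ ?_ ho⟩).trans ?_⟩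
      · exact mk_mem_Ed.2 ⟨hb hr.2, hb hc.mem_left.1⟩
      · refine (hc.congr fun e he h1 => mix_true.2 (Or.inl ⟨?_, h1⟩)).mono_set
          (Set.sdiff_subset.trans hbR)
        exact Ed_mono (fun x hx => hx.2) he
  have hconn : ∃ r ∈ R, Conn (mix c M R V η) Reg r r' := by
    rcases hr' with hr' | ⟨z, hz, hzg, hso, hx⟩
    · exact hg r' hr' hc.mem_left
    · obtain ⟨r, hr, hrz⟩ := hg z hzg (hbR (Face_subset _ _ _ _ hz))
      refine ⟨r, hr, hrz.trans ?_⟩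
      set z' := Function.update z i (z i + σ i) with hz'
      have hz'B : z' ∈ Bx (seedC m i σ z) m := by
        intro j
        by_cases hj : j = i
        · subst hj
          simp only [hz', seedC, Function.update_self]
          have e : z j + σ j - (z j + σ j * (m + 1)) = (σ j : ℤ) * (-m) := by ring
          rw [e, abs_unit_mul, abs_neg, Nat.abs_cast]
        · simp [hz', seedC, hj]
      have hadj : latAdj z z' := by
        unfold latAdj
        rw [Finset.sum_eq_single i]
        · simp only [hz', Function.update_self]
          rcases Int.units_eq_one_or (σ i) with h | h <;> simp [h]
        · intro j _ hj; simp [hz', hj]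
        · simp
      have h1 : s(z, z') ∈ seedEd m i σ z := Or.inr rfl
      refine (Conn.single hrz.mem_right (hsR z hz hz'B)
        ⟨hadj, hspr _ (hs z hz h1) (hso _ h1)⟩).trans ?_
      refine ((conn_Bx hz'B hx).congr fun e he _ => ?_).mono_set (hsR z hz)
      exact hspr _ (hs z hz (Or.inl he)) (hso _ (Or.inl he))
  obtain ⟨r, hr, hrr⟩ := hconn
  refine ⟨r, hr, t, ht, hrr.trans (hc.congr fun e _ h1 => ?_)⟩
  rw [mix_true] at h1 ⊢
  rcases h1 with ⟨h1, h2⟩ | ⟨w, hw, h1, h2⟩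
  · exact Or.inl ⟨Ed_mono (Set.compl_subset_compl.2 fun x hxR => Or.inl (Or.inl hxR)) h1, h2⟩
  · exact Or.inr ⟨w, Finset.mem_of_mem_erase hw, h1, h2⟩

end

section

/-! ### Renormalized connections -/

variable {d : ℕ}

/-- The region associated with a set of coarse sites. -/
def region (c : ℤ × ℤ → Zd d) (M : ℕ) (G : Finset (ℤ × ℤ)) : Set (Zd d) :=
  ⋃ u ∈ G, Bx (c u) (2 * M)

lemma region_finite (c : ℤ × ℤ → Zd d) (M : ℕ) (G : Finset (ℤ × ℤ)) : (region c M G).Finite :=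
  G.finite_toSet.biUnion fun _ _ => Bx_finite _ _

/-- Comparison of the exploration with site percolation in the coarse plane. -/
lemma site_le_reach {p δ s : unitInterval} {m n : ℕ} (z₀ : Zd d) {i₁ i₂ : Fin d}
    (hi : i₁ ≠ i₂) (hstep : ∀ (b : Zd d) (i : Fin d) (σ : Fin d → ℤˣ) (κ : Col) (R : Set (Zd d)),
      Bx b m ⊆ R → (bern (wts p δ)).real (stepFail b m n i σ κ R) ≤ 1 - s)
    (G : Finset (ℤ × ℤ)) (x : ℤ × ℤ) :
    ∀ (V O : Finset (ℤ × ℤ)) (R : Set (Zd d)), V ⊆ G → O ⊆ G →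
      R ⊆ region (cen z₀ (n + m + 1) i₁ i₂) (n + m + 1) G →
      (∀ u ∈ O, ∃ b, Bx b m ⊆ R ∧ b ∈ Bx (cen z₀ (n + m + 1) i₁ i₂ u) n) →
      (bern fun _ => s).real (siteReach O V x) ≤ (bern (wts p δ)).real
        (reachEv (cen z₀ (n + m + 1) i₁ i₂) (n + m + 1)
          (region (cen z₀ (n + m + 1) i₁ i₂) (n + m + 1) G)
          (Bx (cen z₀ (n + m + 1) i₁ i₂ x) (n + m + 1)) R V) := by
  set M := n + m + 1 with hM
  set c := cen z₀ M i₁ i₂ with hc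
  set Reg := region c M G with hReg
  set T := Bx (c x) M with hT
  have hM0 : 0 < M := by omega
  intro V
  induction hk : V.card using Nat.strong_induction_on generalizing V with
  | _ k ih =>
  intro O R hVG hOG hR hO
  by_cases hx : x ∈ O
  · obtain ⟨b, hb1, hb2⟩ := hO x hx
    have hbR : b ∈ R := hb1 (self_mem_Bx b m)
    have : reachEv c M Reg T R V = Set.univ :=
      Set.eq_univ_of_forall fun η => ⟨b, hbR, b, Bx_mono _ (by omega) hb2, .refl (hR hbR)⟩
    rw [this]
    simp only [probReal_univ]
    exact measureReal_le_one
  by_cases hex : ∃ u ∈ O, ∃ v ∈ V, adj2 u v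
  swap
  · have : siteReach O V x = ∅ := by
      rw [Set.eq_empty_iff_forall_notMem]
      rintro θ ⟨o, ho, h⟩
      have key : ∀ y, Relation.ReflTransGen
          (fun a b => adj2 a b ∧ (b ∈ O ∨ (b ∈ V ∧ θ b = true))) o y → y ∈ O := by
        intro y hy
        induction hy with
        | refl => exact ho
        | tail _ h2 ih2 =>
          rcases h2.2 with h3 | h3
          · exact h3
          · exact (hex ⟨_, ih2, _, h3.1, h2.1⟩).elim
      exact hx (key x h)
    rw [this]; simp [measureReal_nonneg]
  obtain ⟨u, hu, v, hv, huv⟩ := hex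
  obtain ⟨b, hb1, hb2⟩ := hO u hu
  obtain ⟨i, σ, hbv, hbu, hface⟩ := step_geometry (m := m) z₀ hi huv hb2
  rw [← hM, ← hc] at hbv hbu hface
  have hbReg : Bx b n ⊆ Reg := hbu.trans (Set.subset_biUnion_of_mem (u := fun u => Bx (c u) (2 * M))
    (hOG hu))
  have hseedReg : ∀ z ∈ Face b n i σ, Bx (seedC m i σ z) m ⊆ Reg := by
    intro z hz
    refine Set.Subset.trans ?_ (Set.subset_biUnion_of_mem (u := fun u => Bx (c u) (2 * M)) (hVG hv))
    intro y hy j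
    have a1 := _root_.abs_le.1 (hy j)
    have a2 := _root_.abs_le.1 ((hface z hz).1 j)
    rw [_root_.abs_le]
    push_cast [hM] at *
    constructor <;> linarith
  have hs := fun z hz => (hface z hz).2
  set κ := chi v with hκ
  set X := nextR b m n i σ κ R with hX
  set F := stepFail b m n i σ κ R with hF
  have hXReg : ∀ η, X η ⊆ Reg := by
    rintro η y ((hy | ⟨r, hr, y₀, -, -, h⟩) | ⟨z, hz, -, -, hy⟩)
    · exact hR hy
    · exact hbReg h.mem_right.1
    · exact hseedReg z hz hy
  have hRX : ∀ η, R ⊆ X η := fun η y hy => Or.inl (Or.inl hy)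
  have hRegf : Reg.Finite := region_finite _ _ _
  let U : Finset (Set (Zd d)) := hRegf.finite_subsets.toFinset
  have hdep : ∀ ρ, Dep {η | η ∈ F ∧ X η = ρ} (usedSet b (c v) n M κ ρ) := by
    rintro ρ η η' h ⟨h1, rfl⟩
    have := step_congr hbv hs h
    exact ⟨this.2.2 h1, this.1⟩
  have hdep' : ∀ ρ, Dep {η | η ∈ Fᶜ ∧ X η = ρ} (usedSet b (c v) n M κ ρ) := by
    rintro ρ η η' h ⟨h1, rfl⟩
    have := step_congr hbv hs h
    exact ⟨fun h2 => h1 (this.2.1 h2), this.1⟩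
  have hdepF : Dep F (usedSet b (c v) n M κ Reg) := by
    intro η η' h h1
    refine (step_congr hbv hs fun j hj => h j ?_).2.2 h1
    rcases hj with ⟨e, he, rfl⟩ | hj
    · exact Or.inl ⟨e, ⟨he.1, fun h => he.2 (Ed_mono (Set.compl_subset_compl.2 (hXReg η)) h)⟩, rfl⟩
    · exact Or.inr hj
  have hmF : MeasurableSet F := hdepF.measurableSet (usedSet_finite _ _ _ _ _ _)
  have hdis : ∀ ρ ∈ U, Disjoint (usedSet b (c v) n M κ ρ) (freshSet c M Reg ρ (V.erase v)) := by
    intro ρ _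
    rw [Set.disjoint_left]
    rintro _ (⟨e, he, rfl⟩ | ⟨e, he, rfl⟩) (⟨e', he', h⟩ | h)
    · obtain rfl := (Prod.mk.inj h).1
      exact he.2 he'.2
    · simp at h
    · simp at h
    · simp only [Set.mem_iUnion] at h
      obtain ⟨w, hw, e', he', h⟩ := h
      obtain ⟨rfl, h2⟩ := Prod.mk.inj h
      obtain ⟨y, hy⟩ : ∃ y, y ∈ e' := by
        induction e' with
        | h x y => exact ⟨x, by simp⟩
      have := chi_disjoint hi hM0 (Option.some.inj h2) (he' y hy) (he y hy)
      exact (Finset.mem_erase.1 hw).1 this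
  have hcard : (V.erase v).card < k := by rw [← hk]; exact Finset.card_erase_lt_of_mem hv
  have hVG' : V.erase v ⊆ G := (Finset.erase_subset _ _).trans hVG
  have hOG' : insert v O ⊆ G := Finset.insert_subset (hVG hv) hOG
  have hqF : ∀ η ∈ F, (bern fun _ => s).real (siteReach O (V.erase v) x) ≤
      (bern (wts p δ)).real (reachEv c M Reg T (X η) (V.erase v)) := by
    intro η _
    refine ih _ hcard _ rfl O (X η) hVG' hOG (hXReg η) fun w hw => ?_
    obtain ⟨b', h1, h2⟩ := hO w hw
    exact ⟨b', h1.trans (hRX η), h2⟩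
  have hqS : ∀ η ∈ Fᶜ, (bern fun _ => s).real (siteReach (insert v O) (V.erase v) x) ≤
      (bern (wts p δ)).real (reachEv c M Reg T (X η) (V.erase v)) := by
    intro η hη
    refine ih _ hcard _ rfl (insert v O) (X η) hVG' hOG' (hXReg η) fun w hw => ?_
    rw [Finset.mem_insert] at hw
    rcases hw with rfl | hw
    · simp only [hF, stepFail, Set.mem_compl_iff, Set.mem_ofPred_eq] at hη
      push Not at hη
      obtain ⟨z, hz, hzg, hso⟩ := hη
      exact ⟨_, fun y hy => Or.inr ⟨z, hz, hzg, hso, hy⟩, (hface z hz).1⟩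
    · obtain ⟨b', h1, h2⟩ := hO w hw
      exact ⟨b', h1.trans (hRX η), h2⟩
  have l1 := fresh_lower (wts p δ) U X F (fun ρ => reachEv c M Reg T ρ (V.erase v))
    (fun ρ => usedSet b (c v) n M κ ρ) (fun ρ => freshSet c M Reg ρ (V.erase v))
    (fun η _ => by simpa [U] using hXReg η) (fun ρ => usedSet_finite _ _ _ _ _ _)
    (fun ρ => freshSet_finite hRegf _ _) hdep (fun ρ => dep_reachEv _ _ _ _ _ _) hdis hqF
  have l2 := fresh_lower (wts p δ) U X Fᶜ (fun ρ => reachEv c M Reg T ρ (V.erase v))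
    (fun ρ => usedSet b (c v) n M κ ρ) (fun ρ => freshSet c M Reg ρ (V.erase v))
    (fun η _ => by simpa [U] using hXReg η) (fun ρ => usedSet_finite _ _ _ _ _ _)
    (fun ρ => freshSet_finite hRegf _ _) hdep' (fun ρ => dep_reachEv _ _ _ _ _ _) hdis hqS
  have hmE : MeasurableSet (reachEv c M Reg T R V) :=
    (dep_reachEv c M Reg T R V).measurableSet (freshSet_finite hRegf _ _)
  have hsub : ∀ η, η ∈ reachEv c M Reg T (X η) (V.erase v) → η ∈ reachEv c M Reg T R V :=
    fun η h => reach_step hv hbv hbReg hs hseedReg hR h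
  have l3 : (bern (wts p δ)).real {η | η ∈ F ∧ η ∈ reachEv c M Reg T (X η) (V.erase v)} +
      (bern (wts p δ)).real {η | η ∈ Fᶜ ∧ η ∈ reachEv c M Reg T (X η) (V.erase v)} ≤
      (bern (wts p δ)).real (reachEv c M Reg T R V) := by
    rw [← measureReal_inter_add_sdiff (μ := bern (wts p δ)) (s := reachEv c M Reg T R V) hmF]
    refine add_le_add (measureReal_mono ?_) (measureReal_mono ?_)
    · rintro η ⟨h1, h2⟩; exact ⟨hsub η h2, h1⟩
    · rintro η ⟨h1, h2⟩; exact ⟨hsub η h2, h1⟩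
  have hf := hstep b i σ κ R hb1
  rw [← hF] at hf
  have hcompl : (bern (wts p δ)).real Fᶜ = 1 - (bern (wts p δ)).real F :=
    probReal_compl_eq_one_sub hmF
  have hsplit := siteReach_split s (O := O) (x := x) hv
  have hmono : (bern fun _ => s).real (siteReach O (V.erase v) x) ≤
      (bern fun _ => s).real (siteReach (insert v O) (V.erase v) x) :=
    measureReal_mono (siteReach_mono (Finset.subset_insert _ _) x)
  rw [hcompl] at l2
  nlinarith

/-- The Grimmett-Marstrand comparison. -/
lemma site_le_conn {p p' δ s : unitInterval} (hp : (1 - (p' : ℝ)) * (1 - (δ : ℝ)) ^ 49 = 1 - p)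
    {m n : ℕ} (z₀ : Zd d) {i₁ i₂ : Fin d}
    (hi : i₁ ≠ i₂) (hstep : ∀ (b : Zd d) (i : Fin d) (σ : Fin d → ℤˣ) (κ : Col) (R : Set (Zd d)),
      Bx b m ⊆ R → (bern (wts p' δ)).real (stepFail b m n i σ κ R) ≤ 1 - s)
    (G : Finset (ℤ × ℤ)) {o x : ℤ × ℤ} (ho : o ∈ G) :
    (bern fun _ => s).real (siteReach {o} G x) ≤ (bern fun _ => p).real
      {ω : Config d | ∃ y ∈ Bx (cen z₀ (n + m + 1) i₁ i₂ o) m,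
        ∃ t ∈ Bx (cen z₀ (n + m + 1) i₁ i₂ x) (n + m + 1),
        Conn ω (region (cen z₀ (n + m + 1) i₁ i₂) (n + m + 1) G) y t} := by
  set c := cen z₀ (n + m + 1) i₁ i₂ with hc
  have h1 := site_le_reach z₀ hi hstep G x G {o} (Bx (c o) m) subset_rfl (by simpa using ho)
    ((Bx_mono _ (by omega)).trans (Set.subset_biUnion_of_mem
      (u := fun u => Bx (c u) (2 * (n + m + 1))) ho))
    (fun u hu => by
      rw [Finset.mem_singleton] at hu; subst hu; exact ⟨c u, subset_rfl, self_mem_Bx _ _⟩)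
  refine h1.trans ?_
  have hw : ∏ k : Option Col, (1 - ((k.elim p' fun _ => δ : unitInterval) : ℝ)) = 1 - p := by
    rw [Fintype.prod_option]
    simp only [Option.elim, Finset.prod_const, Finset.card_univ, Fintype.card_prod, ZMod.card]
    rw [← hp]
  have hmap := map_superpose (E := Sym2 (Zd d)) (fun k : Option Col => k.elim p' fun _ => δ) p hw
  rw [← hmap, Measure.real, Measure.real, Measure.map_apply measurable_superpose]
  · refine ENNReal.toReal_mono (measure_ne_top _ _) (measure_mono ?_)
    rintro η ⟨r, hr, t, ht, hh⟩
    refine ⟨r, hr, t, ht, hh.congr fun e _ h => ?_⟩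
    rw [mix_true] at h
    rw [superpose_true]
    rcases h with ⟨-, h⟩ | ⟨v, -, -, h⟩
    · exact ⟨_, h⟩
    · exact ⟨_, h⟩
  · have : {ω : Config d | ∃ y ∈ Bx (c o) m, ∃ t ∈ Bx (c x) (n + m + 1),
        Conn ω (region c (n + m + 1) G) y t} = ⋃ y ∈ Bx (c o) m, ⋃ t ∈ Bx (c x) (n + m + 1),
        {ω | Conn ω (region c (n + m + 1) G) y t} := by
      ext ω; simp
    rw [this]
    exact MeasurableSet.biUnion (Bx_finite _ _).countable fun y _ => MeasurableSet.biUnion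
      (Bx_finite _ _).countable fun t _ => (dep_conn _ _ _).measurableSet
        (Ed_finite (region_finite _ _ _))

end

section

/-! ### The triadic hierarchy -/

/-- The parent of a coarse site in the triadic hierarchy. -/
def par (a : ℤ × ℤ) : ℤ × ℤ := (a.1 / 3, a.2 / 3)

/-- A block is good if at most one of its nine sub-blocks is not good. -/
def Good (θ : ℤ × ℤ → Bool) : ℕ → ℤ × ℤ → Prop
  | 0, u => θ u = true
  | k + 1, u => ∀ a b, par a = u → par b = u → a ≠ b → Good θ k a ∨ Good θ k b

/-- The core of a good block. -/
def Core (θ : ℤ × ℤ → Bool) : ℕ → ℤ × ℤ → ℤ × ℤ → Prop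
  | 0, u, x => x = u
  | k + 1, u, x => ∃ a, par a = u ∧ Good θ k a ∧ Core θ k a x

/-- Open paths in the coarse plane. -/
def sRel (θ : ℤ × ℤ → Bool) : ℤ × ℤ → ℤ × ℤ → Prop :=
  Relation.ReflTransGen fun a b => adj2 a b ∧ θ a = true ∧ θ b = true

lemma adj2.symm {u v : ℤ × ℤ} (h : adj2 u v) : adj2 v u := by
  unfold adj2 at *; rw [abs_sub_comm v.1, abs_sub_comm v.2]; exact h

lemma sRel.symm {θ : ℤ × ℤ → Bool} {x y : ℤ × ℤ} (h : sRel θ x y) : sRel θ y x := by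
  have : Std.Symm (fun a b => adj2 a b ∧ θ a = true ∧ θ b = true) :=
    ⟨fun a b h => ⟨h.1.symm, h.2.2, h.2.1⟩⟩
  exact Relation.ReflTransGen.stdSymm.symm _ _ h

lemma block_connected {g : ℤ × ℤ → Prop} {E : ℤ × ℤ → ℤ × ℤ → Prop}
    (hs : ∀ a b, E a b → E b a) (ht : ∀ a b c, g b → E a b → E b c → E a c)
    (hr : ∀ a, g a → E a a)
    (ha : ∀ a b, g a → g b → adj2 a b → E a b) {u : ℤ × ℤ}
    (hu : ∀ a b, par a = u → par b = u → a ≠ b → g a ∨ g b) {a b : ℤ × ℤ} (hau : par a = u)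
    (hbu : par b = u) (hga : g a) (hgb : g b) : E a b := by
  obtain ⟨u1, u2⟩ := u
  have hpar : ∀ s t : ℤ, 0 ≤ s → s < 3 → 0 ≤ t → t < 3 →
      par (3 * u1 + s, 3 * u2 + t) = (u1, u2) := by
    intro s t h1 h2 h3 h4
    simp only [par, Prod.mk.injEq]; omega
  have hor : ∀ s t s' t' : ℤ, 0 ≤ s → s < 3 → 0 ≤ t → t < 3 → 0 ≤ s' → s' < 3 → 0 ≤ t' → t' < 3 →
      (s ≠ s' ∨ t ≠ t') → g (3 * u1 + s, 3 * u2 + t) ∨ g (3 * u1 + s', 3 * u2 + t') := by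
    intro s t s' t' h1 h2 h3 h4 h5 h6 h7 h8 h
    refine hu _ _ (hpar s t h1 h2 h3 h4) (hpar s' t' h5 h6 h7 h8) ?_
    intro h9
    simp only [Prod.mk.injEq] at h9
    omega
  have hadj : ∀ s t s' t' : ℤ, |s - s'| + |t - t'| = 1 → g (3 * u1 + s, 3 * u2 + t) →
      g (3 * u1 + s', 3 * u2 + t') → E (3 * u1 + s, 3 * u2 + t) (3 * u1 + s', 3 * u2 + t') := by
    intro s t s' t' h h1 h2
    refine ha _ _ h1 h2 ?_
    unfold adj2
    simpa using h
  have hrep : ∀ a, par a = (u1, u2) → ∃ s t : ℤ, (s = 0 ∨ s = 1 ∨ s = 2) ∧ (t = 0 ∨ t = 1 ∨ t = 2) ∧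
      a = (3 * u1 + s, 3 * u2 + t) := by
    rintro ⟨a1, a2⟩ h
    simp only [par, Prod.mk.injEq] at h
    refine ⟨a1 - 3 * u1, a2 - 3 * u2, by omega, by omega, ?_⟩
    simp
  have hub : ∃ h, g h ∧ ∀ a, par a = (u1, u2) → g a → E a h := by
    by_cases hc : g (3 * u1 + 1, 3 * u2 + 1)
    · refine ⟨_, hc, fun a h1 h2 => ?_⟩
      obtain ⟨s, t, hs', ht', rfl⟩ := hrep a h1
      by_cases h11 : s = 1 ∧ t = 1
      · obtain ⟨rfl, rfl⟩ := h11; exact hr _ hc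
      by_cases h1 : s = 1 ∨ t = 1
      · refine hadj _ _ _ _ ?_ h2 hc
        rw [Int.abs_eq_natAbs, Int.abs_eq_natAbs]; omega
      rcases hor s 1 1 t (by omega) (by omega) (by omega) (by omega) (by omega) (by omega) (by omega)
        (by omega) (by omega) with h | h
      · refine ht _ _ _ h (hadj _ _ _ _ ?_ h2 h) (hadj _ _ _ _ ?_ h hc) <;>
        rw [Int.abs_eq_natAbs, Int.abs_eq_natAbs] <;> omega
      · refine ht _ _ _ h (hadj _ _ _ _ ?_ h2 h) (hadj _ _ _ _ ?_ h hc) <;>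
        rw [Int.abs_eq_natAbs, Int.abs_eq_natAbs] <;> omega
    · have hg : ∀ s t : ℤ, 0 ≤ s → s < 3 → 0 ≤ t → t < 3 → (s ≠ 1 ∨ t ≠ 1) →
          g (3 * u1 + s, 3 * u2 + t) := fun s t h1 h2 h3 h4 h5 =>
        (hor s t 1 1 h1 h2 h3 h4 (by omega) (by omega) (by omega) (by omega) h5).resolve_right hc
      have g00 := hg 0 0 (by omega) (by omega) (by omega) (by omega) (by omega)
      have g01 := hg 0 1 (by omega) (by omega) (by omega) (by omega) (by omega)
      have g02 := hg 0 2 (by omega) (by omega) (by omega) (by omega) (by omega)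
      have g12 := hg 1 2 (by omega) (by omega) (by omega) (by omega) (by omega)
      have g22 := hg 2 2 (by omega) (by omega) (by omega) (by omega) (by omega)
      have g21 := hg 2 1 (by omega) (by omega) (by omega) (by omega) (by omega)
      have g20 := hg 2 0 (by omega) (by omega) (by omega) (by omega) (by omega)
      have g10 := hg 1 0 (by omega) (by omega) (by omega) (by omega) (by omega)
      have e01 := hadj 0 1 0 0 (by norm_num) g01 g00
      have e02 := ht _ _ _ g01 (hadj 0 2 0 1 (by norm_num) g02 g01) e01
      have e12 := ht _ _ _ g02 (hadj 1 2 0 2 (by norm_num) g12 g02) e02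
      have e22 := ht _ _ _ g12 (hadj 2 2 1 2 (by norm_num) g22 g12) e12
      have e10 := hadj 1 0 0 0 (by norm_num) g10 g00
      have e20 := ht _ _ _ g10 (hadj 2 0 1 0 (by norm_num) g20 g10) e10
      have e21 := ht _ _ _ g20 (hadj 2 1 2 0 (by norm_num) g21 g20) e20
      refine ⟨_, g00, fun a h1 h2 => ?_⟩
      obtain ⟨s, t, hs', ht', rfl⟩ := hrep a h1
      clear hor hadj hrep hpar hg hu
      rcases hs' with rfl | rfl | rfl <;> rcases ht' with rfl | rfl | rfl <;>
        first | assumption | exact hr _ g00 | exact (hc h2).elim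
  obtain ⟨h, hg, H⟩ := hub
  exact ht _ _ _ hg (H a hau hga) (hs _ _ (H b hbu hgb))

lemma face_pair {g : ℤ × ℤ → Prop} {u v : ℤ × ℤ} (huv : adj2 u v)
    (hu : ∀ a b, par a = u → par b = u → a ≠ b → g a ∨ g b)
    (hv : ∀ a b, par a = v → par b = v → a ≠ b → g a ∨ g b) :
    ∃ a b, par a = u ∧ par b = v ∧ g a ∧ g b ∧ adj2 a b := by
  obtain ⟨u1, u2⟩ := u
  obtain ⟨v1, v2⟩ := v
  unfold adj2 at huv
  simp only at huv
  have key : ∀ f f' : ℤ → ℤ × ℤ, (∀ i, 0 ≤ i → i < 3 → par (f i) = (u1, u2)) →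
      (∀ i, 0 ≤ i → i < 3 → par (f' i) = (v1, v2)) → (∀ i, adj2 (f i) (f' i)) →
      f.Injective → f'.Injective → ∃ a b, par a = (u1, u2) ∧ par b = (v1, v2) ∧ g a ∧ g b ∧ adj2 a b := by
    intro f f' h1 h2 h3 h4 h5
    have a01 := hu _ _ (h1 0 (by omega) (by omega)) (h1 1 (by omega) (by omega)) (h4.ne (by omega))
    have a02 := hu _ _ (h1 0 (by omega) (by omega)) (h1 2 (by omega) (by omega)) (h4.ne (by omega))
    have a12 := hu _ _ (h1 1 (by omega) (by omega)) (h1 2 (by omega) (by omega)) (h4.ne (by omega))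
    have b01 := hv _ _ (h2 0 (by omega) (by omega)) (h2 1 (by omega) (by omega)) (h5.ne (by omega))
    have b02 := hv _ _ (h2 0 (by omega) (by omega)) (h2 2 (by omega) (by omega)) (h5.ne (by omega))
    have b12 := hv _ _ (h2 1 (by omega) (by omega)) (h2 2 (by omega) (by omega)) (h5.ne (by omega))
    have : (g (f 0) ∧ g (f' 0)) ∨ (g (f 1) ∧ g (f' 1)) ∨ (g (f 2) ∧ g (f' 2)) := by tauto
    rcases this with h | h | h
    · exact ⟨_, _, h1 0 (by omega) (by omega), h2 0 (by omega) (by omega), h.1, h.2, h3 0⟩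
    · exact ⟨_, _, h1 1 (by omega) (by omega), h2 1 (by omega) (by omega), h.1, h.2, h3 1⟩
    · exact ⟨_, _, h1 2 (by omega) (by omega), h2 2 (by omega) (by omega), h.1, h.2, h3 2⟩
  have h4 : (v1 = u1 + 1 ∧ v2 = u2) ∨ (v1 = u1 - 1 ∧ v2 = u2) ∨ (v1 = u1 ∧ v2 = u2 + 1) ∨
      (v1 = u1 ∧ v2 = u2 - 1) := by
    rw [Int.abs_eq_natAbs, Int.abs_eq_natAbs] at huv; omega
  have fin : ∀ s t s' t' : ℤ, |s - s'| + |t - t'| = 1 → ∀ i, adj2 (s + i, t) (s' + i, t') := by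
    intro s t s' t' h i; unfold adj2; simpa using h
  have fin' : ∀ s t s' t' : ℤ, |s - s'| + |t - t'| = 1 → ∀ i, adj2 (s, t + i) (s', t' + i) := by
    intro s t s' t' h i; unfold adj2; simpa using h
  rcases h4 with ⟨rfl, rfl⟩ | ⟨rfl, rfl⟩ | ⟨rfl, rfl⟩ | ⟨rfl, rfl⟩
  · refine key (fun i => (3 * u1 + 2, 3 * v2 + i)) (fun i => (3 * u1 + 3, 3 * v2 + i)) ?_ ?_
      (fin' _ _ _ _ (by simp)) ?_ ?_
    · intro i h1 h2; simp only [par, Prod.mk.injEq]; omega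
    · intro i h1 h2; simp only [par, Prod.mk.injEq]; omega
    · intro i j h; simpa using h
    · intro i j h; simpa using h
  · refine key (fun i => (3 * u1, 3 * v2 + i)) (fun i => (3 * u1 - 1, 3 * v2 + i)) ?_ ?_
      (fin' _ _ _ _ (by simp)) ?_ ?_
    · intro i h1 h2; simp only [par, Prod.mk.injEq]; omega
    · intro i h1 h2; simp only [par, Prod.mk.injEq]; omega
    · intro i j h; simpa using h
    · intro i j h; simpa using h
  · refine key (fun i => (3 * v1 + i, 3 * u2 + 2)) (fun i => (3 * v1 + i, 3 * u2 + 3)) ?_ ?_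
      (fin _ _ _ _ (by simp)) ?_ ?_
    · intro i h1 h2; simp only [par, Prod.mk.injEq]; omega
    · intro i h1 h2; simp only [par, Prod.mk.injEq]; omega
    · intro i j h; simpa using h
    · intro i j h; simpa using h
  · refine key (fun i => (3 * v1 + i, 3 * u2)) (fun i => (3 * v1 + i, 3 * u2 - 1)) ?_ ?_
      (fin _ _ _ _ (by simp)) ?_ ?_
    · intro i h1 h2; simp only [par, Prod.mk.injEq]; omega
    · intro i h1 h2; simp only [par, Prod.mk.injEq]; omega
    · intro i j h; simpa using h
    · intro i j h; simpa using h

lemma good_nonempty {θ : ℤ × ℤ → Bool} : ∀ (k : ℕ) (u : ℤ × ℤ), Good θ k u → ∃ x, Core θ k u x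
  | 0, u, _ => ⟨u, rfl⟩
  | k + 1, u, h => by
    have h1 : par (3 * u.1, 3 * u.2) = u := by ext <;> simp [par]
    have h2 : par (3 * u.1 + 1, 3 * u.2) = u := by ext <;> simp [par]; omega
    rcases h _ _ h1 h2 (by simp) with h | h
    · obtain ⟨x, hx⟩ := good_nonempty k _ h
      exact ⟨x, _, h1, h, hx⟩
    · obtain ⟨x, hx⟩ := good_nonempty k _ h
      exact ⟨x, _, h2, h, hx⟩

lemma core_connected {θ : ℤ × ℤ → Bool} (k : ℕ) : ∀ u v : ℤ × ℤ, (u = v ∨ adj2 u v) → Good θ k u →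
    Good θ k v → ∀ x y, Core θ k u x → Core θ k v y → sRel θ x y := by
  induction k with
  | zero =>
    rintro u v huv hu hv x y rfl rfl
    rcases huv with rfl | h
    · exact .refl
    · exact .single ⟨h, hu, hv⟩
  | succ k ih =>
    let E : ℤ × ℤ → ℤ × ℤ → Prop := fun a b => ∀ x y, Core θ k a x → Core θ k b y → sRel θ x y
    have hs : ∀ a b, E a b → E b a := fun a b h x y hx hy => (h y x hy hx).symm
    have ht : ∀ a b c, Good θ k b → E a b → E b c → E a c := by
      intro a b c hb h1 h2 x y hx hy
      obtain ⟨w, hw⟩ := good_nonempty k b hb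
      exact (h1 x w hx hw).trans (h2 w y hw hy)
    have hr : ∀ a, Good θ k a → E a a := fun a h => ih a a (.inl rfl) h h
    have ha : ∀ a b, Good θ k a → Good θ k b → adj2 a b → E a b := fun a b h1 h2 h =>
      ih a b (.inr h) h1 h2
    rintro u v huv hu hv x y ⟨a, ha1, ha2, ha3⟩ ⟨b, hb1, hb2, hb3⟩
    suffices h : E a b from h x y ha3 hb3
    rcases huv with rfl | h
    · exact block_connected hs ht hr ha hu ha1 hb1 ha2 hb2
    · obtain ⟨a', b', h1, h2, h3, h4, h5⟩ := face_pair h hu hv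
      exact ht _ _ _ h3 (block_connected hs ht hr ha hu ha1 h1 ha2 h3)
        (ht _ _ _ h4 (ha _ _ h3 h4 h5) (block_connected hs ht hr ha hv h2 hb1 h4 hb2))

lemma core_anc {θ : ℤ × ℤ → Bool} (o : ℤ × ℤ) : ∀ k : ℕ, (∀ i < k, Good θ i (par^[i] o)) →
    Core θ k (par^[k] o) o
  | 0, _ => rfl
  | k + 1, h => ⟨par^[k] o, (Function.iterate_succ_apply' par k o).symm, h k (by omega),
    core_anc o k fun i hi => h i (by omega)⟩

lemma dep_good (k : ℕ) : ∀ u, Dep {θ | Good θ k u} {v | par^[k] v = u} := by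
  induction k with
  | zero =>
    intro u θ θ' h h1
    have := h u (by simp)
    simp only [Set.mem_ofPred_eq, Good] at h1 ⊢
    rw [← this]; exact h1
  | succ k ih =>
    intro u θ θ' h h1 a b ha hb hab
    refine (h1 a b ha hb hab).imp (fun h2 => ih a θ θ' ?_ h2) (fun h2 => ih b θ θ' ?_ h2)
    · rintro v rfl; exact h v (by rw [Set.mem_ofPred_eq, Function.iterate_succ_apply', ha])
    · rintro v rfl; exact h v (by rw [Set.mem_ofPred_eq, Function.iterate_succ_apply', hb])

end

section

/-! ### Contours in the plane -/

lemma par_iterate (k : ℕ) (v : ℤ × ℤ) : par^[k] v = (v.1 / 3 ^ k, v.2 / 3 ^ k) := by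
  induction k with
  | zero => simp
  | succ k ih =>
    rw [Function.iterate_succ_apply', ih]
    simp only [par, pow_succ]
    rw [Int.ediv_ediv_of_nonneg (by positivity), Int.ediv_ediv_of_nonneg (by positivity)]

lemma block_finite (k : ℕ) (u : ℤ × ℤ) : {v : ℤ × ℤ | par^[k] v = u}.Finite := by
  refine (Set.finite_Icc ((3 ^ k * u.1, 3 ^ k * u.2) : ℤ × ℤ)
    (3 ^ k * u.1 + 3 ^ k, 3 ^ k * u.2 + 3 ^ k)).subset ?_
  rintro v hv
  rw [Set.mem_ofPred_eq, par_iterate] at hv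
  have h3 : (0 : ℤ) < 3 ^ k := by positivity
  have e1 := Int.mul_ediv_add_emod v.1 (3 ^ k)
  have e2 := Int.mul_ediv_add_emod v.2 (3 ^ k)
  have f1 := Int.emod_nonneg v.1 h3.ne'
  have f2 := Int.emod_nonneg v.2 h3.ne'
  have g1 := Int.emod_lt_of_pos v.1 h3
  have g2 := Int.emod_lt_of_pos v.2 h3
  have hv1 : v.1 / 3 ^ k = u.1 := by rw [← hv]
  have hv2 : v.2 / 3 ^ k = u.2 := by rw [← hv]
  rw [hv1] at e1; rw [hv2] at e2
  exact ⟨⟨by simp only; omega, by simp only; omega⟩, ⟨by simp only; omega, by simp only; omega⟩⟩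

lemma measurableSet_good (k : ℕ) (u : ℤ × ℤ) : MeasurableSet {θ | Good θ k u} :=
  (dep_good k u).measurableSet (block_finite k u)

lemma prob_not_good (s : unitInterval) {e : ℝ} (he : 1 - (s : ℝ) = e) (he' : e ≤ 1 / 324) (k : ℕ) :
    ∀ u, (bern fun _ : ℤ × ℤ => s).real {θ | ¬ Good θ k u} ≤ e * (1 / 4) ^ k := by
  have he0 : 0 ≤ e := by rw [← he]; linarith [s.2.2]
  induction k with
  | zero =>
    intro u
    have : {θ : ℤ × ℤ → Bool | ¬ Good θ 0 u} = {θ | θ u = false} := by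
      ext θ; simp [Good]
    rw [this, bern_false]; simp [he]
  | succ k ih =>
    intro u
    let kids : Finset (ℤ × ℤ) :=
      Finset.Icc (3 * u.1) (3 * u.1 + 2) ×ˢ Finset.Icc (3 * u.2) (3 * u.2 + 2)
    have hk : ∀ a, par a = u → a ∈ kids := by
      rintro a rfl
      simp only [kids, par, Finset.mem_product, Finset.mem_Icc]; omega
    have hcard : (kids ×ˢ kids).card = 81 := by
      have h (a : ℤ) : (a + 2 + 1 - a).toNat = 3 := by omega
      simp [kids, Finset.card_product, h]
    let P := (kids ×ˢ kids).filter fun q => q.1 ≠ q.2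
    have hsub : {θ : ℤ × ℤ → Bool | ¬ Good θ (k + 1) u} ⊆
        ⋃ q ∈ P, ({θ | ¬ Good θ k q.1} ∩ {θ | ¬ Good θ k q.2}) := by
      intro θ hθ
      simp only [Set.mem_ofPred_eq, Good] at hθ
      push Not at hθ
      obtain ⟨a, b, ha, hb, hab, h1, h2⟩ := hθ
      refine Set.mem_biUnion (x := (a, b)) ?_ ⟨h1, h2⟩
      simp [P, hk a ha, hk b hb, hab]
    calc _ ≤ (bern fun _ : ℤ × ℤ => s).real _ := measureReal_mono hsub (measure_ne_top _ _)
      _ ≤ ∑ q ∈ P, (bern fun _ : ℤ × ℤ => s).real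
          ({θ | ¬ Good θ k q.1} ∩ {θ | ¬ Good θ k q.2}) := measureReal_biUnion_finset_le _ _
      _ ≤ ∑ q ∈ P, (e * (1 / 4) ^ k) ^ 2 := by
        refine Finset.sum_le_sum fun q hq => ?_
        have hne : q.1 ≠ q.2 := (Finset.mem_filter.1 hq).2
        have hdis : Disjoint {v : ℤ × ℤ | par^[k] v = q.1} {v | par^[k] v = q.2} := by
          rw [Set.disjoint_left]; intro v h1 h2; exact hne (h1.symm.trans h2)
        have := bern_inter (fun _ : ℤ × ℤ => s) (dep_good k q.1).compl (dep_good k q.2).compl hdis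
          (measurableSet_good k q.1).compl (measurableSet_good k q.2).compl
        calc _ = _ := this
          _ ≤ (e * (1 / 4) ^ k) * (e * (1 / 4) ^ k) :=
            mul_le_mul (ih _) (ih _) measureReal_nonneg (by positivity)
          _ = _ := by ring
      _ = P.card * (e * (1 / 4) ^ k) ^ 2 := by simp
      _ ≤ 81 * (e * (1 / 4) ^ k) ^ 2 := by
        gcongr
        have : P.card ≤ 81 := hcard ▸ Finset.card_filter_le _ _
        exact_mod_cast this
      _ ≤ e * (1 / 4) ^ (k + 1) := by
        have h1 : ((1 : ℝ) / 4) ^ k ≤ 1 := pow_le_one₀ (by norm_num) (by norm_num)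
        have h2 : 0 ≤ ((1 : ℝ) / 4) ^ k := by positivity
        have h3 : 81 * e * (1 / 4) ^ k ≤ 1 / 4 := by nlinarith
        calc _ = (81 * e * (1 / 4) ^ k) * (e * (1 / 4) ^ k) := by ring
          _ ≤ 1 / 4 * (e * (1 / 4) ^ k) := by gcongr
          _ = _ := by ring

/-- A long rectangle of coarse sites. -/
noncomputable def grid (j q : ℕ) : Finset (ℤ × ℤ) :=
  Finset.Ico 0 ((q * 3 ^ j : ℕ) : ℤ) ×ˢ Finset.Ico 0 ((3 ^ j : ℕ) : ℤ)

lemma mem_grid_iff {j q : ℕ} {v : ℤ × ℤ} :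
    v ∈ grid j q ↔ ∃ t < q, par^[j] v = ((t : ℤ), 0) := by
  have h3 : (0 : ℤ) < 3 ^ j := by positivity
  have e1 := Int.mul_ediv_add_emod v.1 (3 ^ j)
  have f1 := Int.emod_nonneg v.1 h3.ne'
  have g1 := Int.emod_lt_of_pos v.1 h3
  rw [par_iterate]
  simp only [grid, Finset.mem_product, Finset.mem_Ico, Prod.mk.injEq]
  push_cast
  constructor
  · rintro ⟨⟨h1, h2⟩, h4, h5⟩
    have h6 : 0 ≤ v.1 / 3 ^ j := Int.ediv_nonneg h1 h3.le
    have h7 : v.1 / 3 ^ j < q := Int.ediv_lt_of_lt_mul h3 h2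
    exact ⟨(v.1 / 3 ^ j).toNat, by omega, by omega, Int.ediv_eq_zero_of_lt h4 h5⟩
  · rintro ⟨t, ht, h1, h2⟩
    have e2 := Int.mul_ediv_add_emod v.2 (3 ^ j)
    have f2 := Int.emod_nonneg v.2 h3.ne'
    have g2 := Int.emod_lt_of_pos v.2 h3
    rw [h2] at e2
    rw [h1] at e1
    have ht' : (t : ℤ) + 1 ≤ q := by exact_mod_cast ht
    refine ⟨⟨?_, ?_⟩, by omega, by omega⟩
    · nlinarith
    · nlinarith

/-- Site percolation at high density connects any two given sites of a long rectangle with high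
probability, uniformly. -/
lemma site_connect {ε : ℝ} (hε : 0 < ε) (K : ℕ) : ∃ s : unitInterval, (s : ℝ) < 1 ∧ ∀ j q : ℕ,
    q ≤ K * 3 ^ j → ∀ o ∈ grid j q, ∀ x ∈ grid j q,
    1 - ε ≤ (bern fun _ => s).real (siteReach {o} (grid j q) x) := by
  set e : ℝ := min (1 / 324) (ε / (3 + K)) with he
  have he0 : 0 < e := by positivity
  have he1 : e ≤ 1 / 324 := min_le_left _ _
  have he2 : e * (3 + K) ≤ ε := by
    rw [← le_div_iff₀ (by positivity)]; exact min_le_right _ _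
  refine ⟨⟨1 - e, by constructor <;> linarith⟩, by simpa using he0, ?_⟩
  intro j q hq o ho x hx
  set s : unitInterval := ⟨1 - e, by constructor <;> linarith⟩ with hs
  have hse : 1 - (s : ℝ) = e := by simp [hs]
  set μ := (bern fun _ : ℤ × ℤ => s) with hμ
  have hbad := prob_not_good s hse he1
  set B : Set (ℤ × ℤ → Bool) := ((⋃ i ∈ Finset.range j, {θ | ¬ Good θ i (par^[i] o)}) ∪
    (⋃ i ∈ Finset.range j, {θ | ¬ Good θ i (par^[i] x)})) ∪
    ⋃ t ∈ Finset.range q, {θ | ¬ Good θ j ((t : ℤ), 0)} with hB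
  have hgeo : ∑ i ∈ Finset.range j, e * (1 / 4 : ℝ) ^ i ≤ e * (4 / 3) := by
    rw [← Finset.mul_sum]
    gcongr
    calc _ ≤ ∑' i : ℕ, (1 / 4 : ℝ) ^ i :=
          Summable.sum_le_tsum _ (fun i _ => by positivity)
            (summable_geometric_of_lt_one (by norm_num) (by norm_num))
      _ = 4 / 3 := by rw [tsum_geometric_of_lt_one (by norm_num) (by norm_num)]; norm_num
  have hq' : (q : ℝ) * (1 / 4) ^ j ≤ K := by
    calc (q : ℝ) * (1 / 4) ^ j ≤ (K * 3 ^ j : ℕ) * (1 / 4) ^ j := by gcongr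
      _ = K * (3 / 4) ^ j := by push_cast; rw [mul_assoc, ← mul_pow]; norm_num
      _ ≤ K * 1 := by gcongr; exact pow_le_one₀ (by norm_num) (by norm_num)
      _ = K := mul_one _
  have hPB : μ.real B ≤ ε := by
    have h1 : ∀ y : ℤ × ℤ, μ.real (⋃ i ∈ Finset.range j, {θ | ¬ Good θ i (par^[i] y)}) ≤ e * (4 / 3) :=
      fun y => (measureReal_biUnion_finset_le _ _).trans
        ((Finset.sum_le_sum fun i _ => hbad i _).trans hgeo)
    have h2 : μ.real (⋃ t ∈ Finset.range q, {θ | ¬ Good θ j ((t : ℤ), 0)}) ≤ e * K := by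
      refine (measureReal_biUnion_finset_le _ _).trans
        ((Finset.sum_le_sum fun i _ => hbad j _).trans ?_)
      simp only [Finset.sum_const, Finset.card_range, nsmul_eq_mul]
      calc _ = e * (q * (1 / 4) ^ j) := by ring
        _ ≤ _ := by gcongr
    have h3 := measureReal_union_le (μ := μ) (⋃ i ∈ Finset.range j, {θ | ¬ Good θ i (par^[i] o)})
      (⋃ i ∈ Finset.range j, {θ | ¬ Good θ i (par^[i] x)})
    have h4 := measureReal_union_le (μ := μ) ((⋃ i ∈ Finset.range j, {θ | ¬ Good θ i (par^[i] o)}) ∪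
      (⋃ i ∈ Finset.range j, {θ | ¬ Good θ i (par^[i] x)}))
      (⋃ t ∈ Finset.range q, {θ | ¬ Good θ j ((t : ℤ), 0)})
    have := h1 o
    have := h1 x
    nlinarith
  have hBm : MeasurableSet B := by
    refine ((Finset.measurableSet_biUnion _ fun i _ => (measurableSet_good _ _).compl).union
      (Finset.measurableSet_biUnion _ fun i _ => (measurableSet_good _ _).compl)).union
      (Finset.measurableSet_biUnion _ fun i _ => (measurableSet_good _ _).compl)
  have hsub : Bᶜ ⊆ siteReach {o} (grid j q) x := by
    intro θ hθ
    simp only [hB, Set.compl_union, Set.compl_iUnion, Set.mem_inter_iff, Set.mem_iInter,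
      Set.mem_compl_iff, Set.mem_ofPred_eq, not_not, Finset.mem_range] at hθ
    obtain ⟨⟨hθo, hθx⟩, hθt⟩ := hθ
    set θ' : ℤ × ℤ → Bool := fun v => θ v && decide (v ∈ grid j q) with hθ'
    have htr : ∀ i u, (∀ v, par^[i] v = u → v ∈ grid j q) → Good θ i u → Good θ' i u := by
      intro i u h hg
      refine dep_good i u θ θ' ?_ hg
      intro v hv
      simp [hθ', h v hv]
    have hup : ∀ y ∈ grid j q, ∀ i < j, ∀ v, par^[i] v = par^[i] y → v ∈ grid j q := by
      intro y hy i hi v hv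
      rw [mem_grid_iff] at hy ⊢
      obtain ⟨t, ht, h⟩ := hy
      refine ⟨t, ht, ?_⟩
      obtain ⟨l, rfl⟩ := Nat.exists_eq_add_of_lt hi
      rw [show i + l + 1 = (l + 1) + i by ring, Function.iterate_add_apply] at h ⊢
      rw [hv, h]
    have hgt : ∀ t < q, Good θ' j ((t : ℤ), 0) := fun t ht =>
      htr _ _ (fun v hv => mem_grid_iff.2 ⟨t, ht, hv⟩) (hθt t ht)
    have hcore : ∀ y ∈ grid j q, (∀ i < j, Good θ i (par^[i] y)) →
        ∃ t < q, Core θ' j ((t : ℤ), 0) y := by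
      intro y hy h
      obtain ⟨t, ht, h2⟩ := mem_grid_iff.1 hy
      refine ⟨t, ht, ?_⟩
      rw [← h2]
      exact core_anc y j fun i hi => htr _ _ (hup y hy i hi) (h i hi)
    have hchain : ∀ t < q, ∀ y z, Core θ' j ((0 : ℤ), 0) y → Core θ' j ((t : ℤ), 0) z →
        sRel θ' y z := by
      intro t
      induction t with
      | zero =>
        intro ht y z hy hz
        exact core_connected j _ _ (.inl rfl) (hgt 0 ht) (hgt 0 ht) _ _ hy hz
      | succ t ih =>
        intro ht y z hy hz
        obtain ⟨w, hw⟩ := good_nonempty _ _ (hgt t (by omega))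
        refine (ih (by omega) y w hy hw).trans
          (core_connected j _ _ (.inr ?_) (hgt t (by omega)) (hgt (t + 1) ht) _ _ hw hz)
        simp [adj2]
    obtain ⟨t1, ht1, hc1⟩ := hcore o ho hθo
    obtain ⟨t2, ht2, hc2⟩ := hcore x hx hθx
    obtain ⟨w, hw⟩ := good_nonempty _ _ (hgt 0 (by omega))
    have hpath : sRel θ' o x := (hchain t1 ht1 w o hw hc1).symm.trans (hchain t2 ht2 w x hw hc2)
    refine ⟨o, Finset.mem_singleton_self o, ?_⟩
    refine Relation.ReflTransGen.mono (fun a b h => ⟨h.1, Or.inr ?_⟩) _ _ hpath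
    have := h.2.2
    simp only [hθ', Bool.and_eq_true, decide_eq_true_eq] at this
    exact ⟨this.2, this.1⟩
  calc 1 - ε ≤ 1 - μ.real B := by linarith
    _ = μ.real Bᶜ := (probReal_compl_eq_one_sub hBm).symm
    _ ≤ _ := measureReal_mono hsub

end

section

/-! ### Connections in thick planar rectangles -/

variable {d : ℕ}

/-- The connection event between two coarse sites inside a thick planar rectangle. -/
def coarseConn (z₀ : Zd d) (M : ℕ) (i₁ i₂ : Fin d) (j q : ℕ) (o x : ℤ × ℤ) : Set (Config d) :=
  {ω | ∃ y ∈ Bx (cen z₀ M i₁ i₂ o) M, ∃ t ∈ Bx (cen z₀ M i₁ i₂ x) M,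
    Conn ω (region (cen z₀ M i₁ i₂) M (grid j q)) y t}

/-- Supercritical percolation in thick planar rectangles connects coarse sites with high
probability. -/
lemma exists_coarse (hd : 0 < d) {p p' : unitInterval} (hp : (p' : ℝ) < p)
    (h : bern (fun _ => p') {ω : Config d | (cluster ω).Infinite} ≠ 0) {ε : ℝ} (hε : 0 < ε)
    (K : ℕ) : ∃ M : ℕ, 0 < M ∧ ∀ j q : ℕ, q ≤ K * 3 ^ j → ∀ (z₀ : Zd d) (i₁ i₂ : Fin d), i₁ ≠ i₂ →
      ∀ o ∈ grid j q, ∀ x ∈ grid j q,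
      1 - ε ≤ (bern fun _ => p).real (coarseConn z₀ M i₁ i₂ j q o x) := by
  have hp'1 : (p' : ℝ) < 1 := hp.trans_le p.2.2
  obtain ⟨δ, hδ0, hδ⟩ : ∃ δ : unitInterval, 0 < (δ : ℝ) ∧
      (1 - (p' : ℝ)) * (1 - (δ : ℝ)) ^ 49 = 1 - p := by
    set t : ℝ := (1 - (p : ℝ)) / (1 - p') with ht
    have h1 : 0 < 1 - (p' : ℝ) := by linarith
    have ht0 : 0 ≤ t := div_nonneg (by linarith [p.2.2]) h1.le
    have ht1 : t < 1 := by rw [ht, div_lt_one h1]; linarith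
    set r : ℝ := t ^ ((49 : ℕ) : ℝ)⁻¹ with hr
    have hr0 : 0 ≤ r := Real.rpow_nonneg ht0 _
    have hr1 : r < 1 := Real.rpow_lt_one ht0 ht1 (by positivity)
    have hr49 : r ^ 49 = t := Real.rpow_inv_natCast_pow ht0 (by norm_num)
    refine ⟨⟨1 - r, by constructor <;> linarith⟩, by simpa using hr1, ?_⟩
    simp only [sub_sub_cancel]
    rw [hr49, ht]; field_simp
  obtain ⟨s, hs1, hs⟩ := site_connect hε K
  obtain ⟨m, n, -, hstep⟩ := exists_step (K := Col) hd hp'1 hδ0 h (ε := 1 - s) (by linarith)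
  refine ⟨n + m + 1, by omega, ?_⟩
  intro j q hq z₀ i₁ i₂ hi o ho x hx
  refine (hs j q hq o ho x hx).trans ((site_le_conn hδ z₀ hi hstep (grid j q) ho).trans
    (measureReal_mono ?_))
  rintro ω ⟨y, hy, t, ht, hyt⟩
  exact ⟨y, Bx_mono _ (by omega) hy, t, ht, hyt⟩

lemma dep_coarseConn (z₀ : Zd d) (M : ℕ) (i₁ i₂ : Fin d) (j q : ℕ) (o x : ℤ × ℤ) :
    Dep (coarseConn z₀ M i₁ i₂ j q o x) (Ed (region (cen z₀ M i₁ i₂) M (grid j q))) := by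
  rintro ω ω' h ⟨y, hy, t, ht, hyt⟩
  exact ⟨y, hy, t, ht, (conn_congr h).1 hyt⟩

lemma incr_coarseConn (z₀ : Zd d) (M : ℕ) (i₁ i₂ : Fin d) (j q : ℕ) (o x : ℤ × ℤ) :
    Incr (coarseConn z₀ M i₁ i₂ j q o x) := by
  rintro ω ω' h ⟨y, hy, t, ht, hyt⟩
  exact ⟨y, hy, t, ht, hyt.congr fun e _ => h e⟩

/-- All edges in a box are open. -/
def patch (c : Zd d) (n : ℕ) : Set (Config d) := {ω | ∀ e ∈ Ed (Bx c n), ω e = true}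

lemma dep_patch (c : Zd d) (n : ℕ) : Dep (patch c n) (Ed (Bx c n)) :=
  fun _ _ h h1 e he => (h e he) ▸ h1 e he

lemma incr_patch (c : Zd d) (n : ℕ) : Incr (patch c n) := fun _ _ h h1 e he => h e (h1 e he)

lemma patch_conn {c x y : Zd d} {n : ℕ} {ω : Config d} (h : ω ∈ patch c n) (hx : x ∈ Bx c n)
    (hy : y ∈ Bx c n) : Conn ω (Bx c n) x y := (conn_Bx hx hy).congr fun e he _ => h e he

lemma prob_patch (p : unitInterval) (c : Zd d) (n : ℕ) :
    (p : ℝ) ^ (((2 * n + 1) ^ d) ^ 2) ≤ (bern fun _ => p).real (patch c n) := by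
  have h1 : patch c n = {ω | ∀ e ∈ (Ed_finite (Bx_finite c n)).toFinset, ω e = true} := by
    ext ω; simp [patch]
  rw [h1, bern_all_true, Finset.prod_const]
  refine pow_le_pow_of_le_one p.2.1 p.2.2 ?_
  rw [← Set.ncard_eq_toFinset_card _ (Ed_finite (Bx_finite c n))]
  refine (Ed_ncard_le (Bx_finite c n)).trans ?_
  rw [Bx_ncard]

/-- The coarse coordinate of a point in an interval starting at `0`. -/
def crd (M q : ℕ) (t : ℤ) : ℤ := max 0 (min (t / M - 2) (q - 1))

lemma crd_mem {M q : ℕ} (hq : 0 < q) (t : ℤ) : 0 ≤ crd M q t ∧ crd M q t < q := by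
  unfold crd; omega

lemma crd_spec {M q : ℕ} (hM : 0 < M) (hq : 0 < q) {t : ℤ} (h0 : 0 ≤ t) (h1 : t ≤ (q + 3) * M) :
    |t - (crd M q t + 2) * M| ≤ 2 * M := by
  have hM' : (0 : ℤ) < M := by exact_mod_cast hM
  have e := Int.mul_ediv_add_emod t M
  have f := Int.emod_nonneg t hM'.ne'
  have g := Int.emod_lt_of_pos t hM'
  have k := Int.ediv_nonneg h0 hM'.le
  set a := t / (M : ℤ)
  set b := t % (M : ℤ)
  unfold crd
  rw [_root_.abs_le]
  rcases le_total (a - 2) (q - 1) with h | h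
  · rw [min_eq_left h]
    rcases le_total 0 (a - 2) with h' | h'
    · rw [max_eq_right h']; constructor <;> nlinarith
    · rw [max_eq_left h']; constructor <;> nlinarith
  · rw [min_eq_right h, max_eq_right (by omega)]
    constructor <;> nlinarith

/-- The centre with given coarse coordinates. -/
def pos (l : Zd d) (M : ℕ) (k : Zd d) : Zd d := fun i => l i + (k i + 2) * M

lemma cen_pos (l : Zd d) (M : ℕ) (k : Zd d) {i a : Fin d} (hi : i ≠ a) (u v : ℤ) :
    cen (pos l M (Function.update (Function.update k i 0) a 0)) M i a (u, v) =
      pos l M (Function.update (Function.update k i u) a v) := by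
  funext j
  simp only [cen, pos]
  by_cases h1 : j = i
  · subst h1; simp [Function.update_of_ne hi]; ring
  · by_cases h2 : j = a
    · subst h2; simp [h1]; ring
    · simp [h1, h2]

lemma pos_Bx_subset {l u : Zd d} {M : ℕ} {Q : Fin d → ℕ} (hu : ∀ i, u i = l i + (Q i + 3) * M)
    {k : Zd d} (hk : ∀ i, 0 ≤ k i ∧ k i < Q i) : Bx (pos l M k) (2 * M) ⊆ Set.Icc l u := by
  intro z hz
  have h : ∀ i, l i ≤ z i ∧ z i ≤ u i := by
    intro i
    have h1 := _root_.abs_le.1 (hz i)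
    have h2 := hk i
    have h3 := hu i
    simp only [pos] at h1
    push_cast at h1
    have h4 : (0 : ℤ) ≤ M := by positivity
    have h5 : k i * M ≤ (Q i - 1) * M := by
      apply mul_le_mul_of_nonneg_right _ h4
      omega
    have h6 : 0 ≤ k i * M := mul_nonneg h2.1 h4
    constructor <;> nlinarith
  exact ⟨fun i => (h i).1, fun i => (h i).2⟩

/-- Two points at the same height of a thick slab are connected in the slab with probability
bounded below. -/
lemma exists_slab (hd : 0 < d) {p p' : unitInterval} (hp : (p' : ℝ) < p)
    (h : bern (fun _ => p') {ω : Config d | (cluster ω).Infinite} ≠ 0) (K : ℕ) :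
    ∃ M : ℕ, 0 < M ∧ ∃ c : ℝ, 0 < c ∧ ∀ j q : ℕ, 0 < q → q ≤ K * 3 ^ j →
      ∀ (a : Fin d) (l u : Zd d), (∀ i, i ≠ a → u i = l i + (q * 3 ^ j + 3) * M) →
      u a = l a + (3 ^ j + 3) * M → ∀ x ∈ Set.Icc l u, ∀ y ∈ Set.Icc l u, x a = y a →
      c ≤ (bern fun _ => p).real {ω | Conn ω (Set.Icc l u) x y} := by
  have hp0 : 0 < (p : ℝ) := p'.2.1.trans_lt hp
  obtain ⟨M, hM, hcoarse⟩ := exists_coarse hd hp h (ε := 1 / 2) (by norm_num) K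
  set c1 : ℝ := (p : ℝ) ^ (((2 * (2 * M) + 1) ^ d) ^ 2) with hc1
  refine ⟨M, hM, c1 ^ (d + 1) * (1 / 2) ^ d, by positivity, ?_⟩
  intro j q hq hqK a l u hua1 hua2 x hx y hy hxy
  set Q : Fin d → ℕ := fun i => if i = a then 3 ^ j else q * 3 ^ j with hQ
  have hu : ∀ i, u i = l i + (Q i + 3) * M := by
    intro i
    by_cases hi : i = a
    · subst hi; simp [hQ, hua2]
    · simp [hQ, hi, hua1 i hi]
  have hQ0 : ∀ i, 0 < Q i := by
    intro i; simp only [hQ]; split_ifs <;> positivity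
  set kk : Zd d → Zd d := fun z i => crd M (Q i) (z i - l i) with hkk
  have hkk_mem : ∀ z i, 0 ≤ kk z i ∧ kk z i < Q i := fun z i => crd_mem (hQ0 i) _
  have hkk_box : ∀ z ∈ Set.Icc l u, z ∈ Bx (pos l M (kk z)) (2 * M) := by
    intro z hz i
    have h1 : l i ≤ z i := hz.1 i
    have h2 : z i ≤ u i := hz.2 i
    have := crd_spec hM (hQ0 i) (t := z i - l i) (by omega) (by rw [hu i] at h2; omega)
    simp only [pos, hkk]
    push_cast
    convert this using 2
    ring
  set mix : ℕ → Zd d := fun t i => if i.val < t then kk y i else kk x i with hmix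
  have hmix_mem : ∀ t i, 0 ≤ mix t i ∧ mix t i < Q i := by
    intro t i
    simp only [hmix]
    split_ifs
    · exact hkk_mem y i
    · exact hkk_mem x i
  have hka : kk x a = kk y a := by simp only [hkk, hxy]
  have hmix_a : ∀ t, mix t a = kk x a := by
    intro t
    simp only [hmix]
    split_ifs
    · exact hka.symm
    · rfl
  have hmix_t : ∀ t : Fin d, Function.update (Function.update (mix t) t (kk x t)) a (kk x a) = mix t := by
    intro t
    rw [← hmix_a t, show kk x t = mix t t by simp [hmix], Function.update_eq_self,
      Function.update_eq_self]
  have hmix_t' : ∀ t : Fin d, t ≠ a →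
      Function.update (Function.update (mix t) t (kk y t)) a (kk x a) = mix (t + 1) := by
    intro t hta
    funext i
    by_cases hia : i = a
    · subst hia; simp [hmix_a]
    rw [Function.update_of_ne hia]
    by_cases hit : i = t
    · subst hit; simp [hmix]
    rw [Function.update_of_ne hit]
    simp only [hmix]
    have : i.val ≠ t.val := fun h => hit (Fin.ext h)
    congr 1
    simp only [eq_iff_iff]; omega
  let z₀ : Fin d → Zd d := fun t => pos l M (Function.update (Function.update (mix t) t 0) a 0)
  let A : Fin (d + 1) ⊕ Fin d → Set (Config d) := fun s => s.elim
    (fun t : Fin (d + 1) => patch (pos l M (mix t.val)) (2 * M))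
    (fun t : Fin d => if t = a then Set.univ else
      coarseConn (z₀ t) M t a j q (kk x t, kk x a) (kk y t, kk x a))
  have hreg : ∀ t : Fin d, t ≠ a → region (cen (z₀ t) M t a) M (grid j q) ⊆ Set.Icc l u := by
    intro t hta z hz
    simp only [region, Set.mem_iUnion] at hz
    obtain ⟨v, hv, hz⟩ := hz
    rw [show v = (v.1, v.2) from rfl, cen_pos l M (mix t) hta] at hz
    refine pos_Bx_subset hu (fun i => ?_) hz
    simp only [grid, Finset.mem_product, Finset.mem_Ico] at hv
    by_cases hia : i = a
    · subst hia; simpa [hQ] using hv.2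
    rw [Function.update_of_ne hia]
    by_cases hit : i = t
    · subst hit; simpa [hQ, hia] using hv.1
    rw [Function.update_of_ne hit]
    exact hmix_mem t i
  have hfin : (Set.Icc l u).Finite := Set.finite_Icc l u
  let F := (Ed_finite hfin).toFinset
  have hFA : ∀ s, Dep (A s) F := by
    rintro (t | t)
    · simpa [F, A] using (dep_patch _ _).mono (Ed_mono (pos_Bx_subset hu (hmix_mem t)))
    · by_cases hta : t = a
      · intro ω ω' _ _; simp [A, hta]
      · have := (dep_coarseConn (z₀ t) M t a j q (kk x t, kk x a) (kk y t, kk x a)).mono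
          (Ed_mono (hreg t hta))
        simpa [F, A, hta] using this
  have hIA : ∀ s, Incr (A s) := by
    rintro (t | t)
    · exact incr_patch _ _
    · by_cases hta : t = a
      · intro ω ω' _ _; simp [A, hta]
      · simpa [A, hta] using incr_coarseConn (z₀ t) M t a j q (kk x t, kk x a) (kk y t, kk x a)
  have hprod := harris_biInter (fun _ => p) F Finset.univ hFA hIA
  have hlow : c1 ^ (d + 1) * (1 / 2) ^ d ≤ ∏ s, (bern fun _ => p).real (A s) := by
    rw [Fintype.prod_sum_type]
    have e1 : c1 ^ (d + 1) = ∏ _t : Fin (d + 1), c1 := by simp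
    have e2 : ((1 : ℝ) / 2) ^ d = ∏ _t : Fin d, (1 / 2 : ℝ) := by simp
    rw [e1, e2]
    refine mul_le_mul (Finset.prod_le_prod (fun _ _ => by positivity) fun t _ => prob_patch p _ _)
      (Finset.prod_le_prod (fun _ _ => by positivity) fun t _ => ?_)
      (Finset.prod_nonneg fun _ _ => by positivity)
      (Finset.prod_nonneg fun _ _ => measureReal_nonneg)
    by_cases hta : t = a
    · simp [A, hta]; norm_num
    · have hm : ∀ z, (kk z t, kk x a) ∈ grid j q := by
        intro z
        have h1 := hkk_mem z t
        have h2 := hkk_mem x a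
        simp only [hQ, hta, if_true, if_false] at h1 h2
        simp only [grid, Finset.mem_product, Finset.mem_Ico]
        exact ⟨h1, h2⟩
      have := hcoarse j q hqK (z₀ t) t a hta _ (hm x) _ (hm y)
      simp only [A, Sum.elim_inr, hta, if_false]
      linarith
  refine hlow.trans (hprod.trans (measureReal_mono ?_))
  intro ω hω
  have hpatch : ∀ t : ℕ, t ≤ d → ω ∈ patch (pos l M (mix t)) (2 * M) := by
    intro t ht
    exact hω (Sum.inl ⟨t, by omega⟩) (Finset.mem_univ _)
  have hpc : ∀ t : ℕ, t ≤ d → ∀ v ∈ Bx (pos l M (mix t)) (2 * M), ∀ w ∈ Bx (pos l M (mix t)) (2 * M),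
      Conn ω (Set.Icc l u) v w := fun t ht v hv w hw =>
    (patch_conn (hpatch t ht) hv hw).mono_set (pos_Bx_subset hu (hmix_mem t))
  have hchain : ∀ t : ℕ, t ≤ d → Conn ω (Set.Icc l u) x (pos l M (mix t)) := by
    intro t
    induction t with
    | zero =>
      intro _
      have h0 : mix 0 = kk x := by funext i; simp [hmix]
      exact hpc 0 (by omega) x (by rw [h0]; exact hkk_box x hx) _ (self_mem_Bx _ _)
    | succ t ih =>
      intro ht
      refine (ih (by omega)).trans ?_
      by_cases hta : (⟨t, by omega⟩ : Fin d) = a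
      · have : mix (t + 1) = mix t := by
          funext i
          by_cases hit : i.val = t
          · have hia : i = a := by rw [← hta]; exact Fin.ext hit
            rw [hia, hmix_a, hmix_a]
          · simp only [hmix]
            congr 1
            simp only [eq_iff_iff]; omega
        rw [this]
        exact .refl (pos_Bx_subset hu (hmix_mem t) (self_mem_Bx _ _))
      · have h1 := hω (Sum.inr ⟨t, by omega⟩) (Finset.mem_univ _)
        simp only [A, Sum.elim_inr, hta, if_false] at h1
        obtain ⟨v, hv, w, hw, hvw⟩ := h1
        rw [cen_pos l M _ hta, hmix_t] at hv
        rw [cen_pos l M _ hta, hmix_t' _ hta] at hw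
        exact (hpc t (by omega) _ (self_mem_Bx _ _) v (Bx_mono _ (by omega) hv)).trans
          ((hvw.mono_set (hreg _ hta)).trans
          (hpc (t + 1) ht w (Bx_mono _ (by omega) hw) _ (self_mem_Bx _ _)))
  have hdy : mix d = kk y := by funext i; simp [hmix]
  exact (hchain d le_rfl).trans (hpc d le_rfl _ (self_mem_Bx _ _) y (by rw [hdy]; exact hkk_box y hy))

end

section

/-! ### Levels and slabs -/

variable {d : ℕ}

/-- The part of the box below a level in a signed direction. -/
def Lev (H : ℕ) (a : Fin d) (s : ℤˣ) (h : ℤ) : Set (Zd d) := {x | x ∈ Bx 0 H ∧ s * x a ≤ h}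

lemma Lev_finite (H : ℕ) (a : Fin d) (s : ℤˣ) (h : ℤ) : (Lev H a s h).Finite :=
  (Bx_finite 0 H).subset fun _ hx => hx.1

lemma Lev_mono (H : ℕ) (a : Fin d) (s : ℤˣ) {h h' : ℤ} (hh : h ≤ h') :
    Lev H a s h ⊆ Lev H a s h' := fun _ hx => ⟨hx.1, hx.2.trans hh⟩

/-- The points at a given level that are connected to `B` below this level. -/
def top (H : ℕ) (a : Fin d) (s : ℤˣ) (B : Set (Zd d)) (h : ℤ) (ω : Config d) : Set (Zd d) :=
  {y | s * y a = h ∧ ∃ b ∈ B, Conn ω (Lev H a s h) b y}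

lemma top_congr {H : ℕ} {a : Fin d} {s : ℤˣ} {B : Set (Zd d)} {h : ℤ} {ω ω' : Config d}
    (hh : ∀ e ∈ Ed (Lev H a s h), ω e = ω' e) : top H a s B h ω = top H a s B h ω' := by
  ext y
  simp only [top, Set.mem_ofPred_eq, conn_congr hh]

lemma latAdj.level {x y : Zd d} (h : latAdj x y) (a : Fin d) (s : ℤˣ) : s * y a ≤ s * x a + 1 := by
  have h1 := _root_.abs_le.1 (h.abs_le a)
  rcases Int.units_eq_one_or s with h | h <;> subst h <;> simp <;> omega

lemma top_nonempty_of_le {H : ℕ} {a : Fin d} {s : ℤˣ} {B : Set (Zd d)} {h h' : ℤ} (hh : h ≤ h')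
    (hB : B ⊆ Lev H a s h) {ω : Config d} (hne : (top H a s B h' ω).Nonempty) :
    (top H a s B h ω).Nonempty := by
  obtain ⟨y, hy, b, hb, hby⟩ := hne
  rcases eq_or_lt_of_le hh with rfl | hlt
  · exact ⟨y, hy, b, hb, hby⟩
  obtain ⟨u, v, hbu, huv, hvS, hvA⟩ := hby.exists_exit (A := {x | s * x a ≤ h}) (hB hb).2
    (by simp only [Set.mem_ofPred_eq]; omega)
  have h1 : Lev H a s h' ∩ {x | s * x a ≤ h} ⊆ Lev H a s h := fun x hx => ⟨hx.1.1, hx.2⟩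
  refine ⟨u, ?_, b, hb, hbu.mono_set h1⟩
  have h2 := huv.1.level a s
  have h3 : s * u a ≤ h := hbu.mem_right.2
  simp only [Set.mem_ofPred_eq] at hvA
  omega

/-- Two sets both reach a level without being connected below this level. -/
def Sep (H : ℕ) (a : Fin d) (s : ℤˣ) (B B' : Set (Zd d)) (h : ℤ) : Set (Config d) :=
  {ω | (top H a s B h ω).Nonempty ∧ (top H a s B' h ω).Nonempty ∧
    ¬ ∃ b ∈ B, ∃ b' ∈ B', Conn ω (Lev H a s h) b b'}

lemma Sep_anti {H : ℕ} {a : Fin d} {s : ℤˣ} {B B' : Set (Zd d)} {h h' : ℤ} (hh : h ≤ h')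
    (hB : B ⊆ Lev H a s h) (hB' : B' ⊆ Lev H a s h) : Sep H a s B B' h' ⊆ Sep H a s B B' h := by
  rintro ω ⟨h1, h2, h3⟩
  refine ⟨top_nonempty_of_le hh hB h1, top_nonempty_of_le hh hB' h2, ?_⟩
  rintro ⟨b, hb, b', hb', hc⟩
  exact h3 ⟨b, hb, b', hb', hc.mono_set (Lev_mono H a s hh)⟩

lemma dep_Sep (H : ℕ) (a : Fin d) (s : ℤˣ) (B B' : Set (Zd d)) (h : ℤ) :
    Dep (Sep H a s B B' h) (Ed (Lev H a s h)) := by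
  intro ω ω' hh hω
  unfold Sep at hω ⊢
  simp only [Set.mem_ofPred_eq] at hω ⊢
  simpa only [top_congr hh, conn_congr hh] using hω

/-- The neighbour of a point in a signed direction. -/
def up (a : Fin d) (s : ℤˣ) (y : Zd d) : Zd d := Function.update y a (y a + s)

lemma latAdj_up (a : Fin d) (s : ℤˣ) (y : Zd d) : latAdj y (up a s y) := by
  unfold latAdj up
  rw [Finset.sum_eq_single a]
  · rcases Int.units_eq_one_or s with h | h <;> simp [h]
  · intro j _ hj; simp [hj]
  · simp

lemma up_level (a : Fin d) (s : ℤˣ) (y : Zd d) : s * up a s y a = s * y a + 1 := by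
  simp only [up, Function.update_self, mul_add]
  rcases Int.units_eq_one_or s with h | h <;> simp [h]

/-- The event that two points are joined through the region above them. -/
def bridge (a : Fin d) (s : ℤˣ) (D : Set (Zd d)) (y y' : Zd d) : Set (Config d) :=
  {ω | ω s(y, up a s y) = true ∧ ω s(y', up a s y') = true ∧ Conn ω D (up a s y) (up a s y')}

lemma dep_bridge (a : Fin d) (s : ℤˣ) (D : Set (Zd d)) (y y' : Zd d) :
    Dep (bridge a s D y y') (Ed D ∪ {s(y, up a s y), s(y', up a s y')}) := by
  rintro ω ω' h ⟨h1, h2, h3⟩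
  refine ⟨by rw [← h _ (by simp)]; exact h1, by rw [← h _ (by simp)]; exact h2, ?_⟩
  exact (conn_congr fun e he => h e (Or.inl he)).1 h3

lemma prob_bridge (p : unitInterval) (a : Fin d) (s : ℤˣ) {D : Set (Zd d)} (hD : D.Finite)
    (y y' : Zd d) : (p : ℝ) ^ 2 * (bern fun _ => p).real {ω | Conn ω D (up a s y) (up a s y')} ≤
      (bern fun _ => p).real (bridge a s D y y') := by
  classical
  set S := Ed D ∪ {s(y, up a s y), s(y', up a s y')} with hS
  have hfin : S.Finite := (Ed_finite hD).union (by simp)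
  let F := hfin.toFinset
  have hSF : (F : Set _) = S := hfin.coe_toFinset
  have dE : ∀ e ∈ S, Dep {ω : Config d | ω e = true} (F : Set _) := by
    intro e he ω ω' h h1
    rw [hSF] at h
    exact (h e he).symm.trans h1
  have iE : ∀ e, Incr {ω : Config d | ω e = true} := fun e ω ω' h h1 => h e h1
  have dC : Dep {ω : Config d | Conn ω D (up a s y) (up a s y')} (F : Set _) := by
    rw [hSF]; exact (dep_conn _ _ _).mono Set.subset_union_left
  have e1 := dE s(y, up a s y) (by simp [hS])
  have e2 := dE s(y', up a s y') (by simp [hS])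
  have h1 := harris (fun _ => p) F e2 dC (iE _) (incr_conn _ _ _)
  have h2 := harris (fun _ => p) F e1 (e2.inter dC) (iE _) ((iE _).inter (incr_conn _ _ _))
  rw [bern_true] at h1 h2
  have h3 := mul_le_mul_of_nonneg_left h1 p.2.1
  have h4 : bridge a s D y y' = {ω : Config d | ω s(y, up a s y) = true} ∩
    ({ω | ω s(y', up a s y') = true} ∩ {ω | Conn ω D (up a s y) (up a s y')}) := rfl
  rw [h4]
  calc _ = (p : ℝ) * (p * (bern fun _ => p).real {ω | Conn ω D (up a s y) (up a s y')}) := by ring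
    _ ≤ _ := h3.trans h2

/-- The slab between two levels. -/
def Slab (H : ℕ) (a : Fin d) (s : ℤˣ) (h h' : ℤ) : Set (Zd d) :=
  {x | x ∈ Bx 0 H ∧ h + 1 ≤ s * x a ∧ s * x a ≤ h'}

lemma Sep_step (p : unitInterval) {H : ℕ} {a : Fin d} {s : ℤˣ} {B B' : Set (Zd d)} {h h' : ℤ}
    {c : ℝ} (hh : h < h') (h'H : h' ≤ H) (hH : -(H : ℤ) ≤ h)
    (hB : B ⊆ Lev H a s h) (hB' : B' ⊆ Lev H a s h)
    (hc : ∀ x ∈ Slab H a s h h', ∀ y ∈ Slab H a s h h', x a = y a →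
      c ≤ (bern fun _ => p).real {ω : Config d | Conn ω (Slab H a s h h') x y}) :
    (bern fun _ => p).real (Sep H a s B B' h') ≤
      (1 - p ^ 2 * c) * (bern fun _ => p).real (Sep H a s B B' h) := by
  classical
  set D := Slab H a s h h' with hD
  have hDfin : D.Finite := (Bx_finite 0 H).subset fun _ hx => hx.1
  have hupD : ∀ y ∈ Lev H a s h, s * y a = h → up a s y ∈ D := by
    intro y hy hyh
    have h1 := up_level a s y
    refine ⟨fun i => ?_, by omega, by omega⟩
    by_cases hi : i = a
    · subst hi
      rw [Pi.zero_apply, sub_zero, ← abs_unit_mul s, h1, _root_.abs_le]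
      constructor <;> omega
    · have := hy.1 i
      simpa [up, hi] using this
  let V : Finset (Zd d) := ((Lev_finite H a s h).subset
    (fun y (hy : y ∈ Lev H a s h ∧ s * y a = h) => hy.1)).toFinset
  have hV : ∀ y, y ∈ V ↔ y ∈ Lev H a s h ∧ s * y a = h := fun y =>
    Set.Finite.mem_toFinset _
  let X : Config d → Zd d × Zd d := fun ω =>
    Classical.epsilon fun v => v.1 ∈ top H a s B h ω ∧ v.2 ∈ top H a s B' h ω
  have hX : ∀ ω ∈ Sep H a s B B' h, (X ω).1 ∈ top H a s B h ω ∧ (X ω).2 ∈ top H a s B' h ω := by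
    rintro ω ⟨⟨y, hy⟩, ⟨y', hy'⟩, -⟩
    exact Classical.epsilon_spec (p := fun v : Zd d × Zd d =>
      v.1 ∈ top H a s B h ω ∧ v.2 ∈ top H a s B' h ω) ⟨(y, y'), hy, hy'⟩
  have hXV : ∀ ω ∈ Sep H a s B B' h, X ω ∈ V ×ˢ V := by
    intro ω hω
    obtain ⟨⟨h1, b, -, h2⟩, h3, b', -, h4⟩ := hX ω hω
    rw [Finset.mem_product, hV, hV]
    exact ⟨⟨h2.mem_right, h1⟩, h4.mem_right, h3⟩
  have key := fresh_lower (fun _ => p) (V ×ˢ V) X (Sep H a s B B' h)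
    (fun v => bridge a s D v.1 v.2) (fun _ => Ed (Lev H a s h))
    (fun v => Ed D ∪ {s(v.1, up a s v.1), s(v.2, up a s v.2)}) (q := p ^ 2 * c) hXV
    (fun _ => Ed_finite (Lev_finite _ _ _ _)) (fun _ => (Ed_finite hDfin).union (by simp))
    (fun T => by
      rintro ω ω' hω ⟨h1, h2⟩
      refine ⟨dep_Sep _ _ _ _ _ _ ω ω' hω h1, ?_⟩
      rw [← h2]
      simp only [X, top_congr hω])
    (fun v => dep_bridge a s D v.1 v.2)
    (fun v hv => by
      rw [Finset.mem_product, hV, hV] at hv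
      rw [Set.disjoint_left]
      have hnot : ∀ y, s * y a = h → up a s y ∉ Lev H a s h := by
        intro y hy hy'
        have h1 := up_level a s y
        have h2 := hy'.2
        omega
      rintro e he (he' | he')
      · induction e using Sym2.inductionOn with
        | _ x y =>
        have h1 := (mk_mem_Ed.1 he).1.2
        have h2 := (mk_mem_Ed.1 he').1.2.1
        omega
      · rcases he' with rfl | rfl
        · exact hnot _ hv.1.2 (mk_mem_Ed.1 he).2
        · exact hnot _ hv.2.2 (mk_mem_Ed.1 he).2)
    (fun ω hω => by
      have h1 := hXV ω hω
      rw [Finset.mem_product, hV, hV] at h1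
      refine le_trans ?_ (prob_bridge p a s hDfin _ _)
      refine mul_le_mul_of_nonneg_left (hc _ (hupD _ h1.1.1 h1.1.2) _ (hupD _ h1.2.1 h1.2.2) ?_)
        (by positivity)
      have h2 := up_level a s (X ω).1
      have h3 := up_level a s (X ω).2
      have h4 : (s : ℤ) * up a s (X ω).1 a = s * up a s (X ω).2 a := by
        rw [h2, h3, h1.1.2, h1.2.2]
      exact mul_left_cancel₀ s.ne_zero h4)
  have hsub : Sep H a s B B' h' ⊆
      Sep H a s B B' h \ {ω | ω ∈ Sep H a s B B' h ∧ ω ∈ bridge a s D (X ω).1 (X ω).2} := by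
    intro ω hω
    refine ⟨Sep_anti hh.le hB hB' hω, ?_⟩
    rintro ⟨h1, h2, h3, h4⟩
    obtain ⟨⟨-, b, hb, hby⟩, -, b', hb', hby'⟩ := hX ω h1
    refine hω.2.2 ⟨b, hb, b', hb', ?_⟩
    have hDL : D ⊆ Lev H a s h' := fun x hx => ⟨hx.1, hx.2.2⟩
    have c1 := hby.mono_set (Lev_mono H a s hh.le)
    have c2 := hby'.mono_set (Lev_mono H a s hh.le)
    have c3 := h4.mono_set hDL
    refine (c1.tail ⟨latAdj_up _ _ _, h2⟩ c3.mem_left).trans (c3.trans ?_)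
    exact (c2.tail ⟨latAdj_up _ _ _, h3⟩ c3.mem_right).symm
  have hmS := (dep_Sep H a s B B' h).measurableSet (Ed_finite (Lev_finite _ _ _ _))
  have hdepE : Dep {ω | ω ∈ Sep H a s B B' h ∧ ω ∈ bridge a s D (X ω).1 (X ω).2}
      (Ed (Bx 0 (H + 1) : Set (Zd d))) := by
    rintro ω ω' hω ⟨h1, h2⟩
    have hL : Ed (Lev H a s h) ⊆ Ed (Bx 0 (H + 1) : Set (Zd d)) :=
      Ed_mono fun x hx => Bx_mono _ (by omega) hx.1
    have hω' : ∀ e ∈ Ed (Lev H a s h), ω e = ω' e := fun e he => hω e (hL he)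
    have hXX : X ω = X ω' := by simp only [X, top_congr hω']
    refine ⟨dep_Sep _ _ _ _ _ _ ω ω' hω' h1, ?_⟩
    rw [← hXX]
    have h3 := hXV ω h1
    rw [Finset.mem_product, hV, hV] at h3
    refine dep_bridge _ _ _ _ _ ω ω' (fun e he => hω e ?_) h2
    have hedge : ∀ y ∈ Lev H a s h, s * y a = h → s(y, up a s y) ∈ Ed (Bx 0 (H + 1) : Set (Zd d)) :=
      fun y hy hyh => mk_mem_Ed.2 ⟨Bx_mono _ (by omega) hy.1,
        Bx_mono _ (by omega) (hupD y hy hyh).1⟩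
    rcases he with he | he
    · exact Ed_mono (fun x hx => Bx_mono _ (by omega) hx.1) he
    · rcases he with rfl | rfl
      · exact hedge _ h3.1.1 h3.1.2
      · exact hedge _ h3.2.1 h3.2.2
  have hmE := hdepE.measurableSet (Ed_finite (Bx_finite _ _))
  have h5 := measureReal_mono (μ := bern fun _ : Sym2 (Zd d) => p) hsub (measure_ne_top _ _)
  rw [measureReal_sdiff (fun ω hω => hω.1) hmE] at h5
  linarith

/-- Two far reaching sets are connected below every level of a sequence of slabs except with
exponentially small probability. -/
lemma Sep_iterate (p : unitInterval) {H : ℕ} {a : Fin d} {s : ℤˣ} {B B' : Set (Zd d)} {h : ℤ}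
    {W : ℕ} {c : ℝ} (hc0 : p ^ 2 * c ≤ 1) (hW : 0 < W) (hH : -(H : ℤ) ≤ h)
    (hB : B ⊆ Lev H a s h) (hB' : B' ⊆ Lev H a s h)
    (hc : ∀ t : ℤ, h ≤ t → t + W ≤ H → ∀ x ∈ Slab H a s t (t + W), ∀ y ∈ Slab H a s t (t + W),
      x a = y a → c ≤ (bern fun _ => p).real {ω : Config d | Conn ω (Slab H a s t (t + W)) x y})
    (k : ℕ) (hk : h + k * W ≤ H) :
    (bern fun _ => p).real (Sep H a s B B' (h + k * W)) ≤ (1 - p ^ 2 * c) ^ k := by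
  induction k with
  | zero => simp
  | succ k ih =>
    push_cast at hk ⊢
    have hkW : (0 : ℤ) ≤ k * W := by positivity
    have e : h + (k + 1) * W = h + k * W + W := by ring
    rw [e] at hk ⊢
    have h1 := Sep_step p (B := B) (B' := B') (h := h + k * W) (h' := h + k * W + W) (c := c)
      (a := a) (s := s) (by omega) hk (by omega) (hB.trans (Lev_mono _ _ _ (by omega)))
      (hB'.trans (Lev_mono _ _ _ (by omega))) (hc _ (by omega) hk)
    refine h1.trans ?_
    rw [pow_succ, mul_comm]
    exact mul_le_mul_of_nonneg_right (ih (by omega)) (by linarith)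

end

section

/-! ### Connections through slabs -/

variable {d : ℕ}

lemma Slab_eq_Icc (H : ℕ) (a : Fin d) (s : ℤˣ) {h h' : ℤ} (hH : -(H : ℤ) ≤ h) (h'H : h' ≤ H) :
    ∃ l u : Zd d, Slab H a s h h' = Set.Icc l u ∧ (∀ i, i ≠ a → u i = l i + 2 * H) ∧
      u a = l a + (h' - h - 1) := by
  have key : ∀ x : Zd d, x ∈ Slab H a s h h' ↔
      (∀ i, i ≠ a → -(H : ℤ) ≤ x i ∧ x i ≤ H) ∧ h + 1 ≤ s * x a ∧ s * x a ≤ h' := by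
    intro x
    constructor
    · rintro ⟨h1, h2⟩
      exact ⟨fun i _ => _root_.abs_le.1 (by simpa using h1 i), h2⟩
    · rintro ⟨h1, h2⟩
      refine ⟨fun i => ?_, h2⟩
      rw [Pi.zero_apply, sub_zero]
      by_cases hi : i = a
      · subst hi
        rw [← abs_unit_mul s, _root_.abs_le]
        constructor <;> omega
      · exact _root_.abs_le.2 (h1 i hi)
  rcases Int.units_eq_one_or s with hs | hs
  · refine ⟨fun i => if i = a then h + 1 else -H, fun i => if i = a then h' else H, ?_, ?_, ?_⟩
    · ext x
      rw [key, Set.mem_Icc, Pi.le_def, Pi.le_def, ← forall_and]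
      subst hs
      simp only [Units.val_one, one_mul]
      constructor
      · rintro ⟨h1, h2⟩ i
        by_cases hi : i = a
        · subst hi; simpa using h2
        · simpa [hi] using h1 i hi
      · intro h1
        exact ⟨fun i hi => by simpa [hi] using h1 i, by simpa using h1 a⟩
    · intro i hi; simp [hi]; ring
    · simp
  · refine ⟨fun i => if i = a then -h' else -H, fun i => if i = a then -(h + 1) else H, ?_, ?_, ?_⟩
    · ext x
      rw [key, Set.mem_Icc, Pi.le_def, Pi.le_def, ← forall_and]
      subst hs
      simp only [Units.val_neg, Units.val_one, neg_mul, one_mul]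
      constructor
      · rintro ⟨h1, h2⟩ i
        by_cases hi : i = a
        · subst hi; simp only [if_true]; omega
        · simpa [hi] using h1 i hi
      · intro h1
        refine ⟨fun i hi => by simpa [hi] using h1 i, ?_⟩
        have := h1 a
        simp only [if_true] at this
        omega
    · intro i hi; simp [hi]; ring
    · simp; ring

/-- The good block event: every point of the enlarged core which is connected to the boundary of
the block is connected to the core. -/
def GoodB (c : Zd d) (r H : ℕ) : Set (Config d) :=
  {ω | ∀ b ∈ Bx c (3 * r + 1), (∃ y, (∃ i, |y i - c i| = H) ∧ Conn ω (Bx c H) b y) →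
    ∃ z ∈ Bx c r, Conn ω (Bx c H) b z}

lemma dep_GoodB (c : Zd d) (r H : ℕ) : Dep (GoodB c r H) (Ed (Bx c H)) := by
  intro ω ω' hh hω
  simp only [GoodB, Set.mem_ofPred_eq] at hω ⊢
  simpa only [conn_congr hh] using hω

lemma prob_GoodB (p : unitInterval) (c : Zd d) (r H : ℕ) :
    (bern fun _ => p).real (GoodB c r H)ᶜ = (bern fun _ => p).real (GoodB (0 : Zd d) r H)ᶜ := by
  rw [← bern_pull p (isom c 1 1)
    ((dep_GoodB 0 r H).compl.measurableSet (Ed_finite (Bx_finite _ _)))]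
  set φ := isom c 1 1 with hφ
  have hφ' : ∀ x j, φ x j = c j + x j := fun x j => by simp [hφ, isom_apply]
  have h0 : φ 0 = c := by funext j; simp [hφ']
  have hlat : ∀ x y, latAdj (φ x) (φ y) ↔ latAdj x y := latAdj_isom _ _ _
  have hBx : ∀ k x, φ x ∈ Bx c k ↔ x ∈ Bx 0 k := by
    intro k x
    rw [← h0]; exact isom_mem_Bx _ _ _ _ _ _
  congr 1
  ext ω
  simp only [Set.mem_compl_iff, Set.mem_ofPred_eq]
  refine not_congr ?_
  simp only [GoodB, Set.mem_ofPred_eq, Conn.of_pull hlat (hBx H)]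
  rw [← φ.forall_congr_right]
  refine forall_congr' fun b => ?_
  rw [hBx]
  refine imp_congr Iff.rfl (imp_congr ?_ ?_)
  · refine (Equiv.exists_congr_right φ).symm.trans (exists_congr fun y => ?_)
    simp only [hφ', add_sub_cancel_left, Pi.zero_apply, sub_zero]
  · refine (Equiv.exists_congr_right φ).symm.trans (exists_congr fun y => ?_)
    rw [hBx]

/-- The centre block is good with high probability, at scales with a bounded ratio. -/
lemma exists_block (hd : 0 < d) {p p' : unitInterval} (hp : (p' : ℝ) < p)
    (h' : bern (fun _ => p') {ω : Config d | (cluster ω).Infinite} ≠ 0)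
    (h : bern (fun _ => p) {ω : Config d | (cluster ω).Infinite} ≠ 0) {ε : ℝ} (hε : 0 < ε) :
    ∃ r H : ℕ, 0 < r ∧ 3 * r + 1 ≤ H ∧ H ≤ 11 * r ∧
      ∀ c : Zd d, (bern fun _ => p).real (GoodB c r H)ᶜ ≤ ε := by
  obtain ⟨M, hM, c, hc, hslab⟩ := exists_slab hd hp h' 19
  set η : ℝ := ε / (4 * d) with hη
  have hd' : (0 : ℝ) < d := by exact_mod_cast hd
  have hη0 : 0 < η := by positivity
  obtain ⟨m0, hm0⟩ := exists_tface_nonempty hd h hη0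
  have hp0 : 0 < (p : ℝ) := p'.2.1.trans_lt hp
  set ρ : ℝ := 1 - p ^ 2 * min c 1 with hρ
  have hq1 : (p : ℝ) ^ 2 * min c 1 ≤ 1 := by
    have h1 : (p : ℝ) ^ 2 ≤ 1 := pow_le_one₀ p.2.1 p.2.2
    have h2 : min c 1 ≤ 1 := min_le_right _ _
    have h3 : 0 < min c 1 := lt_min hc one_pos
    nlinarith
  have hρ0 : 0 ≤ ρ := by linarith
  have hρ1 : ρ < 1 := by
    have : 0 < (p : ℝ) ^ 2 * min c 1 := by
      have : 0 < min c 1 := lt_min hc one_pos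
      positivity
    linarith
  have hlim : Filter.Tendsto (fun j : ℕ => (9 * M : ℝ) ^ d * (((3 ^ j : ℕ) : ℝ) ^ (2 * d) * ρ ^ (3 ^ j)))
      Filter.atTop (nhds 0) := by
    have h1 := tendsto_pow_const_mul_const_pow_of_abs_lt_one (2 * d)
      (show |ρ| < 1 by rw [abs_of_nonneg hρ0]; exact hρ1)
    have h2 := (h1.comp (tendsto_pow_atTop_atTop_of_one_lt (r := 3) (by norm_num))).const_mul
      ((9 * M : ℝ) ^ d)
    simpa using h2
  obtain ⟨j, hj1, hj2⟩ := ((hlim.eventually (gt_mem_nhds hη0)).and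
    (Filter.eventually_ge_atTop m0)).exists
  set k : ℕ := 3 ^ j with hk
  have hk0 : 0 < k := by positivity
  have hkodd : Odd k := Odd.pow (by decide)
  obtain ⟨t, ht⟩ : ∃ t, 19 * k * k + 3 = 2 * t := by
    have h1 : Odd (19 * k * k) := (Odd.mul (by decide) hkodd).mul hkodd
    obtain ⟨t, ht⟩ := h1
    exact ⟨t + 2, by omega⟩
  set r := k * k * M with hr
  set H := t * M with hH
  set W := (k + 3) * M + 1 with hW
  have hkM : 1 ≤ k * M := Nat.mul_pos hk0 hM
  have hkk : k ≤ k * k := Nat.le_mul_self k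
  have hr0 : 0 < r := by positivity
  have hH2 : 2 * H = 19 * r + 3 * M := by
    rw [hH, ← mul_assoc, ← ht, hr]; ring
  have hMr : M ≤ r := by rw [hr]; exact Nat.le_mul_of_pos_left _ (by positivity)
  have hkW : k * W ≤ 5 * r := by
    have h1 : W ≤ 5 * (k * M) := by
      rw [hW]
      have : M ≤ k * M := Nat.le_mul_of_pos_left _ hk0
      nlinarith
    calc k * W ≤ k * (5 * (k * M)) := Nat.mul_le_mul_left _ h1
      _ = 5 * r := by rw [hr]; ring
  have hm0r : m0 ≤ r := by
    have : j < k := Nat.lt_pow_self (by norm_num)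
    have : k ≤ r := by
      rw [hr, mul_assoc]; exact Nat.le_mul_of_pos_right _ (by omega)
    omega
  refine ⟨r, H, hr0, by omega, by omega, fun c₀ => ?_⟩
  rw [prob_GoodB]
  classical
  let Bf := (Bx_finite (0 : Zd d) (3 * r + 1)).toFinset
  have hsub : (GoodB (0 : Zd d) r H)ᶜ ⊆ (⋃ q ∈ (Finset.univ : Finset (Fin d × ℤˣ)),
      {ω | tface 0 r H q.1 (fun _ => q.2) ω = ∅}) ∪
      ⋃ q ∈ Bf ×ˢ (Finset.univ : Finset (Fin d × ℤˣ)),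
        Sep H q.2.1 q.2.2 {q.1} (Bx 0 r) ((3 * r + 1 : ℕ) + k * W) := by
    intro ω hω
    simp only [GoodB, Set.mem_compl_iff, Set.mem_ofPred_eq] at hω
    push Not at hω
    obtain ⟨b, hb, ⟨y, ⟨i, hi⟩, hy⟩, hno⟩ := hω
    obtain ⟨s, hs⟩ : ∃ s : ℤˣ, s * y i = H := by
      simp only [Pi.zero_apply, sub_zero] at hi
      rcases abs_choice (y i) with h | h
      · exact ⟨1, by simpa [h] using hi⟩
      · exact ⟨-1, by simpa [h] using hi⟩
    by_cases hf : tface 0 r H i (fun _ => s) ω = ∅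
    · exact Or.inl (Set.mem_iUnion₂.2 ⟨(i, s), Finset.mem_univ _, hf⟩)
    refine Or.inr (Set.mem_iUnion₂.2 ⟨(b, i, s), by simp [Bf, hb], ?_⟩)
    obtain ⟨z, hz, a, ha, haz⟩ := Set.nonempty_iff_ne_empty.2 hf
    have hlev : Lev H i s H = Bx 0 H := by
      ext x
      refine ⟨fun h => h.1, fun h => ⟨h, ?_⟩⟩
      have := h i
      rw [Pi.zero_apply, sub_zero, ← abs_unit_mul s] at this
      exact (le_abs_self _).trans this
    have hlow : ∀ n ≤ 3 * r + 1, Bx (0 : Zd d) n ⊆ Lev H i s ((3 * r + 1 : ℕ) + k * W) := by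
      intro n hn x hx
      refine ⟨Bx_mono _ (by omega) hx, ?_⟩
      have := hx i
      rw [Pi.zero_apply, sub_zero, ← abs_unit_mul s] at this
      have := (le_abs_self _).trans this
      push_cast
      have : (0 : ℤ) ≤ k * W := by positivity
      omega
    refine Sep_anti (h' := H) ?_ ?_ (hlow r (by omega)) ?_
    · exact_mod_cast (show 3 * r + 1 + k * W ≤ H by omega)
    · simpa using hlow _ le_rfl hb
    · refine ⟨⟨y, hs, b, rfl, by rwa [hlev]⟩, ⟨z, by simpa using hz.1, a, ha, by rwa [hlev]⟩, ?_⟩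
      rintro ⟨b', rfl, z', hz', hc'⟩
      rw [hlev] at hc'
      exact hno z' hz' hc'
  have hSep : ∀ q ∈ Bf ×ˢ (Finset.univ : Finset (Fin d × ℤˣ)), (bern fun _ => p).real
      (Sep H q.2.1 q.2.2 {q.1} (Bx 0 r) ((3 * r + 1 : ℕ) + k * W)) ≤ ρ ^ k := by
    rintro ⟨b, a, s⟩ hq
    have hb : b ∈ Bx 0 (3 * r + 1) := by simpa [Bf] using hq
    have hlow : ∀ n ≤ 3 * r + 1, Bx (0 : Zd d) n ⊆ Lev H a s (3 * r + 1 : ℕ) := by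
      intro n hn x hx
      refine ⟨Bx_mono _ (by omega) hx, ?_⟩
      have := hx a
      rw [Pi.zero_apply, sub_zero, ← abs_unit_mul s] at this
      have := (le_abs_self _).trans this
      omega
    refine Sep_iterate p hq1 (by omega) (by omega) (by simpa using hlow _ le_rfl hb)
      (hlow r (by omega)) ?_ k (by exact_mod_cast (show 3 * r + 1 + k * W ≤ H by omega))
    intro t' ht' htH x hx y hy hxy
    obtain ⟨l, u, hS, hu1, hu2⟩ := Slab_eq_Icc H a s (h := t') (h' := t' + W) (by omega) htH
    rw [hS] at hx hy ⊢
    refine (min_le_left _ _).trans (hslab j (19 * k) (by omega) (by simp [hk]) a l u ?_ ?_ x hx y hy hxy)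
    · intro i hi
      rw [hu1 i hi]
      have : (2 * H : ℤ) = (19 * k * k + 3) * M := by
        rw [show (19 * k * k + 3 : ℤ) = 2 * t by exact_mod_cast ht, hH]; push_cast; ring
      rw [this, hk]; push_cast; ring
    · rw [hu2, hW, hk]; push_cast; ring
  refine (measureReal_mono hsub (measure_ne_top _ _)).trans ((measureReal_union_le _ _).trans ?_)
  have h1 : (bern fun _ => p).real (⋃ q ∈ (Finset.univ : Finset (Fin d × ℤˣ)),
      {ω | tface 0 r H q.1 (fun _ => q.2) ω = ∅}) ≤ 2 * d * η := by
    refine (measureReal_biUnion_finset_le _ _).trans ?_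
    refine (Finset.sum_le_sum fun q _ => hm0 r hm0r H (by omega) q.1 _).trans ?_
    simp [Finset.card_univ, Fintype.card_prod]
    apply le_of_eq; ring
  have h2 : (bern fun _ => p).real (⋃ q ∈ Bf ×ˢ (Finset.univ : Finset (Fin d × ℤˣ)),
        Sep H q.2.1 q.2.2 {q.1} (Bx 0 r) ((3 * r + 1 : ℕ) + k * W)) ≤ 2 * d * η := by
    refine (measureReal_biUnion_finset_le _ _).trans ?_
    refine (Finset.sum_le_sum hSep).trans ?_
    rw [Finset.sum_const, nsmul_eq_mul, Finset.card_product]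
    have hcard : (Bf.card : ℝ) ≤ (9 * M : ℝ) ^ d * (k : ℝ) ^ (2 * d) := by
      rw [← Set.ncard_eq_toFinset_card _ (Bx_finite _ _), Bx_ncard]
      push_cast
      rw [pow_mul, ← mul_pow]
      refine pow_le_pow_left₀ (by positivity) ?_ _
      have : 2 * (3 * r + 1) + 1 ≤ 9 * M * (k * k) := by
        have : 9 * M * (k * k) = 9 * r := by rw [hr]; ring
        omega
      calc (2 * (3 * (r : ℝ) + 1) + 1) = ((2 * (3 * r + 1) + 1 : ℕ) : ℝ) := by push_cast; ring
        _ ≤ ((9 * M * (k * k) : ℕ) : ℝ) := by exact_mod_cast this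
        _ = _ := by push_cast; ring
    have hcard2 : (Finset.univ : Finset (Fin d × ℤˣ)).card = 2 * d := by
      simp [Finset.card_univ, Fintype.card_prod]; ring
    rw [hcard2]
    push_cast
    have hj1' : (9 * M : ℝ) ^ d * ((k : ℝ) ^ (2 * d) * ρ ^ k) ≤ η := by
      have := hj1.le
      exact this
    calc _ = (2 * d) * (Bf.card * ρ ^ k) := by ring
      _ ≤ (2 * d) * (((9 * M : ℝ) ^ d * (k : ℝ) ^ (2 * d)) * ρ ^ k) := by gcongr
      _ = (2 * d) * ((9 * M : ℝ) ^ d * ((k : ℝ) ^ (2 * d) * ρ ^ k)) := by ring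
      _ ≤ _ := by gcongr
  have h3 : 2 * d * η + 2 * d * η = ε := by rw [hη]; field_simp; ring
  linarith

end

section

/-! ### Boundaries of finite sets -/

variable {d : ℕ}

/-- Integer sequences have primitives. -/
lemma exists_primitive (f : ℤ → ℤ) : ∃ P : ℤ → ℤ, ∀ t, P (t + 1) - P t = f t := by
  refine ⟨fun t => ∑ s ∈ Finset.Ico 0 t, f s - ∑ s ∈ Finset.Ico t 0, f s, fun t => ?_⟩
  beta_reduce
  rcases le_or_gt 0 t with h | h
  · have h1 : Finset.Ico 0 (t + 1) = insert t (Finset.Ico 0 t) := by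
      ext s; simp only [Finset.mem_Ico, Finset.mem_insert]; omega
    rw [h1, Finset.sum_insert (by simp), Finset.Ico_eq_empty (by omega : ¬ t + 1 < 0),
      Finset.Ico_eq_empty (by omega : ¬ t < 0)]
    simp
  · have h1 : Finset.Ico t 0 = insert t (Finset.Ico (t + 1) 0) := by
      ext s; simp only [Finset.mem_Ico, Finset.mem_insert]; omega
    rw [h1, Finset.sum_insert (by simp), Finset.Ico_eq_empty (by omega : ¬ 0 < t + 1),
      Finset.Ico_eq_empty (by omega : ¬ 0 < t)]
    simp

/-- The unit vector. -/
def bas (i : Fin d) : Zd d := Pi.single i 1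

lemma bas_same (i : Fin d) : bas i i = 1 := by simp [bas]

lemma bas_ne {i j : Fin d} (h : j ≠ i) : bas i j = 0 := by simp [bas, h]

/-- Closed integer one-cochains on the lattice are exact. -/
lemma poincare (F : Fin d → Zd d → ℤ)
    (hF : ∀ i j x, F i x + F j (x + bas i) = F j x + F i (x + bas j)) :
    ∃ g : Zd d → ℤ, ∀ i x, g (x + bas i) - g x = F i x := by
  suffices H : ∀ k : ℕ, ∃ g : Zd d → ℤ, ∀ i : Fin d, i.val < k → ∀ x,
      g (x + bas i) - g x = F i x by
    obtain ⟨g, hg⟩ := H d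
    exact ⟨g, fun i x => hg i i.2 x⟩
  intro k
  induction k with
  | zero => exact ⟨0, fun i hi => by omega⟩
  | succ k ih =>
    obtain ⟨g, hg⟩ := ih
    by_cases hk : k < d
    · set a : Fin d := ⟨k, hk⟩ with ha
      set G : Zd d → ℤ := fun x => F a x - (g (x + bas a) - g x) with hG
      have hinv : ∀ i : Fin d, i.val < k → ∀ x, G (x + bas i) = G x := by
        intro i hi x
        have h1 := hF i a x
        have h2 := hg i hi x
        have h3 := hg i hi (x + bas a)
        have h4 : x + bas i + bas a = x + bas a + bas i := by abel
        simp only [hG, h4]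
        linarith
      choose P hP using fun x : Zd d => exists_primitive fun t => G (Function.update x a t)
      have hPc : ∀ x x' : Zd d, (∀ t, G (Function.update x a t) = G (Function.update x' a t)) →
          ∃ c, ∀ t, P x t = P x' t + c := by
        intro x x' h
        refine ⟨P x 0 - P x' 0, fun t => ?_⟩
        induction t using Int.induction_on with
        | zero => ring
        | succ n ih => have := hP x n; have := hP x' n; have := h n; linarith
        | pred n ih =>
          have h1 := hP x (-n - 1); have h2 := hP x' (-n - 1); have := h (-n - 1)
          simp only [sub_add_cancel] at h1 h2
          linarith
      set h : Zd d → ℤ := fun x => P x (x a) - P x 0 with hh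
      refine ⟨fun x => g x + h x, fun i hi x => ?_⟩
      rcases Nat.lt_succ_iff_lt_or_eq.1 hi with hi | hi
      · have hia : i ≠ a := fun e => by rw [e] at hi; simp [ha] at hi
        have e1 : (x + bas i) a = x a := by simp [bas_ne hia.symm]
        have e2 : ∀ t, G (Function.update (x + bas i) a t) = G (Function.update x a t) := by
          intro t
          rw [← hinv i hi (Function.update x a t)]
          congr 1
          funext j
          by_cases hj : j = a
          · subst hj; simp [bas_ne hia.symm]
          · simp [hj]
        obtain ⟨c, hc⟩ := hPc _ _ e2
        have := hg i hi x
        simp only [hh, e1, hc]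
        linarith
      · have hia : i = a := Fin.ext hi
        subst hia
        have e1 : (x + bas a) a = x a + 1 := by simp [bas_same]
        have e2 : ∀ t, G (Function.update (x + bas a) a t) = G (Function.update x a t) := by
          intro t
          congr 1
          funext j
          by_cases hj : j = a
          · subst hj; simp
          · simp [hj, bas_ne hj]
        obtain ⟨c, hc⟩ := hPc _ _ e2
        have h1 := hP x (x a)
        rw [Function.update_eq_self] at h1
        simp only [hh, e1, hc]
        simp only [hG] at h1
        linarith
    · exact ⟨g, fun i _ x => hg i (by have := i.2; omega) x⟩

/-- Nearest neighbours and diagonal neighbours. -/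
def Star (x y : Zd d) : Prop := ∀ i, |x i - y i| ≤ 1

/-- Connectedness with respect to nearest and diagonal neighbours. -/
def StarConn (Γ : Set (Zd d)) : Prop :=
  ∀ x ∈ Γ, ∀ y ∈ Γ, Relation.ReflTransGen (fun a b => Star a b ∧ b ∈ Γ) x y

lemma latAdj_add_bas (x : Zd d) (i : Fin d) : latAdj x (x + bas i) := by
  unfold latAdj
  rw [Finset.sum_eq_single i]
  · simp [bas_same]
  · intro j _ hj; simp [bas_ne hj]
  · simp

lemma latAdj_iff {x y : Zd d} : latAdj x y ↔ ∃ i, y = x + bas i ∨ x = y + bas i := by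
  constructor
  · intro h
    have hne : ∃ i, x i ≠ y i := by
      by_contra! h0
      simp [latAdj, h0] at h
    obtain ⟨i, hi⟩ := hne
    have hsum : |x i - y i| + ∑ j ∈ Finset.univ.erase i, |x j - y j| = 1 := by
      rw [Finset.add_sum_erase _ (fun j => |x j - y j|) (Finset.mem_univ i)]; exact h
    have h1 : 1 ≤ |x i - y i| := Int.one_le_abs (sub_ne_zero.2 hi)
    have h2 : 0 ≤ ∑ j ∈ Finset.univ.erase i, |x j - y j| := Finset.sum_nonneg fun _ _ => abs_nonneg _
    have h3 : ∑ j ∈ Finset.univ.erase i, |x j - y j| = 0 := by omega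
    have h4 : ∀ j, j ≠ i → x j = y j := by
      intro j hj
      have := (Finset.sum_eq_zero_iff_of_nonneg fun _ _ => abs_nonneg _).1 h3 j (by simp [hj])
      exact sub_eq_zero.1 (abs_eq_zero.1 this)
    have h5 : |x i - y i| = 1 := by omega
    refine ⟨i, ?_⟩
    rcases abs_eq (zero_le_one) |>.1 h5 with h6 | h6
    · right
      funext j
      by_cases hj : j = i
      · subst hj; simp only [Pi.add_apply, bas_same]; omega
      · simp [bas_ne hj, h4 j hj]
    · left
      funext j
      by_cases hj : j = i
      · subst hj; simp only [Pi.add_apply, bas_same]; omega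
      · simp [bas_ne hj, h4 j hj]
  · rintro ⟨i, rfl | rfl⟩
    · exact latAdj_add_bas _ _
    · exact (latAdj_add_bas _ _).symm

/-- The inner vertex boundary of a set. -/
def inBd (D : Set (Zd d)) : Set (Zd d) := {x | x ∈ D ∧ ∃ y, latAdj x y ∧ y ∉ D}

lemma square_star (x : Zd d) (i j : Fin d) {v w : Zd d}
    (hv : v = x ∨ v = x + bas i ∨ v = x + bas j ∨ v = x + bas i + bas j)
    (hw : w = x ∨ w = x + bas i ∨ w = x + bas j ∨ w = x + bas i + bas j) (hij : i ≠ j) :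
    Star v w := by
  have key : ∀ v, (v = x ∨ v = x + bas i ∨ v = x + bas j ∨ v = x + bas i + bas j) →
      ∀ k, x k ≤ v k ∧ v k ≤ x k + 1 := by
    intro v hv k
    have hi : 0 ≤ bas i k ∧ bas i k ≤ 1 := by
      by_cases h : k = i
      · subst h; simp [bas_same]
      · simp [bas_ne h]
    have hj : 0 ≤ bas j k ∧ bas j k ≤ 1 := by
      by_cases h : k = j
      · subst h; simp [bas_same]
      · simp [bas_ne h]
    have hs : bas i k + bas j k ≤ 1 := by
      by_cases h : k = i
      · subst h; simp [bas_same, bas_ne hij]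
      · simp only [bas_ne h]; omega
    rcases hv with rfl | rfl | rfl | rfl <;> (try simp only [Pi.add_apply]) <;> omega
  intro k
  have h1 := key v hv k
  have h2 := key w hw k
  rw [_root_.abs_le]; omega

open Classical in
/-- The vertex boundary of a connected set with connected complement cannot be split. -/
lemma inBd_not_split {D V₁ V₂ : Set (Zd d)}
    (hD : ∀ x ∈ D, ∀ y ∈ D, Conn (fun _ => true) D x y)
    (hDc : ∀ x ∉ D, ∀ y ∉ D, Conn (fun _ => true) Dᶜ x y)
    (hV : inBd D = V₁ ∪ V₂) (hstar : ∀ x ∈ V₁, ∀ y ∈ V₂, ¬ Star x y) {v₁ v₂ : Zd d}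
    (h₁ : v₁ ∈ V₁) (h₂ : v₂ ∈ V₂) : False := by
  have hV1D : ∀ x ∈ V₁, x ∈ D := fun x hx => (hV ▸ Or.inl hx : x ∈ inBd D).1
  have hV2D : ∀ x ∈ V₂, x ∈ D := fun x hx => (hV ▸ Or.inr hx : x ∈ inBd D).1
  set f : Zd d → Zd d → ℤ := fun x y =>
    (if x ∉ D ∧ y ∈ V₁ then 1 else 0) - (if x ∈ V₁ ∧ y ∉ D then 1 else 0) with hf
  have hfD : ∀ x y, x ∈ D → y ∈ D → f x y = 0 := by
    intro x y hx hy; simp [hf, hx, hy]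
  have hfDc : ∀ x y, x ∉ D → y ∉ D → f x y = 0 := by
    intro x y hx hy
    have h1 : x ∉ V₁ := fun h => hx (hV1D x h)
    have h2 : y ∉ V₁ := fun h => hy (hV1D y h)
    simp [hf, h1, h2]
  have hflat : ∀ x y, latAdj x y → (x ∉ V₂) → (y ∉ V₂) →
      f x y = (if y ∈ D then 1 else 0) - (if x ∈ D then 1 else 0) := by
    intro x y hxy hx2 hy2
    by_cases hx : x ∈ D <;> by_cases hy : y ∈ D
    · simp [hfD x y hx hy, hx, hy]
    · have : x ∈ V₁ := by
        have : x ∈ inBd D := ⟨hx, y, hxy, hy⟩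
        rw [hV] at this
        exact this.resolve_right hx2
      simp [hf, hx, hy, this]
    · have : y ∈ V₁ := by
        have : y ∈ inBd D := ⟨hy, x, hxy.symm, hx⟩
        rw [hV] at this
        exact this.resolve_right hy2
      simp [hf, hx, hy, this]
    · simp [hfDc x y hx hy, hx, hy]
  obtain ⟨g, hg⟩ := poincare (fun i x => f x (x + bas i)) (by
    intro i j x
    by_cases hij : i = j
    · subst hij; rfl
    by_cases hw : ∃ w, (w = x ∨ w = x + bas i ∨ w = x + bas j ∨ w = x + bas i + bas j) ∧ w ∈ V₂
    · obtain ⟨w, hw, hw2⟩ := hw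
      have hno : ∀ v, (v = x ∨ v = x + bas i ∨ v = x + bas j ∨ v = x + bas i + bas j) → v ∉ V₁ :=
        fun v hv hv1 => hstar v hv1 w hw2 (square_star x i j hv hw hij)
      have h0 := hno x (by simp)
      have h1 := hno (x + bas i) (by simp)
      have h2 := hno (x + bas j) (by simp)
      have h3 := hno (x + bas i + bas j) (by simp)
      have h4 : x + bas j + bas i ∉ V₁ := by rwa [add_right_comm]
      simp [hf, h0, h1, h2, h3, h4]
    · push Not at hw
      have h0 := hw x (by simp)
      have h1 := hw (x + bas i) (by simp)
      have h2 := hw (x + bas j) (by simp)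
      have h3 := hw (x + bas i + bas j) (by simp)
      have h4 : x + bas j + bas i = x + bas i + bas j := add_right_comm _ _ _
      rw [hflat _ _ (latAdj_add_bas _ _) h0 h1, hflat _ _ (latAdj_add_bas _ _) h1 h3,
        hflat _ _ (latAdj_add_bas _ _) h0 h2, hflat _ _ (latAdj_add_bas _ _) h2 (by rwa [h4]), h4]
      ring)
  have hgadj : ∀ x y, latAdj x y → g y - g x = f x y := by
    intro x y hxy
    rcases latAdj_iff.1 hxy with ⟨i, rfl | rfl⟩
    · exact hg i x
    · have := hg i y
      have h2 : f (y + bas i) y = - f y (y + bas i) := by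
        simp only [hf]
        simp only [and_comm]
        ring
      rw [h2]; linarith
  have hgD : ∀ x ∈ D, ∀ y ∈ D, g x = g y := by
    intro x hx y hy
    refine (hD x hx y hy).induct (P := fun y => g x = g y) rfl ?_
    intro y z hy' ih hyz hz
    have := hgadj y z hyz.1
    rw [hfD y z hy'.mem_right hz] at this
    linarith
  have hgDc : ∀ x ∉ D, ∀ y ∉ D, g x = g y := by
    intro x hx y hy
    refine (hDc x hx y hy).induct (P := fun y => g x = g y) rfl ?_
    intro y z hy' ih hyz hz
    have := hgadj y z hyz.1
    rw [hfDc y z hy'.mem_right hz] at this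
    linarith
  obtain ⟨hD1, y₁, ha₁, hy₁⟩ : v₁ ∈ inBd D := hV ▸ Or.inl h₁
  obtain ⟨hD2, y₂, ha₂, hy₂⟩ : v₂ ∈ inBd D := hV ▸ Or.inr h₂
  have e1 := hgadj v₁ y₁ ha₁
  have e2 := hgadj v₂ y₂ ha₂
  have e3 := hgD v₁ hD1 v₂ hD2
  have e4 := hgDc y₁ hy₁ y₂ hy₂
  have h2V : v₂ ∉ V₁ := fun h => hstar v₂ h v₂ h₂ (fun i => by simp)
  have e5 : f v₁ y₁ = -1 := by simp [hf, h₁, hy₁, hD1]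
  have e6 : f v₂ y₂ = 0 := by simp [hf, hD2, h2V]
  omega

/-- The vertex boundary of a connected set with connected complement is connected in the sense of
nearest and diagonal neighbours. -/
lemma starConn_inBd {D : Set (Zd d)} (hD : ∀ x ∈ D, ∀ y ∈ D, Conn (fun _ => true) D x y)
    (hDc : ∀ x ∉ D, ∀ y ∉ D, Conn (fun _ => true) Dᶜ x y) : StarConn (inBd D) := by
  intro x hx y hy
  by_contra hxy
  set V₁ := {z | z ∈ inBd D ∧ Relation.ReflTransGen (fun a b => Star a b ∧ b ∈ inBd D) x z} with hV1
  refine inBd_not_split (V₁ := V₁) (V₂ := inBd D \ V₁) hD hDc ?_ ?_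
    (v₁ := x) (v₂ := y) ⟨hx, .refl⟩ ⟨hy, fun h => hxy h.2⟩
  · rw [Set.union_sdiff_self]
    exact (Set.union_eq_self_of_subset_left fun z hz => hz.1).symm
  · rintro u ⟨hu, hxu⟩ v ⟨hv, hv'⟩ huv
    exact hv' ⟨hv, hxu.tail ⟨huv, hv⟩⟩

end

section

/-! ### Projections of boundaries -/

variable {d : ℕ}

lemma line_hits_inBd {D : Set (Zd d)} (hD : Dᶜ.Finite) {x : Zd d} (hx : x ∉ D) (i : Fin d) :
    ∃ t : ℤ, Function.update x i t ∈ inBd D := by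
  classical
  have hex : ∃ n : ℕ, Function.update x i (x i + n) ∈ D := by
    by_contra! h
    have hinj : Function.Injective fun n : ℕ => Function.update x i (x i + n) := by
      intro n m hnm
      have := congrFun hnm i
      simpa using this
    exact Set.infinite_of_injective_forall_mem hinj h hD
  have h1 := Nat.find_spec hex
  obtain ⟨k, hk⟩ : ∃ k, Nat.find hex = k + 1 := by
    refine Nat.exists_eq_succ_of_ne_zero fun h0 => ?_
    rw [h0] at h1
    simp at h1
    exact hx h1
  have h2 := Nat.find_min hex (m := k) (by omega)
  rw [hk] at h1
  refine ⟨_, h1, _, ?_, h2⟩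
  refine latAdj.symm (latAdj_iff.2 ⟨i, Or.inl ?_⟩)
  funext j
  by_cases hj : j = i
  · subst hj; simp [bas_same]; ring
  · simp [hj, bas_ne hj]

/-- The vertex isoperimetric inequality on the lattice. -/
lemma lattice_isoperimetry (hd : 2 ≤ d) {D : Set (Zd d)} (hD : Dᶜ.Finite) :
    (Dᶜ.ncard) ^ (d - 1) ≤ (inBd D).ncard ^ d := by
  classical
  by_cases hbfin : (inBd D).Finite
  swap
  · exfalso
    refine hbfin ?_
    refine Set.Finite.subset (Set.Finite.biUnion hD fun y _ => Bx_finite y 1) ?_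
    rintro x ⟨-, y, hxy, hy⟩
    exact Set.mem_biUnion (show y ∈ Dᶜ from hy) hxy.symm.mem_Bx
  have hd1 : (1 : ℝ) < d := by exact_mod_cast hd
  have hd0 : (0 : ℝ) < (d : ℝ) - 1 := by linarith
  have hpi : Measure.pi (fun _ : Fin d => (Measure.count : Measure ℤ)) = Measure.count := by
    refine Measure.ext_of_singleton fun a => ?_
    rw [Measure.pi_singleton]; simp
  set q : ℝ := d / (d - 1) with hq
  have hconj : Real.HolderConjugate (Fintype.card (Fin d)) q := by
    rw [Fintype.card_fin]
    exact Real.HolderConjugate.conjExponent hd1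
  have key := lintegral_prod_lintegral_pow_le (fun _ : Fin d => (Measure.count : Measure ℤ)) hconj
    (f := (inBd D).indicator 1) (Measurable.of_discrete)
  rw [hpi, lintegral_indicator_one (by measurability), Measure.count_apply_finite _ hbfin] at key
  have h1 : (Dᶜ).indicator 1 ≤ fun x : Fin d → ℤ => ∏ i : Fin d,
      (∫⁻ t, (inBd D).indicator (1 : (Fin d → ℤ) → ℝ≥0∞) (Function.update x i t) ∂Measure.count) ^
        ((1 : ℝ) / (Fintype.card (Fin d) - 1 : ℝ)) := by
    intro x
    by_cases hx : x ∈ Dᶜ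
    · rw [Set.indicator_of_mem hx, Pi.one_apply]
      refine Finset.one_le_prod' fun i _ => ?_
      refine ENNReal.one_le_rpow ?_ (by rw [Fintype.card_fin]; positivity)
      obtain ⟨t, ht⟩ := line_hits_inBd hD hx i
      rw [lintegral_count]
      refine le_trans ?_ (ENNReal.le_tsum t)
      rw [Set.indicator_of_mem ht]; simp
    · rw [Set.indicator_of_notMem hx]; exact zero_le
  have h2 := (lintegral_mono h1 (μ := Measure.count)).trans key
  rw [lintegral_indicator_one (by measurability), Measure.count_apply_finite _ hD] at h2
  rw [Set.ncard_eq_toFinset_card _ hD, Set.ncard_eq_toFinset_card _ hbfin]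
  set a := hD.toFinset.card
  set b := hbfin.toFinset.card
  have h3 : (a : ℝ) ≤ (b : ℝ) ^ q := by
    have := ENNReal.toReal_mono
      (ENNReal.rpow_ne_top_of_nonneg (by positivity : 0 ≤ q) (ENNReal.natCast_ne_top _)) h2
    rwa [← ENNReal.toReal_rpow, ENNReal.toReal_natCast, ENNReal.toReal_natCast] at this
  have h4 : ((a ^ (d - 1) : ℕ) : ℝ) ≤ ((b ^ d : ℕ) : ℝ) := by
    push_cast
    calc (a : ℝ) ^ (d - 1) ≤ ((b : ℝ) ^ q) ^ (d - 1) := pow_le_pow_left₀ (by positivity) h3 _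
      _ = (b : ℝ) ^ d := by
        rw [← Real.rpow_natCast, ← Real.rpow_mul (by positivity), ← Real.rpow_natCast]
        congr 1
        rw [hq, Nat.cast_sub (by omega)]
        push_cast
        field_simp
  exact_mod_cast h4

/-- The complement of a box is connected. -/
lemma conn_compl_Bx (hd : 2 ≤ d) {n : ℕ} {x y : Zd d} (hx : x ∉ Bx 0 n) (hy : y ∉ Bx 0 n) :
    Conn (fun _ => true) (Bx 0 n)ᶜ x y := by
  have hhalf : ∀ (i : Fin d) (s : ℤˣ) (x y : Zd d), (n : ℤ) < s * x i → (n : ℤ) < s * y i →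
      Conn (fun _ => true) (Bx 0 n)ᶜ x y := by
    intro i s x y hx hy
    refine (conn_Icc (l := x ⊓ y) (u := x ⊔ y) ⟨inf_le_left, le_sup_left⟩
      ⟨inf_le_right, le_sup_right⟩).mono_set ?_
    intro z hz hzn
    have h1 : (x ⊓ y) i ≤ z i := hz.1 i
    have h2 : z i ≤ (x ⊔ y) i := hz.2 i
    have h3 := _root_.abs_le.1 (hzn i)
    simp only [Pi.inf_apply, Pi.sup_apply, Pi.zero_apply] at h1 h2 h3
    rcases Int.units_eq_one_or s with hs | hs <;> subst hs <;> simp at hx hy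
    · rcases min_le_iff.1 h1 with h | h <;> omega
    · rcases le_max_iff.1 h2 with h | h <;> omega
  have hpick : ∀ x : Zd d, x ∉ Bx 0 n → ∃ (i : Fin d) (s : ℤˣ), (n : ℤ) < s * x i := by
    intro x hx
    simp only [mem_Bx, not_forall, not_le, Pi.zero_apply, sub_zero] at hx
    obtain ⟨i, hi⟩ := hx
    rcases abs_choice (x i) with h | h
    · exact ⟨i, 1, by rw [h] at hi; simpa using hi⟩
    · exact ⟨i, -1, by rw [h] at hi; simpa using hi⟩
  have hdiff : ∀ (i j : Fin d) (s t : ℤˣ) (x y : Zd d), i ≠ j → (n : ℤ) < s * x i → (n : ℤ) < t * y j →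
      Conn (fun _ => true) (Bx 0 n)ᶜ x y := by
    intro i j s t x y hij hx hy
    let z : Zd d := fun k => if k = i then s * (n + 1) else t * (n + 1)
    have hu : ∀ s : ℤˣ, (s : ℤ) * (s * (n + 1)) = n + 1 := by
      intro s
      rw [← mul_assoc, ← Units.val_mul, Int.units_mul_self]; simp
    exact (hhalf i s x z hx (by simp [z, hu])).trans
      (hhalf j t z y (by simp [z, hij.symm, hu]) hy)
  obtain ⟨i, s, hi⟩ := hpick x hx
  obtain ⟨j, t, hj⟩ := hpick y hy
  by_cases hij : i = j
  · subst hij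
    have : Nontrivial (Fin d) := Fin.nontrivial_iff_two_le.2 hd
    obtain ⟨k, hk⟩ := exists_ne i
    exact (hdiff i k s 1 x (fun _ => n + 1) hk.symm hi (by simp)).trans
      (hdiff k i 1 t _ y hk (by simp) hj)
  · exact hdiff i j s t x y hij hi hj

/-- Filling the holes of a finite connected set. -/
lemma exists_outer (hd : 2 ≤ d) {A : Set (Zd d)} {n : ℕ} (hA : A ⊆ Bx 0 n)
    (hconn : ∀ x ∈ A, ∀ y ∈ A, Conn (fun _ => true) A x y) (hne : A.Nonempty) :
    ∃ D : Set (Zd d), A ⊆ Dᶜ ∧ (Bx 0 n)ᶜ ⊆ D ∧ (∀ x ∈ D, ∀ y ∈ D, Conn (fun _ => true) D x y) ∧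
      (∀ x ∉ D, ∀ y ∉ D, Conn (fun _ => true) Dᶜ x y) ∧
      ∀ x ∈ inBd D, ∃ y ∈ A, latAdj x y := by
  obtain ⟨a, ha⟩ := hne
  have i₀ : Fin d := ⟨0, by omega⟩
  set z : Zd d := fun _ => n + 1 with hz
  have hzn : z ∉ Bx 0 n := by
    intro h
    have := _root_.abs_le.1 (h i₀)
    simp only [hz, Pi.zero_apply, sub_zero] at this
    omega
  set D : Set (Zd d) := {x | Conn (fun _ => true) Aᶜ z x} with hD
  have hDA : A ⊆ Dᶜ := fun x hx hxD => hxD.mem_right hx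
  have hself : ∀ x ∈ D, Conn (fun _ => true) D z x := by
    intro x hx
    have h0 : z ∈ D := .refl hx.mem_left
    refine hx.induct (P := fun x => Conn (fun _ => true) D z x) (.refl h0) ?_
    intro u v hu ih huv hv
    exact ih.tail huv (hu.tail huv hv)
  have hclosed : ∀ x ∈ D, ∀ y, latAdj x y → y ∉ A → y ∈ D := fun x hx y hxy hy =>
    Conn.tail hx ⟨hxy, rfl⟩ hy
  have htoA : ∀ x ∉ D, ∃ b ∈ A, Conn (fun _ => true) Dᶜ x b := by
    intro x hx
    by_cases hxA : x ∈ A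
    · exact ⟨x, hxA, .refl hx⟩
    have hxa : Conn (fun _ => true) Set.univ x a := by
      refine (conn_Icc (l := x ⊓ a) (u := x ⊔ a) ⟨inf_le_left, le_sup_left⟩
        ⟨inf_le_right, le_sup_right⟩).mono_set (Set.subset_univ _)
    obtain ⟨u, v, hxu, huv, -, hvA⟩ := hxa.exists_exit (A := Aᶜ) hxA (by simpa using ha)
    have hvA' : v ∈ A := by simpa using hvA
    have hsub : Conn (fun _ => true) Dᶜ x u := by
      refine hxu.induct (P := fun u => Conn (fun _ => true) Dᶜ x u) (.refl hx) ?_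
      intro s t hs ih hst ht
      exact ih.tail hst fun htD => ih.mem_right (hclosed t htD s hst.1.symm hs.mem_right.2)
    exact ⟨v, hvA', hsub.tail huv (hDA hvA')⟩
  refine ⟨D, hDA, ?_, ?_, ?_, ?_⟩
  · intro x hx
    exact (conn_compl_Bx hd hzn hx).mono_set (Set.compl_subset_compl.2 hA)
  · intro x hx y hy
    exact (hself x hx).symm.trans (hself y hy)
  · intro x hx y hy
    obtain ⟨b, hb, hxb⟩ := htoA x hx
    obtain ⟨c, hc, hyc⟩ := htoA y hy
    exact hxb.trans (((hconn b hb c hc).mono_set hDA).trans hyc.symm)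
  · rintro x ⟨hx, y, hxy, hy⟩
    exact ⟨y, by_contra fun h => hy (hclosed x hx y hxy h), hxy⟩

end

section

/-! ### Lattice animals -/

variable {d : ℕ}

/-- The `*`-connected finite sets of size `k` containing `v`. -/
def Animal (v : Zd d) (k : ℕ) : Set (Finset (Zd d)) :=
  {Γ | v ∈ Γ ∧ Γ.card = k ∧ StarConn (Γ : Set (Zd d))}

lemma card_le_of_animal {v : Zd d} {k : ℕ} (F : Finset (Finset (Zd d)))
    (hF : ∀ Γ ∈ F, Γ ∈ Animal v k) : F.card ≤ (2 ^ 3 ^ d) ^ k := by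
  classical
  let p : unitInterval := ⟨1 / 2, by norm_num, by norm_num⟩
  let N : Finset (Zd d) → Finset (Zd d) := fun Γ => Γ.biUnion fun x => (Bx_finite x 1).toFinset
  have hN : ∀ Γ x y, x ∈ Γ → Star x y → y ∈ N Γ := by
    intro Γ x y hx hxy
    refine Finset.mem_biUnion.2 ⟨x, hx, ?_⟩
    rw [Set.Finite.mem_toFinset, mem_Bx]
    intro i
    have := hxy i
    rw [abs_sub_comm]
    exact_mod_cast this
  have hNc : ∀ Γ, Γ.card = k → (N Γ).card ≤ k * 3 ^ d := by
    intro Γ hΓ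
    rw [← hΓ]
    refine Finset.card_biUnion_le_card_mul _ _ _ fun x _ => ?_
    rw [← Set.ncard_eq_toFinset_card _ (Bx_finite x 1), Bx_ncard]
  let E : Finset (Zd d) → Set (Zd d → Bool) := fun Γ => {θ | ∀ x ∈ N Γ, θ x = decide (x ∈ Γ)}
  have hE : ∀ Γ, MeasurableSet (E Γ) := by
    intro Γ
    refine Dep.measurableSet (S := N Γ) (N Γ).finite_toSet ?_
    intro ω ω' h hω x hx
    rw [← h x hx]; exact hω x hx
  have hsub : ∀ Γ ∈ F, ∀ Γ' ∈ F, ∀ θ ∈ E Γ, θ ∈ E Γ' → Γ ⊆ Γ' := by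
    intro Γ hΓ Γ' hΓ' θ h h' x hx
    have hc := (hF Γ hΓ).2.2 v (hF Γ hΓ).1 x hx
    suffices x ∈ Γ ∧ x ∈ Γ' from this.2
    clear hx
    induction hc with
    | refl => exact ⟨(hF Γ hΓ).1, (hF Γ' hΓ').1⟩
    | tail _ hbc ih =>
      refine ⟨hbc.2, ?_⟩
      have h1 := h _ (hN Γ _ _ hbc.2 fun i => by rw [sub_self]; norm_num)
      have h2 := h' _ (hN Γ' _ _ ih.2 hbc.1)
      rw [h1] at h2
      have h3 := of_decide_eq_true (h2.symm.trans (decide_eq_true hbc.2))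
      exact h3
  have hdisj : (F : Set (Finset (Zd d))).PairwiseDisjoint E := by
    intro Γ hΓ Γ' hΓ' hne
    refine Set.disjoint_left.2 fun θ h h' => hne ?_
    exact (hsub Γ hΓ Γ' hΓ' θ h h').antisymm (hsub Γ' hΓ' Γ hΓ θ h' h)
  have hsum := measureReal_biUnion_finset (μ := bern fun _ : Zd d => p) hdisj (fun Γ _ => hE Γ)
  have hle : ∀ Γ ∈ F, ((1 : ℝ) / 2) ^ (k * 3 ^ d) ≤ (bern fun _ : Zd d => p).real (E Γ) := by
    intro Γ hΓ
    have := bern_cylinder (fun _ : Zd d => p) (N Γ) (fun x => decide (x ∈ Γ))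
    have h2 : (bern fun _ : Zd d => p).real (E Γ) = ((1 : ℝ) / 2) ^ (N Γ).card := by
      rw [Measure.real, this, ENNReal.toReal_prod]
      rw [Finset.prod_congr rfl (g := fun _ => (1 : ℝ) / 2), Finset.prod_const]
      intro x _
      by_cases hx : x ∈ Γ
      · simp [hx, p]
      · simp [hx, p]; norm_num
    rw [h2]
    exact pow_le_pow_of_le_one (by norm_num) (by norm_num) (hNc Γ (hF Γ hΓ).2.1)
  have h1 : (F.card : ℝ) * ((1 : ℝ) / 2) ^ (k * 3 ^ d) ≤ 1 := by
    rw [← nsmul_eq_mul, ← Finset.sum_const]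
    refine (Finset.sum_le_sum hle).trans ?_
    rw [← hsum]
    exact measureReal_le_one
  have h2 : (F.card : ℝ) ≤ ((2 ^ 3 ^ d) ^ k : ℕ) := by
    rw [one_div, inv_pow, ← div_eq_mul_inv, div_le_one (by positivity)] at h1
    push_cast
    rw [← pow_mul, mul_comm]
    exact h1
  exact_mod_cast h2

lemma animal_finite (v : Zd d) (k : ℕ) : (Animal v k).Finite := by
  by_contra h
  obtain ⟨F, hF, hc⟩ := Set.Infinite.exists_subset_card_eq h ((2 ^ 3 ^ d) ^ k + 1)
  have := card_le_of_animal F fun Γ hΓ => hF hΓ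
  omega

/-- If there are finitely many colours, and events indexed by sites of the same colour depend on disjoint
finite sets, it is unlikely that half of the events of a given family occur. -/
lemma prob_half_le {ι κ K : Type*} [Fintype K] (w : ι → unitInterval)
    (bad : κ → Set (ι → Bool)) (U : κ → Set ι) (hU : ∀ x, (U x).Finite)
    (hdep : ∀ x, Dep (bad x) (U x)) (color : κ → K)
    (hdisj : ∀ x y, x ≠ y → color x = color y → Disjoint (U x) (U y)) {δ : ℝ} (hδ0 : 0 ≤ δ) (hδ1 : δ ≤ 1)
    (hbad : ∀ x, (bern w).real (bad x) ≤ δ ^ (2 * Fintype.card K)) (Γ : Finset κ) :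
    (bern w).real {ω | Γ.card ≤ 2 * {x | x ∈ Γ ∧ ω ∈ bad x}.ncard} ≤ (2 * δ) ^ Γ.card := by
  classical
  have hall : ∀ S : Finset κ, (∀ x ∈ S, ∀ y ∈ S, color x = color y) →
      MeasurableSet {ω | ∀ x ∈ S, ω ∈ bad x} ∧
      Dep {ω | ∀ x ∈ S, ω ∈ bad x} (⋃ x ∈ S, U x) ∧
      (bern w).real {ω | ∀ x ∈ S, ω ∈ bad x} ≤ (δ ^ (2 * Fintype.card K)) ^ S.card := by
    intro S
    have hdS : ∀ S : Finset κ, Dep {ω | ∀ x ∈ S, ω ∈ bad x} (⋃ x ∈ S, U x) := by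
      intro S ω ω' h hω x hx
      exact hdep x ω ω' (fun e he => h e (Set.mem_biUnion (show x ∈ S from hx) he)) (hω x hx)
    have hfS : ∀ S : Finset κ, (⋃ x ∈ S, U x).Finite := fun S =>
      Set.Finite.biUnion S.finite_toSet fun x _ => hU x
    induction S using Finset.induction_on with
    | empty => intro _; refine ⟨by simp, hdS _, by simp⟩
    | insert a S ha ih =>
      intro hcol
      obtain ⟨hm, hd, hp⟩ := ih fun x hx y hy => hcol x (by simp [hx]) y (by simp [hy])
      refine ⟨(hdS _).measurableSet (hfS _), hdS _, ?_⟩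
      have heq : {ω | ∀ x ∈ insert a S, ω ∈ bad x} = bad a ∩ {ω | ∀ x ∈ S, ω ∈ bad x} := by
        ext ω; simp
      have hma := (hdep a).measurableSet (hU a)
      have hD : Disjoint (U a) (⋃ x ∈ S, U x) := by
        rw [Set.disjoint_iUnion₂_right]
        intro x hx
        exact hdisj a x (fun h => ha (h ▸ hx)) (hcol a (by simp) x (by simp [hx]))
      rw [heq, bern_inter w (hdep a) hd hD hma hm,
        Finset.card_insert_of_notMem ha, pow_succ']
      exact mul_le_mul (hbad a) hp ENNReal.toReal_nonneg (by positivity)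
  set T := Γ.powerset.filter fun S =>
    (∀ x ∈ S, ∀ y ∈ S, color x = color y) ∧ Γ.card ≤ 2 * Fintype.card K * S.card with hT
  have hsub : {ω | Γ.card ≤ 2 * {x | x ∈ Γ ∧ ω ∈ bad x}.ncard} ⊆ ⋃ S ∈ T, {ω | ∀ x ∈ S, ω ∈ bad x} := by
    intro ω hω
    rw [Set.mem_ofPred_eq] at hω
    set B := Γ.filter fun x => ω ∈ bad x with hB
    have hBc : {x | x ∈ Γ ∧ ω ∈ bad x}.ncard = B.card := by
      rw [← Set.ncard_coe_finset]; congr 1; ext x; simp [hB]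
    rw [hBc] at hω
    rcases isEmpty_or_nonempty K with hK | hK
    · have hΓ : Γ = ∅ := Finset.eq_empty_of_forall_notMem fun x _ => hK.elim (color x)
      refine Set.mem_biUnion (x := ∅) (by simp [hT, hΓ]) (by simp)
    have hK0 : (0 : ℝ) < Fintype.card K := by exact_mod_cast Fintype.card_pos
    obtain ⟨c, -, hc⟩ := Finset.exists_le_card_fiber_of_nsmul_le_card_of_maps_to (s := B)
      (t := Finset.univ) (f := color) (b := (B.card : ℝ) / Fintype.card K)
      (fun _ _ => Finset.mem_univ _) Finset.univ_nonempty
      (by rw [Finset.card_univ, nsmul_eq_mul, mul_div_cancel₀ _ hK0.ne'])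
    rw [div_le_iff₀ hK0] at hc
    have hc' : B.card ≤ (B.filter fun x => color x = c).card * Fintype.card K := by exact_mod_cast hc
    refine Set.mem_biUnion (x := B.filter fun x => color x = c) ?_ ?_
    · refine Finset.mem_coe.2 (Finset.mem_filter.2 ⟨?_, ?_, ?_⟩)
      · rw [Finset.mem_powerset]
        exact (Finset.filter_subset _ _).trans (Finset.filter_subset _ _)
      · intro x hx y hy
        rw [(Finset.mem_filter.1 hx).2, (Finset.mem_filter.1 hy).2]
      · rw [mul_assoc, mul_comm (Fintype.card K)]; omega
    · intro x hx
      exact (Finset.mem_filter.1 (Finset.mem_filter.1 hx).1).2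
  refine (measureReal_mono hsub (measure_ne_top _ _)).trans ?_
  refine (measureReal_biUnion_finset_le _ _).trans ?_
  have hterm : ∀ S ∈ T, (bern w).real {ω | ∀ x ∈ S, ω ∈ bad x} ≤ δ ^ Γ.card := by
    intro S hS
    rw [hT, Finset.mem_filter] at hS
    refine (hall S hS.2.1).2.2.trans ?_
    rw [← pow_mul]
    exact pow_le_pow_of_le_one hδ0 hδ1 hS.2.2
  refine (Finset.sum_le_sum hterm).trans ?_
  rw [Finset.sum_const, nsmul_eq_mul, mul_pow]
  refine mul_le_mul_of_nonneg_right ?_ (by positivity)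
  have : T.card ≤ 2 ^ Γ.card := (Finset.card_filter_le _ _).trans (Finset.card_powerset Γ).le
  exact_mod_cast this

end

section

/-! ### Good cubes -/

variable {d : ℕ}

/-- The centre of the cube with index `x` at scale `r`. -/
def ctr (r : ℕ) (x : Zd d) : Zd d := fun i => (2 * r + 1) * x i

lemma disjoint_Ed_ctr {r H : ℕ} (hH : H ≤ 11 * r) {x y : Zd d} (hne : x ≠ y)
    (hcol : (fun i => (x i : ZMod 12)) = fun i => (y i : ZMod 12)) :
    Disjoint (Ed (Bx (ctr r x) H)) (Ed (Bx (ctr r y) H)) := by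
  refine Set.disjoint_left.2 fun e he he' => hne ?_
  induction e using Sym2.ind with
  | _ a b =>
    have ha := (mk_mem_Ed.1 he).1
    have ha' := (mk_mem_Ed.1 he').1
    funext i
    have h1 := _root_.abs_le.1 (ha i)
    have h2 := _root_.abs_le.1 (ha' i)
    have h3 : ((12 : ℕ) : ℤ) ∣ y i - x i := (ZMod.intCast_eq_intCast_iff_dvd_sub _ _ _).1 (congrFun hcol i)
    simp only [ctr] at h1 h2
    obtain ⟨t, ht⟩ := h3
    have hy : y i = x i + 12 * t := by push_cast at ht; linarith
    rw [hy] at h2 ⊢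
    rcases lt_trichotomy t 0 with h | h | h
    · nlinarith
    · simp [h]
    · nlinarith

lemma summable_box_geometric (M D : ℕ) :
    Summable fun k : ℕ => ((2 * (k ^ M : ℕ) + 1 : ℕ) : ℝ) ^ D * (1 / 2) ^ k := by
  have h := summable_pow_mul_geometric_of_norm_lt_one (R := ℝ) (M * D) (r := 1 / 2) (by norm_num)
  have h2 := ((summable_nat_add_iff 1).2 h).mul_left (2 * 3 ^ D)
  refine Summable.of_nonneg_of_le (fun k => by positivity) (fun k => ?_) h2
  have h3 : ((2 * (k ^ M : ℕ) + 1 : ℕ) : ℝ) ≤ 3 * ((k : ℝ) + 1) ^ M := by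
    push_cast
    have h4 : (k : ℝ) ^ M ≤ ((k : ℝ) + 1) ^ M := pow_le_pow_left₀ (by positivity) (by linarith) _
    have h5 : (1 : ℝ) ≤ ((k : ℝ) + 1) ^ M := one_le_pow₀ (by linarith [(Nat.cast_nonneg k : (0:ℝ) ≤ k)])
    linarith
  calc _ ≤ (3 * ((k : ℝ) + 1) ^ M) ^ D * (1 / 2) ^ k := by gcongr
    _ = _ := by push_cast; rw [mul_pow, ← pow_mul, pow_succ]; ring

/-- At a suitable scale, almost surely every large `*`-connected set not too far from the
origin has a majority of good blocks. -/
lemma exists_good_scale (hd : 2 ≤ d) {p' p : unitInterval} (hp : (p' : ℝ) < p)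
    (h' : bern (fun _ => p') {ω : Config d | (cluster ω).Infinite} ≠ 0)
    (h : bern (fun _ => p) {ω : Config d | (cluster ω).Infinite} ≠ 0) :
    ∃ r H : ℕ, 0 < r ∧ 3 * r + 1 ≤ H ∧ ∀ M : ℕ, ∀ᵐ ω : Config d ∂bern fun _ => p,
      ∃ K : ℕ, ∀ k ≥ K, ∀ v ∈ Bx 0 (k ^ M), ∀ Γ ∈ Animal v k,
        2 * {x : Zd d | x ∈ Γ ∧ ω ∉ GoodB (ctr r x) r H}.ncard < k := by
  set δ : ℝ := 1 / (4 * 2 ^ 3 ^ d) with hδ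
  have hδ0 : 0 < δ := by positivity
  have hδ1 : δ ≤ 1 := by
    rw [hδ, div_le_one (by positivity)]
    have : (1 : ℝ) ≤ 2 ^ 3 ^ d := one_le_pow₀ (by norm_num)
    linarith
  obtain ⟨r, H, hr, hrH, hH, hgood⟩ := exists_block (by omega) hp h' h
    (ε := δ ^ (2 * Fintype.card (Fin d → ZMod 12))) (by positivity)
  refine ⟨r, H, hr, hrH, fun M => ?_⟩
  let E : Finset (Zd d) → Set (Config d) := fun Γ =>
    {ω | Γ.card ≤ 2 * {x | x ∈ Γ ∧ ω ∈ (GoodB (ctr r x) r H)ᶜ}.ncard}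
  let G : ℕ → Set (Config d) := fun k =>
    ⋃ v ∈ (Bx_finite (0 : Zd d) (k ^ M)).toFinset, ⋃ Γ ∈ (animal_finite v k).toFinset, E Γ
  have hE : ∀ Γ : Finset (Zd d), (bern fun _ => p).real (E Γ) ≤ (2 * δ) ^ Γ.card := fun Γ =>
    prob_half_le (fun _ => p) (fun x => (GoodB (ctr r x) r H)ᶜ) (fun x => Ed (Bx (ctr r x) H))
      (fun x => Ed_finite (Bx_finite _ _)) (fun x => (dep_GoodB _ _ _).compl)
      (fun x i => (x i : ZMod 12)) (fun x y hne hc => disjoint_Ed_ctr hH hne hc) hδ0.le hδ1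
      (fun x => hgood _) Γ
  have hG : ∀ k, (bern fun _ => p).real (G k) ≤ ((2 * (k ^ M : ℕ) + 1 : ℕ) : ℝ) ^ d * (1 / 2) ^ k := by
    intro k
    have hA : ∀ v : Zd d, (bern fun _ => p).real (⋃ Γ ∈ (animal_finite v k).toFinset, E Γ) ≤ (1 / 2) ^ k := by
      intro v
      refine (measureReal_biUnion_finset_le _ _).trans ?_
      have : ∀ Γ ∈ (animal_finite v k).toFinset, (bern fun _ => p).real (E Γ) ≤ (2 * δ) ^ k := by
        intro Γ hΓ
        rw [Set.Finite.mem_toFinset] at hΓ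
        have := hE Γ
        rwa [hΓ.2.1] at this
      refine (Finset.sum_le_sum this).trans ?_
      rw [Finset.sum_const, nsmul_eq_mul]
      have hc : ((animal_finite v k).toFinset.card : ℝ) ≤ (2 ^ 3 ^ d) ^ k := by
        exact_mod_cast card_le_of_animal _ fun Γ hΓ => (Set.Finite.mem_toFinset _).1 hΓ
      refine (mul_le_mul_of_nonneg_right hc (by positivity)).trans ?_
      rw [← mul_pow]
      refine pow_le_pow_left₀ (by positivity) (le_of_eq ?_) _
      rw [hδ]; field_simp; norm_num
    refine (measureReal_biUnion_finset_le _ _).trans ?_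
    refine (Finset.sum_le_sum fun v _ => hA v).trans ?_
    rw [Finset.sum_const, nsmul_eq_mul, ← Set.ncard_eq_toFinset_card _ (Bx_finite _ _), Bx_ncard]
    push_cast
    rfl
  have hsum : ∑' k, bern (fun _ => p) (G k) ≠ ∞ := by
    have hs := summable_box_geometric M d
    refine ne_top_of_le_ne_top hs.tsum_ofReal_ne_top ?_
    refine ENNReal.tsum_le_tsum fun k => ?_
    rw [← ofReal_measureReal (measure_ne_top _ _)]
    exact ENNReal.ofReal_le_ofReal (hG k)
  filter_upwards [ae_eventually_notMem hsum] with ω hω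
  obtain ⟨K, hK⟩ := Filter.eventually_atTop.1 hω
  refine ⟨K, fun k hk v hv Γ hΓ => ?_⟩
  by_contra hcon
  refine hK k hk (Set.mem_biUnion (x := v) ((Set.Finite.mem_toFinset _).2 hv)
    (Set.mem_biUnion (x := Γ) ((Set.Finite.mem_toFinset _).2 hΓ) ?_))
  change Γ.card ≤ _
  rw [hΓ.2.1]
  exact not_lt.1 hcon

end

section

/-! ### Coarse graining -/

variable {d : ℕ}

/-- The index of the cube at scale `r` containing `b`. -/
def idx (r : ℕ) (b : Zd d) : Zd d := fun i => (b i + r) / (2 * r + 1)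

lemma idx_eq_iff {r : ℕ} {b x : Zd d} : idx r b = x ↔ b ∈ Bx (ctr r x) r := by
  have hm : (0 : ℤ) < 2 * r + 1 := by positivity
  rw [mem_Bx, funext_iff]
  refine forall_congr' fun i => ?_
  rw [_root_.abs_le, idx, ctr, Int.ediv_eq_iff_of_pos hm]
  constructor
  · rintro ⟨h1, h2⟩; constructor <;> nlinarith
  · rintro ⟨h1, h2⟩; constructor <;> nlinarith

lemma idx_mem_Bx {r n : ℕ} {b : Zd d} (hb : b ∈ Bx 0 n) : idx r b ∈ Bx 0 n := by
  intro i
  have hm : (0 : ℤ) < 2 * r + 1 := by positivity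
  have h1 := _root_.abs_le.1 (hb i)
  have h2 := _root_.abs_le.1 ((idx_eq_iff (r := r) (b := b)).1 rfl i)
  simp only [ctr, Pi.zero_apply, sub_zero] at h1 h2 ⊢
  rw [_root_.abs_le]
  constructor
  · by_contra! h; nlinarith
  · by_contra! h; nlinarith

lemma idx_latAdj {r : ℕ} {a b : Zd d} (h : latAdj a b) : idx r a = idx r b ∨ latAdj (idx r a) (idx r b) := by
  have hm : (0 : ℤ) < 2 * r + 1 := by positivity
  have key : ∀ (a : Zd d) i, idx r (a + bas i) = idx r a ∨ idx r (a + bas i) = idx r a + bas i := by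
    intro a i
    have ho : ∀ j, j ≠ i → idx r (a + bas i) j = idx r a j := by
      intro j hj; simp [idx, bas_ne hj]
    have h1 := _root_.abs_le.1 ((idx_eq_iff (r := r) (b := a)).1 rfl i)
    have h2 := _root_.abs_le.1 ((idx_eq_iff (r := r) (b := a + bas i)).1 rfl i)
    simp only [ctr, Pi.add_apply, bas_same] at h1 h2
    have h3 : idx r a i ≤ idx r (a + bas i) i := by by_contra! h; nlinarith
    have h4 : idx r (a + bas i) i ≤ idx r a i + 1 := by by_contra! h; nlinarith
    rcases h3.eq_or_lt with h5 | h5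
    · left; funext j
      by_cases hj : j = i
      · rw [hj]; exact h5.symm
      · exact ho j hj
    · right; funext j
      by_cases hj : j = i
      · rw [hj, Pi.add_apply, bas_same]; omega
      · rw [ho j hj, Pi.add_apply, bas_ne hj, add_zero]
  obtain ⟨i, hi | hi⟩ := latAdj_iff.1 h
  · subst hi
    rcases key a i with h | h
    · exact .inl h.symm
    · right; rw [h]; exact latAdj_add_bas _ _
  · subst hi
    rcases key b i with h | h
    · exact .inl h
    · right; rw [h]; exact (latAdj_add_bas _ _).symm

lemma bdry_finite {ω : Config d} {B : Set (Zd d)} (hB : B.Finite) : (bdry ω B).Finite := by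
  refine Set.Finite.subset (hB.biUnion fun x _ => (Set.finite_singleton x).prod (Bx_finite x 1)) ?_
  rintro ⟨x, y⟩ ⟨h, hx, -⟩
  exact Set.mem_biUnion hx ⟨rfl, h.1.mem_Bx⟩

/-- An infinite cluster leaves every box through its faces. -/
lemma exists_conn_face {ω : Config d} (hinf : (cluster ω).Infinite) {b c : Zd d} (hb : b ∈ cluster ω) {H : ℕ}
    (hbH : b ∈ Bx c H) : ∃ y, (∃ i, |y i - c i| = H) ∧ Conn ω (Bx c H) b y := by
  obtain ⟨w, hw, hwH⟩ := hinf.exists_notMem_finite (Bx_finite c H)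
  have hbw := (mem_cluster_iff.1 hb).symm.trans (mem_cluster_iff.1 hw)
  obtain ⟨u, v, hu, huv, -, hv⟩ := hbw.exists_exit hbH hwH
  rw [Set.univ_inter] at hu
  refine ⟨u, ?_, hu⟩
  simp only [mem_Bx, not_forall, not_le] at hv
  obtain ⟨i, hi⟩ := hv
  refine ⟨i, ?_⟩
  have h1 := hu.mem_right i
  have h2 := huv.1.abs_le i
  refine le_antisymm h1 ?_
  have h3 : |v i - c i| ≤ |u i - v i| + |u i - c i| := by
    rw [abs_sub_comm (u i)]; exact abs_sub_le _ _ _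
  omega

/-- A good block on the outer boundary of a set carries an open boundary edge. -/
lemma exists_bdry_of_good {ω : Config d} (hinf : (cluster ω).Infinite) {B : Set (Zd d)} (hB : B ⊆ cluster ω)
    {r H : ℕ} (hrH : 3 * r + 1 ≤ H) {x y : Zd d} (hxy : latAdj x y) (hy : y ∈ idx r '' B)
    (hx : x ∉ idx r '' B) (hgood : ω ∈ GoodB (ctr r x) r H) :
    ∃ u ∈ Bx (ctr r x) H, ∃ v, (u, v) ∈ bdry ω B := by
  obtain ⟨b, hb, hby⟩ := hy
  have hb3 : b ∈ Bx (ctr r x) (3 * r + 1) := by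
    intro i
    have h1 := _root_.abs_le.1 (idx_eq_iff.1 hby i)
    have h2 := _root_.abs_le.1 (hxy.abs_le i)
    simp only [ctr] at h1 ⊢
    rw [_root_.abs_le]
    push_cast
    constructor <;> nlinarith
  obtain ⟨z, hz, hbz⟩ := hgood b hb3 (exists_conn_face hinf (hB hb) (Bx_mono _ hrH hb3))
  have hzB : z ∉ B := fun h => hx ⟨z, h, idx_eq_iff.2 hz⟩
  obtain ⟨u, v, hu, huv, -, hv⟩ := hbz.exists_exit hb hzB
  exact ⟨u, hu.mem_right.1, v, huv, hu.mem_right.2, hv⟩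

lemma exists_animal_of_conn (hd : 2 ≤ d) {ω : Config d} (hinf : (cluster ω).Infinite) {B : Set (Zd d)} {n r H : ℕ}
    (hB : B ⊆ cluster ω) (hBn : B ⊆ Bx 0 n) (hne : B.Nonempty) (hconn : ∀ x ∈ B, ∀ y ∈ B, Conn ω B x y)
    (hrH : 3 * r + 1 ≤ H) :
    ∃ k, ∃ v ∈ Bx 0 (n + 1), ∃ Γ ∈ Animal v k, B.ncard ^ (d - 1) ≤ ((2 * r + 1) ^ d) ^ (d - 1) * k ^ d ∧
      k ≤ {x : Zd d | x ∈ Γ ∧ ω ∉ GoodB (ctr r x) r H}.ncard + (2 * H + 1) ^ d * (bdry ω B).ncard := by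
  classical
  have hBfin : B.Finite := (Bx_finite _ _).subset hBn
  set A := idx r '' B with hA
  have hAfin : A.Finite := hBfin.image _
  have hAn : A ⊆ Bx 0 n := by rintro _ ⟨b, hb, rfl⟩; exact idx_mem_Bx (hBn hb)
  have hAconn : ∀ x ∈ A, ∀ y ∈ A, Conn (fun _ => true) A x y := by
    rintro _ ⟨a, ha, rfl⟩ _ ⟨b, hb, rfl⟩
    refine (hconn a ha b hb).induct (P := fun b => Conn (fun _ => true) A (idx r a) (idx r b))
      (.refl ⟨a, ha, rfl⟩) ?_
    intro u v _ ih huv hv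
    rcases idx_latAdj (r := r) huv.1 with h | h
    · rwa [← h]
    · exact ih.tail ⟨h, rfl⟩ ⟨v, hv, rfl⟩
  obtain ⟨D, hAD, hDn, hDc, hDc', hbd⟩ := exists_outer hd hAn hAconn (hne.image _)
  have hDfin : Dᶜ.Finite := (Bx_finite _ _).subset (Set.compl_subset_comm.1 hDn)
  have hΓfin : (inBd D).Finite := by
    refine Set.Finite.subset (hAfin.biUnion fun y _ => Bx_finite y 1) fun x hx => ?_
    obtain ⟨y, hy, hxy⟩ := hbd x hx
    exact Set.mem_biUnion hy hxy.symm.mem_Bx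
  have hiso := lattice_isoperimetry hd hDfin
  have hcardB : B.ncard ≤ (2 * r + 1) ^ d * Dᶜ.ncard := by
    refine le_trans ?_ (Nat.mul_le_mul_left _ (Set.ncard_le_ncard hAD hDfin))
    have hAc : A.ncard = (hBfin.toFinset.image (idx r)).card := by
      rw [← Set.ncard_coe_finset, Finset.coe_image, Set.Finite.coe_toFinset]
    rw [Set.ncard_eq_toFinset_card _ hBfin, hAc]
    refine Finset.card_le_mul_card_image _ ((2 * r + 1) ^ d) ?_
    intro a _
    rw [← Bx_ncard (ctr r a) r, Set.ncard_eq_toFinset_card _ (Bx_finite _ _)]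
    refine Finset.card_le_card fun z hz => ?_
    rw [Set.Finite.mem_toFinset, ← idx_eq_iff]
    exact (Finset.mem_filter.1 hz).2
  have hΓne : (inBd D).Nonempty := by
    by_contra h
    rw [Set.not_nonempty_iff_eq_empty] at h
    rw [h, Set.ncard_empty, zero_pow (by omega)] at hiso
    obtain ⟨b, hb⟩ := hne
    have : 0 < Dᶜ.ncard := (Set.ncard_pos hDfin).2 ⟨_, hAD ⟨b, hb, rfl⟩⟩
    have := pow_pos this (d - 1)
    omega
  obtain ⟨v, hv⟩ := hΓne
  have hmem : ∀ x ∈ inBd D, x ∈ Bx 0 (n + 1) := by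
    intro x hx
    obtain ⟨y, hy, hxy⟩ := hbd x hx
    exact hxy.symm.mem_Bx_succ (hAn hy)
  refine ⟨(inBd D).ncard, v, hmem v hv, hΓfin.toFinset, ⟨?_, ?_, ?_⟩, ?_, ?_⟩
  · rwa [Set.Finite.mem_toFinset]
  · rw [Set.ncard_eq_toFinset_card _ hΓfin]
  · rw [Set.Finite.coe_toFinset]; exact starConn_inBd hDc hDc'
  · calc B.ncard ^ (d - 1) ≤ ((2 * r + 1) ^ d * Dᶜ.ncard) ^ (d - 1) := Nat.pow_le_pow_left hcardB _
      _ = ((2 * r + 1) ^ d) ^ (d - 1) * Dᶜ.ncard ^ (d - 1) := mul_pow _ _ _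
      _ ≤ _ := Nat.mul_le_mul_left _ hiso
  · set Γ := hΓfin.toFinset with hΓ
    set good := Γ.filter fun x => ω ∈ GoodB (ctr r x) r H with hgood
    set bad := Γ.filter fun x => ω ∉ GoodB (ctr r x) r H with hbad
    have hbadc : {x : Zd d | x ∈ Γ ∧ ω ∉ GoodB (ctr r x) r H}.ncard = bad.card := by
      rw [← Set.ncard_coe_finset]; congr 1; ext x; simp [hbad]
    have hsplit : Γ.card = good.card + bad.card := (Finset.card_filter_add_card_filter_not _).symm
    rw [hbadc, Set.ncard_eq_toFinset_card _ hΓfin, ← hΓ, hsplit, add_comm]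
    refine Nat.add_le_add_left ?_ _
    have hch : ∀ x ∈ good, ∃ u ∈ Bx (ctr r x) H, ∃ v, (u, v) ∈ bdry ω B := by
      intro x hx
      rw [hgood, Finset.mem_filter, hΓ, Set.Finite.mem_toFinset] at hx
      obtain ⟨y, hy, hxy⟩ := hbd x hx.1
      exact exists_bdry_of_good hinf hB hrH hxy hy (fun h => hAD h hx.1.1) hx.2
    choose! f hf1 hf2 using hch
    have hbf := bdry_finite (ω := ω) hBfin
    calc good.card ≤ (2 * H + 1) ^ d * (good.image f).card := by
          refine Finset.card_le_mul_card_image _ _ fun u _ => ?_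
          rw [← Bx_ncard u H, Set.ncard_eq_toFinset_card _ (Bx_finite _ _)]
          refine Finset.card_le_card_of_injOn (ctr r) ?_ ?_
          · intro x hx
            rw [Finset.mem_coe, Finset.mem_filter] at hx
            rw [Finset.mem_coe, Set.Finite.mem_toFinset]
            intro i
            have := hf1 x hx.1 i
            rw [hx.2] at this
            rwa [abs_sub_comm]
          · intro x _ y _ hxy
            funext i
            have := congrFun hxy i
            simp only [ctr] at this
            exact mul_left_cancel₀ (by positivity) this
      _ ≤ (2 * H + 1) ^ d * (bdry ω B).ncard := by
          refine Nat.mul_le_mul_left _ ?_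
          rw [Set.ncard_eq_toFinset_card _ hbf]
          refine (Finset.card_le_card (t := hbf.toFinset.image Prod.fst) ?_).trans Finset.card_image_le
          intro u hu
          obtain ⟨x, hx, rfl⟩ := Finset.mem_image.1 hu
          obtain ⟨v, hv⟩ := hf2 x hx
          exact Finset.mem_image.2 ⟨_, (Set.Finite.mem_toFinset _).2 hv, rfl⟩

end

section

/-! ### The isoperimetric inequality -/

variable {d : ℕ}

/-- The isoperimetric inequality for connected subsets of the infinite cluster. -/
theorem isoperimetry_of_conn (hd : 2 ≤ d) {p' p : unitInterval} (hp : (p' : ℝ) < p)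
    (h' : bern (fun _ => p') {ω : Config d | (cluster ω).Infinite} ≠ 0)
    (h : bern (fun _ => p) {ω : Config d | (cluster ω).Infinite} ≠ 0) :
    ∃ C : ℕ, 0 < C ∧ ∀ m : ℕ, ∀ᵐ ω : Config d ∂bern fun _ => p, (cluster ω).Infinite →
      ∃ N : ℕ, ∀ n ≥ N, ∀ B : Set (Zd d), B ⊆ cluster ω → B ⊆ Bx 0 n → B.Nonempty →
        (∀ x ∈ B, ∀ y ∈ B, Conn ω B x y) → n ≤ B.ncard ^ m →
        B.ncard ^ (d - 1) ≤ C * (bdry ω B).ncard ^ d := by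
  obtain ⟨r, H, hr, hrH, hgood⟩ := exists_good_scale hd hp h' h
  set R := ((2 * r + 1) ^ d) ^ (d - 1) with hR
  refine ⟨R * (2 * (2 * H + 1) ^ d) ^ d, by positivity, fun m => ?_⟩
  filter_upwards [hgood (d * m + 1)] with ω hω hinf
  obtain ⟨K, hK⟩ := hω
  set K' := max K (R ^ m + 1) with hK'
  refine ⟨R ^ m * K' ^ (d * m) + 1, fun n hn B hB hBn hne hconn hnB => ?_⟩
  obtain ⟨k, v, hv, Γ, hΓ, hBk, hk⟩ := exists_animal_of_conn hd hinf hB hBn hne hconn hrH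
  rw [← hR] at hBk
  have hnk : n ≤ R ^ m * k ^ (d * m) := by
    refine hnB.trans ?_
    have h1 : B.ncard ≤ B.ncard ^ (d - 1) := Nat.le_self_pow (by omega) _
    calc B.ncard ^ m ≤ (R * k ^ d) ^ m := Nat.pow_le_pow_left (h1.trans hBk) _
      _ = R ^ m * k ^ (d * m) := by rw [mul_pow, pow_mul k d m]
  have hkK : K' ≤ k := by
    by_contra! hlt
    have : R ^ m * k ^ (d * m) ≤ R ^ m * K' ^ (d * m) :=
      Nat.mul_le_mul_left _ (Nat.pow_le_pow_left hlt.le _)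
    omega
  have hkR : R ^ m + 1 ≤ k := (le_max_right _ _).trans hkK
  have hn1 : n + 1 ≤ k ^ (d * m + 1) := by
    have h1 : 1 ≤ k ^ (d * m) := Nat.one_le_pow _ _ (by omega)
    calc n + 1 ≤ R ^ m * k ^ (d * m) + k ^ (d * m) := by omega
      _ = (R ^ m + 1) * k ^ (d * m) := by ring
      _ ≤ k * k ^ (d * m) := Nat.mul_le_mul_right _ hkR
      _ = _ := (pow_succ' _ _).symm
  have hbad := hK k ((le_max_left _ _).trans hkK) v (Bx_mono _ hn1 hv) Γ hΓ
  have hkb : k ≤ 2 * (2 * H + 1) ^ d * (bdry ω B).ncard := by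
    rw [mul_assoc]; omega
  calc B.ncard ^ (d - 1) ≤ R * k ^ d := hBk
    _ ≤ R * (2 * (2 * H + 1) ^ d * (bdry ω B).ncard) ^ d :=
      Nat.mul_le_mul_left _ (Nat.pow_le_pow_left hkb _)
    _ = _ := by rw [mul_pow, mul_assoc]

end

section

/-! ### Flux through superlevel sets -/

variable {d : ℕ}

lemma openAdj_finite (ω : Config d) (x : Zd d) : {y | openAdj ω x y}.Finite :=
  (Bx_finite x 1).subset fun _ hy => hy.1.mem_Bx

/-- The open neighbours of a vertex. -/
noncomputable def nbr (ω : Config d) (x : Zd d) : Finset (Zd d) := (openAdj_finite ω x).toFinset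

lemma mem_nbr {ω : Config d} {x y : Zd d} : y ∈ nbr ω x ↔ openAdj ω x y := Set.Finite.mem_toFinset _

lemma card_nbr (ω : Config d) (x : Zd d) : (nbr ω x).card = nu ω x :=
  (Set.ncard_eq_toFinset_card _ _).symm

lemma card_nbr_le (ω : Config d) (x : Zd d) : (nbr ω x).card ≤ 3 ^ d := by
  have h := Set.ncard_le_ncard (s := {y | openAdj ω x y}) (fun _ hy => hy.1.mem_Bx) (Bx_finite x 1)
  rw [Bx_ncard] at h
  rw [card_nbr]; exact h

/-- The transition operator of the walk. -/
noncomputable def avg (ω : Config d) (f : Zd d → ℝ) (x : Zd d) : ℝ :=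
  (nu ω x : ℝ)⁻¹ * ∑ y ∈ nbr ω x, f y

lemma avg_mono {ω : Config d} {f g : Zd d → ℝ} {x : Zd d} (h : ∀ y, openAdj ω x y → f y ≤ g y) :
    avg ω f x ≤ avg ω g x :=
  mul_le_mul_of_nonneg_left (Finset.sum_le_sum fun y hy => h y (mem_nbr.1 hy)) (by positivity)

lemma avg_nonneg {ω : Config d} {f : Zd d → ℝ} {x : Zd d} (h : ∀ y, 0 ≤ f y) : 0 ≤ avg ω f x :=
  mul_nonneg (by positivity) (Finset.sum_nonneg fun y _ => h y)

lemma avg_add {ω : Config d} (f g : Zd d → ℝ) (x : Zd d) :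
    avg ω (fun y => f y + g y) x = avg ω f x + avg ω g x := by
  simp only [avg, Finset.sum_add_distrib, mul_add]

lemma avg_const_mul {ω : Config d} (c : ℝ) (f : Zd d → ℝ) (x : Zd d) :
    avg ω (fun y => c * f y) x = c * avg ω f x := by
  simp only [avg, ← Finset.mul_sum]; ring

lemma avg_const_le {ω : Config d} {c : ℝ} (hc : 0 ≤ c) (x : Zd d) : avg ω (fun _ => c) x ≤ c := by
  rw [avg, Finset.sum_const, card_nbr, nsmul_eq_mul, ← mul_assoc]
  exact mul_le_of_le_one_left hc (inv_mul_le_one)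

lemma avg_sum {ι : Type*} {ω : Config d} (s : Finset ι) (f : ι → Zd d → ℝ) (x : Zd d) :
    avg ω (fun y => ∑ i ∈ s, f i y) x = ∑ i ∈ s, avg ω (f i) x := by
  simp only [avg]
  rw [Finset.sum_comm, Finset.mul_sum]

/-- The flux through the boundary of a superlevel set. -/
lemma flux_le {ω : Config d} {h : Zd d → ℝ} {B : Finset (Zd d)} (hB : ∀ x ∈ B, h x ≤ 1 + avg ω h x) :
    ∑ e ∈ (bdry_finite (ω := ω) B.finite_toSet).toFinset, (h e.1 - h e.2) ≤ 3 ^ d * B.card := by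
  classical
  have h1 : ∀ x ∈ B, ∑ y ∈ nbr ω x, (h x - h y) ≤ 3 ^ d := by
    intro x hx
    rcases (nbr ω x).eq_empty_or_nonempty with he | hne
    · rw [he, Finset.sum_empty]; positivity
    have hc : (0 : ℝ) < (nbr ω x).card := by exact_mod_cast hne.card_pos
    have h2 := hB x hx
    rw [avg, ← card_nbr, inv_mul_eq_div] at h2
    rw [Finset.sum_sub_distrib, Finset.sum_const, nsmul_eq_mul]
    have h3 : (nbr ω x).card * h x ≤ (nbr ω x).card + ∑ y ∈ nbr ω x, h y := by
      calc _ ≤ (nbr ω x).card * (1 + (∑ y ∈ nbr ω x, h y) / (nbr ω x).card) :=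
            mul_le_mul_of_nonneg_left h2 hc.le
        _ = _ := by field_simp
    have h4 : ((nbr ω x).card : ℝ) ≤ 3 ^ d := by exact_mod_cast card_nbr_le ω x
    linarith
  have h2 : ∑ x ∈ B, ∑ y ∈ nbr ω x, (h x - h y) ≤ 3 ^ d * B.card := by
    refine (Finset.sum_le_sum h1).trans (le_of_eq ?_)
    rw [Finset.sum_const, nsmul_eq_mul, mul_comm]
  have h3 : ∑ x ∈ B, ∑ y ∈ (nbr ω x).filter (· ∈ B), (h x - h y) = 0 := by
    have h4 : ∀ f : Zd d → Zd d → ℝ, ∑ x ∈ B, ∑ y ∈ (nbr ω x).filter (· ∈ B), f x y =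
        ∑ x ∈ B, ∑ y ∈ B, if openAdj ω x y then f x y else 0 := by
      intro f
      refine Finset.sum_congr rfl fun x _ => ?_
      rw [← Finset.sum_filter]
      refine Finset.sum_congr ?_ fun _ _ => rfl
      ext y; simp only [Finset.mem_filter, mem_nbr]; exact and_comm
    have h5 := h4 fun x y => h x - h y
    have h6 : ∑ x ∈ B, ∑ y ∈ B, (if openAdj ω x y then h x - h y else 0) =
        -∑ x ∈ B, ∑ y ∈ B, (if openAdj ω x y then h x - h y else 0) := by
      conv_lhs => rw [Finset.sum_comm]
      rw [← Finset.sum_neg_distrib]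
      refine Finset.sum_congr rfl fun x _ => ?_
      rw [← Finset.sum_neg_distrib]
      refine Finset.sum_congr rfl fun y _ => ?_
      have : openAdj ω y x ↔ openAdj ω x y := ⟨fun h => h.symm, fun h => h.symm⟩
      simp only [this]
      split_ifs <;> ring
    linarith
  have h4 : ∑ e ∈ (bdry_finite (ω := ω) B.finite_toSet).toFinset, (h e.1 - h e.2) =
      ∑ x ∈ B, ∑ y ∈ (nbr ω x).filter (· ∉ B), (h x - h y) := by
    rw [Finset.sum_sigma' B fun x => (nbr ω x).filter (· ∉ B)]
    refine Finset.sum_bij' (fun e _ => ⟨e.1, e.2⟩) (fun e _ => (e.1, e.2)) ?_ ?_ ?_ ?_ ?_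
    · rintro ⟨x, y⟩ he
      obtain ⟨h, hx, hy⟩ := (Set.Finite.mem_toFinset _).1 he
      simp only [Finset.mem_sigma, Finset.mem_filter, mem_nbr]
      exact ⟨hx, h, hy⟩
    · rintro ⟨x, y⟩ he
      simp only [Finset.mem_sigma, Finset.mem_filter, mem_nbr] at he
      rw [Set.Finite.mem_toFinset]
      exact ⟨he.2.1, he.1, he.2.2⟩
    · intro _ _; rfl
    · intro _ _; rfl
    · intro _ _; rfl
  rw [h4]
  have h5 : ∀ x ∈ B, ∑ y ∈ (nbr ω x).filter (· ∈ B), (h x - h y) +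
      ∑ y ∈ (nbr ω x).filter (· ∉ B), (h x - h y) = ∑ y ∈ nbr ω x, (h x - h y) := fun x _ =>
    Finset.sum_filter_add_sum_filter_not _ _ _
  rw [← Finset.sum_congr rfl h5, Finset.sum_add_distrib, h3, zero_add] at h2
  exact h2

open Classical in
/-- Growth of the superlevel sets of a function with bounded Laplacian. -/
lemma superlevel_growth {ω : Config d} {h : Zd d → ℝ} {S : Finset (Zd d)} (h0 : ∀ x ∉ S, h x ≤ 0)
    (hS : ∀ x ∈ S, h x ≤ 1 + avg ω h x) {s D : ℝ} (hD : 0 < D) (hs : D ≤ s)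
    (hDB : 2 * 3 ^ d * ((S.filter fun x => s < h x).card : ℝ) ≤
      D * (bdry ω (S.filter fun x => s < h x : Finset (Zd d))).ncard) :
    ((bdry ω (S.filter fun x => s < h x : Finset (Zd d))).ncard : ℝ) ≤
      2 * 3 ^ d * (((S.filter fun x => s - D < h x).card : ℝ) - (S.filter fun x => s < h x).card) := by
  set B := S.filter fun x => s < h x with hB
  set B' := S.filter fun x => s - D < h x with hB'
  set E := (bdry_finite (ω := ω) B.finite_toSet).toFinset with hE
  have hEc : (bdry ω (B : Set (Zd d))).ncard = E.card := Set.ncard_eq_toFinset_card _ _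
  rw [hEc] at hDB ⊢
  have hmem : ∀ e ∈ E, openAdj ω e.1 e.2 ∧ e.1 ∈ B ∧ e.2 ∉ B := fun e he =>
    (bdry_finite (ω := ω) B.finite_toSet).mem_toFinset.1 he
  have hflux := flux_le (ω := ω) (B := B) (h := h) fun x hx => hS x (Finset.mem_filter.1 hx).1
  rw [← hE] at hflux
  have hpos : ∀ e ∈ E, 0 ≤ h e.1 - h e.2 := by
    intro e he
    obtain ⟨-, h1, h2⟩ := hmem e he
    have h3 := (Finset.mem_filter.1 h1).2
    by_cases h4 : e.2 ∈ S
    · have : ¬ s < h e.2 := fun h5 => h2 (Finset.mem_filter.2 ⟨h4, h5⟩)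
      linarith
    · linarith [h0 _ h4]
  have hfar : D * ((E.filter fun e => ¬ h e.1 - h e.2 < D).card : ℝ) ≤ 3 ^ d * B.card := by
    refine le_trans ?_ hflux
    refine le_trans ?_ (Finset.sum_le_sum_of_subset_of_nonneg
      (Finset.filter_subset (fun e => ¬ h e.1 - h e.2 < D) E) fun e he _ => hpos e he)
    rw [mul_comm, ← nsmul_eq_mul]
    exact Finset.card_nsmul_le_sum _ _ _ fun e he => not_lt.1 (Finset.mem_filter.1 he).2
  have hnear : (E.filter fun e => h e.1 - h e.2 < D).card ≤ 3 ^ d * (B' \ B).card := by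
    refine (Finset.card_le_mul_card_image (f := Prod.snd) _ (3 ^ d) ?_).trans
      (Nat.mul_le_mul_left _ (Finset.card_le_card ?_))
    · intro y _
      refine le_trans ?_ (card_nbr_le ω y)
      refine Finset.card_le_card_of_injOn Prod.fst ?_ ?_
      · intro e he
        rw [Finset.mem_coe, Finset.mem_filter, Finset.mem_filter] at he
        rw [Finset.mem_coe, mem_nbr, ← he.2]
        exact (hmem e he.1.1).1.symm
      · intro e he e' he' hee
        rw [Finset.mem_coe, Finset.mem_filter] at he he'
        exact Prod.ext hee (he.2.trans he'.2.symm)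
    · intro y hy
      obtain ⟨e, he, rfl⟩ := Finset.mem_image.1 hy
      rw [Finset.mem_filter] at he
      obtain ⟨-, h1, h2⟩ := hmem e he.1
      have h3 := (Finset.mem_filter.1 h1).2
      have h4 : s - D < h e.2 := by linarith [he.2]
      have h5 : e.2 ∈ S := by_contra fun h5 => by linarith [h0 _ h5]
      exact Finset.mem_sdiff.2 ⟨Finset.mem_filter.2 ⟨h5, h4⟩, h2⟩
  have hsub : B ⊆ B' := by
    intro x hx
    rw [hB, Finset.mem_filter] at hx
    exact Finset.mem_filter.2 ⟨hx.1, by linarith [hx.2]⟩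
  have hsd : ((B' \ B).card : ℝ) = B'.card - B.card := by
    rw [Finset.card_sdiff_of_subset hsub, Nat.cast_sub (Finset.card_le_card hsub)]
  have hsplit : ((E.filter fun e => h e.1 - h e.2 < D).card : ℝ) +
      (E.filter fun e => ¬ h e.1 - h e.2 < D).card = E.card := by
    exact_mod_cast Finset.card_filter_add_card_filter_not (s := E) _
  have hnear' : ((E.filter fun e => h e.1 - h e.2 < D).card : ℝ) ≤ 3 ^ d * (B'.card - B.card) := by
    rw [← hsd]; exact_mod_cast hnear
  have : D * ((E.filter fun e => ¬ h e.1 - h e.2 < D).card : ℝ) ≤ D * (E.card / 2) := by linarith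
  have := le_of_mul_le_mul_left this hD
  linarith

end

section

/-! ### The torsion function -/

variable {d : ℕ}

/-- The isoperimetric scale of sets of volume `V`. -/
noncomputable def scale (d : ℕ) (ℓ V : ℝ) : ℝ := (ℓ ^ d * V) ^ (1 / (2 * d) : ℝ)

lemma scale_pow (hd : 0 < d) {ℓ V : ℝ} (hℓ : 0 ≤ ℓ) (hV : 0 ≤ V) : scale d ℓ V ^ (2 * d) = ℓ ^ d * V := by
  rw [scale, ← Real.rpow_natCast, ← Real.rpow_mul (by positivity)]
  have : (d : ℝ) ≠ 0 := by exact_mod_cast hd.ne'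
  rw [show (1 / (2 * d) : ℝ) * ((2 * d : ℕ) : ℝ) = 1 by push_cast; field_simp, Real.rpow_one]

lemma scale_nonneg {ℓ V : ℝ} (hℓ : 0 ≤ ℓ) (hV : 0 ≤ V) : 0 ≤ scale d ℓ V :=
  Real.rpow_nonneg (by positivity) _

lemma one_le_scale {ℓ V : ℝ} (hℓ : 1 ≤ ℓ) (hV : 1 ≤ V) : 1 ≤ scale d ℓ V :=
  Real.one_le_rpow (one_le_mul_of_one_le_of_one_le (one_le_pow₀ hℓ) hV) (by positivity)

lemma scale_le (hd : 0 < d) {ℓ V : ℝ} (hℓ : 0 ≤ ℓ) (hV : 0 ≤ V) (h : V ≤ ℓ ^ d) : scale d ℓ V ≤ ℓ := by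
  refine le_of_pow_le_pow_left₀ (n := 2 * d) (by omega) hℓ ?_
  rw [scale_pow hd hℓ hV, two_mul, pow_add]
  exact mul_le_mul_of_nonneg_left h (by positivity)

lemma scale_growth (hd : 0 < d) {ℓ V W ε : ℝ} (hℓ : 1 ≤ ℓ) (hV : 1 ≤ V) (hε0 : 0 ≤ ε) (hε1 : ε ≤ 1)
    (hVW : V * (1 + ε) ≤ W) : scale d ℓ V ^ 2 * (1 + ε / (2 * d)) ≤ scale d ℓ W ^ 2 := by
  have hd' : (1 : ℝ) ≤ d := by exact_mod_cast hd
  set t : ℝ := ε / (4 * d) with ht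
  have ht0 : 0 ≤ t := by positivity
  have h1 : (1 + t) ^ (2 * d) ≤ 1 + ε := by
    have ht1 : 2 * d * t = ε / 2 := by rw [ht]; field_simp; ring
    have ht2 : t ≤ 1 := by nlinarith
    have h2 : 1 + ((2 * d : ℕ) : ℝ) * (-t) ≤ (1 + -t) ^ (2 * d) :=
      one_add_mul_le_pow (by linarith) _
    push_cast at h2
    have h3 : (1 + t) ^ (2 * d) * (1 + -t) ^ (2 * d) ≤ 1 := by
      rw [← mul_pow]
      exact pow_le_one₀ (by nlinarith) (by nlinarith)
    have h4 : 0 ≤ (1 + t) ^ (2 * d) := by positivity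
    have h5 : (1 + t) ^ (2 * d) * (1 - ε / 2) ≤ 1 :=
      (mul_le_mul_of_nonneg_left (by linarith) h4).trans h3
    nlinarith
  have h2 : scale d ℓ V * (1 + t) ≤ scale d ℓ W := by
    refine le_of_pow_le_pow_left₀ (n := 2 * d) (by omega) (scale_nonneg (by linarith) (by nlinarith)) ?_
    rw [mul_pow, scale_pow hd (by linarith) (by linarith), scale_pow hd (by linarith) (by nlinarith), mul_assoc]
    refine mul_le_mul_of_nonneg_left ?_ (by positivity)
    exact (mul_le_mul_of_nonneg_left h1 (by linarith)).trans hVW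
  have h0 : 0 ≤ scale d ℓ V := scale_nonneg (by linarith) (by linarith)
  have h3 := pow_le_pow_left₀ (by positivity) h2 2
  have h4 : ε / (2 * d) = 2 * t := by rw [ht]; field_simp; norm_num
  rw [h4]
  rw [mul_pow] at h3
  refine le_trans (mul_le_mul_of_nonneg_left ?_ (by positivity)) h3
  nlinarith

open Classical in
/-- Functions with bounded Laplacian on a small set are bounded. -/
lemma torsion_bound (hd : 0 < d) {ω : Config d} {h : Zd d → ℝ} {S : Finset (Zd d)} (h0 : ∀ x ∉ S, h x ≤ 0)
    (hS : ∀ x ∈ S, h x ≤ 1 + avg ω h x) {K ℓ : ℝ} (hK : 1 ≤ K) (hℓ : 1 ≤ ℓ) (hSℓ : (S.card : ℝ) ≤ ℓ ^ d)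
    (hiso : ∀ B ⊆ S, B.Nonempty → (B.card : ℝ) ≤ K * scale d ℓ B.card * (bdry ω (B : Set (Zd d))).ncard)
    (x : Zd d) : h x ≤ (8 * d * (3 ^ d) ^ 2 * K ^ 2 + 2 * 3 ^ d * K) * ℓ ^ 2 := by
  have hd' : (1 : ℝ) ≤ d := by exact_mod_cast hd
  set Q : ℝ := 3 ^ d with hQ
  have hQ1 : 1 ≤ Q := one_le_pow₀ (by norm_num)
  set C : ℝ := 8 * d * Q ^ 2 * K ^ 2 with hC
  have hC0 : 0 < C := by positivity
  set V : ℝ → ℕ := fun s => (S.filter fun x => s < h x).card with hV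
  have key : ∀ m : ℕ, ∀ s : ℝ, 0 ≤ s → S.card - V s < m → 1 ≤ V s →
      s ≤ C * (ℓ ^ 2 - scale d ℓ (V s) ^ 2) + 2 * Q * K * ℓ := by
    intro m
    induction m with
    | zero => intro s _ hm; omega
    | succ m ih =>
      intro s hs hm hVs
      have hVs' : (1 : ℝ) ≤ V s := by exact_mod_cast hVs
      have hVS : V s ≤ S.card := Finset.card_filter_le _ _
      have hρ1 := one_le_scale (d := d) hℓ hVs'
      have hρℓ : scale d ℓ (V s) ≤ ℓ := scale_le hd (by linarith) (by linarith)
        (le_trans (by exact_mod_cast hVS) hSℓ)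
      set ρ := scale d ℓ (V s) with hρ
      set D := 2 * Q * K * ρ with hD
      have hQK : 1 ≤ Q * K := one_le_mul_of_one_le_of_one_le hQ1 hK
      have hD1 : 1 ≤ D := by
        have := one_le_mul_of_one_le_of_one_le hQK hρ1
        rw [hD]; nlinarith
      have hDℓ : D ≤ 2 * Q * K * ℓ := mul_le_mul_of_nonneg_left hρℓ (by positivity)
      by_cases hsD : s < D
      · have : ρ ^ 2 ≤ ℓ ^ 2 := pow_le_pow_left₀ (by linarith) hρℓ 2
        have : 0 ≤ C * (ℓ ^ 2 - ρ ^ 2) := mul_nonneg hC0.le (by linarith)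
        linarith
      push Not at hsD
      have hne : (S.filter fun x => s < h x).Nonempty := Finset.card_pos.1 hVs
      have hi := hiso _ (Finset.filter_subset _ _) hne
      have hi' : (V s : ℝ) ≤ K * ρ * (bdry ω (S.filter fun x => s < h x : Finset (Zd d))).ncard := hi
      have hg := superlevel_growth h0 hS (by linarith) hsD
        (by
          calc 2 * 3 ^ d * ((S.filter fun x => s < h x).card : ℝ) ≤
              2 * Q * (K * ρ * (bdry ω (S.filter fun x => s < h x : Finset (Zd d))).ncard) :=
                mul_le_mul_of_nonneg_left hi' (by positivity)
            _ = _ := by rw [hD]; ring)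
      have hg' : (V s : ℝ) ≤ D * ((V (s - D) : ℝ) - V s) := by
        calc (V s : ℝ) ≤ K * ρ * (2 * Q * ((V (s - D) : ℝ) - V s)) :=
              hi'.trans (mul_le_mul_of_nonneg_left hg (by positivity))
          _ = _ := by rw [hD]; ring
      have hgrow : (V s : ℝ) * (1 + 1 / D) ≤ V (s - D) := by
        rw [mul_add, mul_one, mul_one_div]
        have := (div_le_iff₀' (by linarith : (0:ℝ) < D)).2 hg'
        linarith
      have hlt : V s < V (s - D) := by
        have : (V s : ℝ) < V (s - D) := by
          refine lt_of_lt_of_le ?_ hgrow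
          have : (0 : ℝ) < 1 / D := by positivity
          nlinarith
        exact_mod_cast this
      have hVS' : V (s - D) ≤ S.card := Finset.card_filter_le _ _
      have hih := ih (s - D) (by linarith) (by omega) (by omega)
      have hsg := scale_growth hd hℓ hVs' (by positivity) ((div_le_one (by linarith)).2 hD1) hgrow
      rw [← hρ] at hsg
      have hgain : C * (ρ ^ 2 * (1 + 1 / D / (2 * d))) = C * ρ ^ 2 + D := by
        rw [hC, hD]; field_simp; ring
      have := mul_le_mul_of_nonneg_left hsg hC0.le
      nlinarith
  by_contra! hlt
  set s := (C + 2 * Q * K) * ℓ ^ 2 with hs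
  have hVs : 1 ≤ V s := by
    refine Finset.card_pos.2 ⟨x, Finset.mem_filter.2 ⟨by_contra fun hx => ?_, hlt⟩⟩
    have := h0 x hx
    have : 0 ≤ s := by positivity
    linarith
  have hk := key _ s (by positivity) (Nat.lt_succ_self _) hVs
  have h1 := one_le_scale (d := d) hℓ (V := V s) (by exact_mod_cast hVs)
  have h2 : 0 < C * scale d ℓ (V s) ^ 2 := by positivity
  have h3 : 2 * Q * K * ℓ ≤ 2 * Q * K * ℓ ^ 2 := mul_le_mul_of_nonneg_left (by nlinarith) (by positivity)
  nlinarith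

end

section

/-! ### Exit times from small sets -/

variable {d : ℕ}

/-- Isoperimetry passes from connected sets to all finite sets. -/
lemma iso_of_conn {ω : Config d} {M : ℝ} {B : Set (Zd d)} (hBf : B.Finite)
    (hB : ∀ B' ⊆ B, B'.Nonempty → (∀ x ∈ B', ∀ y ∈ B', Conn ω B' x y) →
      (B'.ncard : ℝ) ≤ M * (bdry ω B').ncard) : (B.ncard : ℝ) ≤ M * (bdry ω B).ncard := by
  induction hm : B.ncard using Nat.strong_induction_on generalizing B with
  | _ m ih =>
    rcases B.eq_empty_or_nonempty with he | ⟨b, hb⟩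
    · have : m = 0 := by rw [← hm, he, Set.ncard_empty]
      subst he
      have h0 : bdry ω ∅ = ∅ := by ext e; simp [bdry]
      rw [this, h0, Set.ncard_empty]; simp
    set B1 := {y | Conn ω B b y} with hB1
    have h1B : B1 ⊆ B := fun y hy => hy.mem_right
    have hb1 : b ∈ B1 := .refl hb
    have hc1 : ∀ y ∈ B1, Conn ω B1 b y := fun y hy =>
      hy.induct (P := fun y => Conn ω B1 b y) (.refl hb1) fun u v hu ih huv hv => ih.tail huv (hu.tail huv hv)
    have hlt : (B \ B1).ncard < m := by
      rw [← hm]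
      exact Set.ncard_lt_ncard ⟨Set.sdiff_subset, fun h => (h hb).2 hb1⟩ hBf
    have h1 := hB B1 h1B ⟨b, hb1⟩ fun x hx y hy => (hc1 x hx).symm.trans (hc1 y hy)
    have h2 := ih _ hlt (hBf.sdiff (t := B1)) (fun B' hB' => hB B' (hB'.trans Set.sdiff_subset)) rfl
    have hd12 : Disjoint (bdry ω B1) (bdry ω (B \ B1)) :=
      Set.disjoint_left.2 fun e he he' => he'.2.1.2 he.2.1
    have hsub : bdry ω B1 ∪ bdry ω (B \ B1) ⊆ bdry ω B := by
      rintro ⟨x, y⟩ (⟨h, hx, hy⟩ | ⟨h, hx, hy⟩)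
      · exact ⟨h, h1B hx, fun hyB => hy (hx.tail h hyB)⟩
      · exact ⟨h, hx.1, fun hyB => hy ⟨hyB, fun hy1 => hx.2 (Conn.tail hy1 h.symm hx.1)⟩⟩
    have h3 : (bdry ω B1).ncard + (bdry ω (B \ B1)).ncard ≤ (bdry ω B).ncard := by
      rw [← Set.ncard_union_eq hd12 (bdry_finite (hBf.subset h1B)) (bdry_finite hBf.sdiff)]
      exact Set.ncard_le_ncard hsub (bdry_finite hBf)
    have h4 : B1.ncard + (B \ B1).ncard = m := by
      rw [← hm, add_comm]; exact Set.ncard_sdiff_add_ncard_of_subset h1B hBf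
    have h5 : (m : ℝ) = B1.ncard + (B \ B1).ncard := by exact_mod_cast h4.symm
    have h6 : ((bdry ω B1).ncard : ℝ) + (bdry ω (B \ B1)).ncard ≤ (bdry ω B).ncard := by exact_mod_cast h3
    have hM : 0 ≤ M := by
      by_contra! hneg
      have h7 : (1 : ℝ) ≤ B1.ncard := by
        exact_mod_cast (Set.ncard_pos (hBf.subset h1B)).2 ⟨b, hb1⟩
      nlinarith [(Nat.cast_nonneg (bdry ω B1).ncard : (0 : ℝ) ≤ _)]
    nlinarith [mul_le_mul_of_nonneg_left h6 hM]

lemma one_le_bdry {ω : Config d} (hinf : (cluster ω).Infinite) {B : Set (Zd d)} (hBf : B.Finite) (hB : B ⊆ cluster ω)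
    (hne : B.Nonempty) : 1 ≤ (bdry ω B).ncard := by
  obtain ⟨b, hb⟩ := hne
  obtain ⟨w, hw, hwB⟩ := hinf.exists_notMem_finite hBf
  obtain ⟨u, v, hu, huv, -, hv⟩ :=
    ((mem_cluster_iff.1 (hB hb)).symm.trans (mem_cluster_iff.1 hw)).exists_exit hb hwB
  exact (Set.ncard_pos (bdry_finite hBf)).2 ⟨(u, v), huv, hu.mem_right.2, hv⟩

/-- Isoperimetry at scale `ℓ` for all sets of volume at most `ℓ ^ d`. -/
lemma iso_scale (hd : 2 ≤ d) {ω : Config d} (hinf : (cluster ω).Infinite) {C n ℓ : ℕ} (hC : 0 < C) (hℓ : 2 ≤ ℓ)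
    (hn : n ≤ (ℓ + 1) ^ (d + 2))
    (hI : ∀ B : Set (Zd d), B ⊆ cluster ω → B ⊆ Bx 0 n → B.Nonempty →
        (∀ x ∈ B, ∀ y ∈ B, Conn ω B x y) → n ≤ B.ncard ^ (4 * (d + 2)) →
        B.ncard ^ (d - 1) ≤ C * (bdry ω B).ncard ^ d)
    {B : Set (Zd d)} (hB : B ⊆ cluster ω) (hBn : B ⊆ Bx 0 n) (hBℓ : B.ncard ≤ ℓ ^ d) :
    (B.ncard : ℝ) ≤ C * scale d ℓ B.ncard * (bdry ω B).ncard := by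
  have hBf : B.Finite := (Bx_finite _ _).subset hBn
  refine iso_of_conn hBf fun B' hB' hne hconn => ?_
  have hV'V := Set.ncard_le_ncard hB' hBf
  have hb := one_le_bdry hinf (hBf.subset hB') (hB'.trans hB) hne
  have hV'1 : 1 ≤ B'.ncard := (Set.ncard_pos (hBf.subset hB')).2 hne
  have hIB := hI B' (hB'.trans hB) (hB'.trans hBn) hne hconn
  set V' := B'.ncard
  set V := B.ncard
  set b := (bdry ω B').ncard
  have hρ0 : 0 ≤ scale d ℓ V := scale_nonneg (by positivity) (by positivity)
  refine le_of_pow_le_pow_left₀ (n := 2 * d) (by omega) (by positivity) ?_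
  rw [mul_pow, mul_pow, scale_pow (by omega) (by positivity) (by positivity)]
  have hC1 : 1 ≤ C ^ (2 * d) := Nat.one_le_pow _ _ hC
  suffices V' ^ (2 * d) ≤ C ^ (2 * d) * (ℓ ^ d * V) * b ^ (2 * d) by exact_mod_cast this
  rcases lt_or_ge (V' ^ 2) ℓ with h | h
  · calc V' ^ (2 * d) = (V' ^ 2) ^ d := pow_mul _ _ _
      _ ≤ ℓ ^ d := Nat.pow_le_pow_left h.le _
      _ = 1 * (ℓ ^ d * 1) * 1 := by ring
      _ ≤ C ^ (2 * d) * (ℓ ^ d * V) * b ^ (2 * d) := by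
        gcongr
        · omega
        · exact Nat.one_le_pow _ _ hb
  · have h1 : n ≤ V' ^ (4 * (d + 2)) := by
      calc n ≤ (ℓ + 1) ^ (d + 2) := hn
        _ ≤ ((V' ^ 2) ^ 2) ^ (d + 2) := by
          refine Nat.pow_le_pow_left ?_ _
          calc ℓ + 1 ≤ ℓ ^ 2 := by nlinarith
            _ ≤ _ := Nat.pow_le_pow_left h _
        _ = _ := by rw [← pow_mul, ← pow_mul]; congr 1; ring
    have h2 := hIB h1
    calc V' ^ (2 * d) = (V' ^ (d - 1)) ^ 2 * V' ^ 2 := by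
          rw [← pow_mul, ← pow_add]; congr 1; omega
      _ ≤ (C * b ^ d) ^ 2 * V ^ 2 := by gcongr
      _ = C ^ 2 * (V * V) * b ^ (2 * d) := by ring
      _ ≤ C ^ (2 * d) * (ℓ ^ d * V) * b ^ (2 * d) := by
        gcongr
        omega

/-- The probability that the walk stays in `S` up to time `t`. -/
noncomputable def stay (ω : Config d) (S : Set (Zd d)) : ℕ → Zd d → ℝ
  | 0 => S.indicator 1
  | t + 1 => S.indicator (avg ω (stay ω S t))

lemma stay_nonneg (ω : Config d) (S : Set (Zd d)) (t : ℕ) (x : Zd d) : 0 ≤ stay ω S t x := by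
  induction t generalizing x with
  | zero => exact Set.indicator_nonneg (fun _ _ => zero_le_one) x
  | succ t ih => exact Set.indicator_nonneg (fun _ _ => avg_nonneg ih) x

lemma stay_of_notMem {ω : Config d} {S : Set (Zd d)} {x : Zd d} (hx : x ∉ S) (t : ℕ) : stay ω S t x = 0 := by
  cases t <;> simp [stay, hx]

lemma stay_succ_of_mem {ω : Config d} {S : Set (Zd d)} {x : Zd d} (hx : x ∈ S) (t : ℕ) :
    stay ω S (t + 1) x = avg ω (stay ω S t) x := by simp [stay, hx]

lemma stay_zero_of_mem {ω : Config d} {S : Set (Zd d)} {x : Zd d} (hx : x ∈ S) : stay ω S 0 x = 1 := by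
  simp [stay, hx]

lemma stay_le_one (ω : Config d) (S : Set (Zd d)) (t : ℕ) (x : Zd d) : stay ω S t x ≤ 1 := by
  by_cases hx : x ∈ S
  · induction t generalizing x with
    | zero => rw [stay_zero_of_mem hx]
    | succ t ih =>
      rw [stay_succ_of_mem hx]
      refine (avg_mono (g := fun _ => 1) fun y _ => ?_).trans (avg_const_le zero_le_one x)
      by_cases hy : y ∈ S
      · exact ih y hy
      · rw [stay_of_notMem hy]; exact zero_le_one
  · rw [stay_of_notMem hx]; exact zero_le_one

lemma stay_succ_le (ω : Config d) (S : Set (Zd d)) (t : ℕ) (x : Zd d) : stay ω S (t + 1) x ≤ stay ω S t x := by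
  by_cases hx : x ∈ S
  · induction t generalizing x with
    | zero => rw [stay_zero_of_mem hx]; exact stay_le_one _ _ _ _
    | succ t ih =>
      rw [stay_succ_of_mem hx, stay_succ_of_mem hx]
      refine avg_mono fun y _ => ?_
      by_cases hy : y ∈ S
      · exact ih y hy
      · rw [stay_of_notMem hy, stay_of_notMem hy]
  · rw [stay_of_notMem hx, stay_of_notMem hx]

/-- Escape from a small set takes a time of order `ℓ ^ 2`. -/
lemma stay_le_half (hd : 0 < d) {ω : Config d} {S : Finset (Zd d)} {K ℓ : ℝ} (hK : 1 ≤ K) (hℓ : 1 ≤ ℓ)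
    (hSℓ : (S.card : ℝ) ≤ ℓ ^ d)
    (hiso : ∀ B ⊆ S, B.Nonempty → (B.card : ℝ) ≤ K * scale d ℓ B.card * (bdry ω (B : Set (Zd d))).ncard)
    {T : ℕ} (hT : 2 * ((8 * d * (3 ^ d) ^ 2 * K ^ 2 + 2 * 3 ^ d * K) * ℓ ^ 2) ≤ T) (x : Zd d) :
    stay ω (S : Set (Zd d)) T x ≤ 1 / 2 := by
  have hanti : Antitone fun t => stay ω (S : Set (Zd d)) t x := antitone_nat_of_succ_le fun t => stay_succ_le _ _ _ _
  have h := torsion_bound hd (ω := ω) (h := fun x => ∑ t ∈ Finset.range T, stay ω (S : Set (Zd d)) t x) (S := S)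
    (fun x hx => by
      refine (Finset.sum_eq_zero fun t _ => ?_).le
      exact stay_of_notMem (by exact_mod_cast hx) t)
    (fun x hx => by
      have hx' : x ∈ (S : Set (Zd d)) := by exact_mod_cast hx
      rw [avg_sum, ← stay_zero_of_mem (ω := ω) hx']
      simp only [← stay_succ_of_mem hx']
      rw [add_comm, ← Finset.sum_range_succ' (fun t => stay ω (S : Set (Zd d)) t x) T, Finset.sum_range_succ]
      exact le_add_of_nonneg_right (stay_nonneg _ _ _ _)) hK hℓ hSℓ hiso x
  have h2 : (T : ℝ) * stay ω (S : Set (Zd d)) T x ≤ ∑ t ∈ Finset.range T, stay ω (S : Set (Zd d)) t x := by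
    have := Finset.card_nsmul_le_sum (Finset.range T) (fun t => stay ω (S : Set (Zd d)) t x) _
      fun t ht => hanti (Finset.mem_range.1 ht).le
    rwa [Finset.card_range, nsmul_eq_mul] at this
  have hd' : (0 : ℝ) < d := by exact_mod_cast hd
  have hT0 : (0 : ℝ) < T := lt_of_lt_of_le (by positivity) hT
  refine le_of_mul_le_mul_left ?_ hT0
  linarith

end

section

/-! ### The Laplace functional of the range -/

variable {d : ℕ}

open Classical in
/-- The transition operator of the walk together with its set of visited sites. -/
noncomputable def rangeStep (ω : Config d) (g : Finset (Zd d) → Zd d → ℝ) (A : Finset (Zd d)) (x : Zd d) : ℝ :=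
  avg ω (fun y => g (insert y A) y) x

/-- The functional `α ^ |A|` of the set of visited sites. -/
def rangeWeight (α : ℝ) (A : Finset (Zd d)) (_ : Zd d) : ℝ := α ^ A.card

lemma rangeStep_iterate_nonneg {α : ℝ} (hα : 0 ≤ α) (ω : Config d) (n : ℕ) (A : Finset (Zd d)) (x : Zd d) :
    0 ≤ (rangeStep ω)^[n] (rangeWeight α) A x := by
  induction n generalizing A x with
  | zero => exact pow_nonneg hα _
  | succ n ih =>
    rw [Function.iterate_succ_apply']
    exact avg_nonneg fun y => ih _ _

lemma rangeStep_iterate_le {α : ℝ} (hα : 0 ≤ α) (hα1 : α ≤ 1) (ω : Config d) (n : ℕ) (A : Finset (Zd d))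
    (x : Zd d) : (rangeStep ω)^[n] (rangeWeight α) A x ≤ α ^ A.card := by
  classical
  induction n generalizing A x with
  | zero => exact le_rfl
  | succ n ih =>
    rw [Function.iterate_succ_apply']
    refine (avg_mono fun y _ => ?_).trans (avg_const_le (pow_nonneg hα A.card) x)
    exact (ih _ _).trans (pow_le_pow_of_le_one hα hα1 (Finset.card_le_card (Finset.subset_insert _ _)))

/-- States of the walk with its range that can be reached from the origin in `m` steps. -/
def Reachable (ω : Config d) (m : ℕ) (A : Finset (Zd d)) (x : Zd d) : Prop :=
  x ∈ A ∧ (A : Set (Zd d)) ⊆ cluster ω ∧ (A : Set (Zd d)) ⊆ Bx 0 m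

lemma Reachable.mono {ω : Config d} {m n : ℕ} (hmn : m ≤ n) {A : Finset (Zd d)} {x : Zd d}
    (h : Reachable ω m A x) : Reachable ω n A x :=
  ⟨h.1, h.2.1, h.2.2.trans (Bx_mono 0 hmn)⟩

open Classical in
lemma Reachable.step {ω : Config d} {m : ℕ} {A : Finset (Zd d)} {x y : Zd d}
    (h : Reachable ω m A x) (hxy : openAdj ω x y) : Reachable ω (m + 1) (insert y A) y := by
  refine ⟨Finset.mem_insert_self _ _, ?_, ?_⟩
  · rw [Finset.coe_insert]
    exact Set.insert_subset (Relation.ReflTransGen.tail (h.2.1 h.1) hxy) h.2.1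
  · rw [Finset.coe_insert]
    exact Set.insert_subset (hxy.1.mem_Bx_succ (h.2.2 h.1)) (h.2.2.trans (Bx_mono 0 (Nat.le_succ m)))

lemma rangeStep_iterate_mono {ω : Config d} {f g : Finset (Zd d) → Zd d → ℝ} {n : ℕ}
    (hfg : ∀ A x, Reachable ω n A x → f A x ≤ g A x) {k m : ℕ} (hn : m + k ≤ n) {A : Finset (Zd d)} {x : Zd d}
    (h : Reachable ω m A x) : (rangeStep ω)^[k] f A x ≤ (rangeStep ω)^[k] g A x := by
  induction k generalizing m A x with
  | zero => exact hfg _ _ (h.mono (by omega))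
  | succ k ih =>
    rw [Function.iterate_succ_apply', Function.iterate_succ_apply']
    exact avg_mono fun y hy => ih (m := m + 1) (by omega) (h.step hy)

lemma rangeStep_iterate_affine_le {ω : Config d} {f : Finset (Zd d) → Zd d → ℝ} {κ ε : ℝ} (hε : 0 ≤ ε)
    (k : ℕ) (A : Finset (Zd d)) (x : Zd d) :
    (rangeStep ω)^[k] (fun A x => κ * f A x + ε) A x ≤ κ * (rangeStep ω)^[k] f A x + ε := by
  classical
  induction k generalizing A x with
  | zero => exact le_rfl
  | succ k ih =>
    rw [Function.iterate_succ_apply', Function.iterate_succ_apply']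
    refine (avg_mono fun y _ => ih _ _).trans ?_
    rw [avg_add, avg_const_mul]
    exact add_le_add le_rfl (avg_const_le hε x)

/-- As long as the walk has left `S` at least one new site has been visited. -/
lemma rangeStep_iterate_le_stay {α : ℝ} (hα : 0 ≤ α) (hα1 : α ≤ 1) {ω : Config d} {S : Finset (Zd d)} (t : ℕ)
    {A : Finset (Zd d)} {x : Zd d} (hSA : S ⊆ A) (hx : x ∈ A) :
    (rangeStep ω)^[t] (rangeWeight α) A x ≤ α ^ S.card * (α + (1 - α) * stay ω (S : Set (Zd d)) t x) := by
  classical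
  induction t generalizing A x with
  | zero =>
    by_cases hxS : x ∈ S
    · rw [stay_zero_of_mem (by exact_mod_cast hxS)]
      have : α ^ A.card ≤ α ^ S.card := pow_le_pow_of_le_one hα hα1 (Finset.card_le_card hSA)
      calc _ = α ^ A.card := rfl
        _ ≤ α ^ S.card := this
        _ = _ := by ring
    · rw [stay_of_notMem (by exact_mod_cast hxS)]
      have h1 : S.card + 1 ≤ A.card := by
        rw [← Finset.card_insert_of_notMem hxS]
        exact Finset.card_le_card (Finset.insert_subset hx hSA)
      calc _ = α ^ A.card := rfl
        _ ≤ α ^ (S.card + 1) := pow_le_pow_of_le_one hα hα1 h1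
        _ = _ := by ring
  | succ t ih =>
    by_cases hxS : x ∈ S
    · rw [Function.iterate_succ_apply', stay_succ_of_mem (by exact_mod_cast hxS)]
      refine (avg_mono (g := fun y => (α ^ S.card * (1 - α)) * stay ω (S : Set (Zd d)) t y + α ^ S.card * α)
        fun y _ => (ih (hSA.trans (Finset.subset_insert y A)) (Finset.mem_insert_self _ _)).trans
          (le_of_eq (by ring))).trans ?_
      rw [avg_add, avg_const_mul]
      have := avg_const_le (ω := ω) (mul_nonneg (pow_nonneg hα S.card) hα) x
      linarith
    · rw [stay_of_notMem (by exact_mod_cast hxS)]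
      have h1 : S.card + 1 ≤ A.card := by
        rw [← Finset.card_insert_of_notMem hxS]
        exact Finset.card_le_card (Finset.insert_subset hx hSA)
      calc _ ≤ α ^ A.card := rangeStep_iterate_le hα hα1 _ _ _ _
        _ ≤ α ^ (S.card + 1) := pow_le_pow_of_le_one hα hα1 h1
        _ = _ := by ring

lemma reachable_zero (ω : Config d) : Reachable ω 0 {0} 0 := by
  refine ⟨Finset.mem_singleton_self _, ?_, ?_⟩
  · rw [Finset.coe_singleton, Set.singleton_subset_iff]; exact Relation.ReflTransGen.refl
  · rw [Finset.coe_singleton, Set.singleton_subset_iff]; exact self_mem_Bx _ _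

/-- Iterating a one-block contraction. -/
lemma rangeStep_iterate_le_of_block {α κ ε : ℝ} (hα : 0 ≤ α) (hα1 : α ≤ 1) (hκ : 0 ≤ κ) (hκ1 : κ < 1) (hε : 0 ≤ ε)
    {ω : Config d} {n T j : ℕ} (hj : j * T ≤ n)
    (hblock : ∀ A x, Reachable ω n A x →
      (rangeStep ω)^[T] (rangeWeight α) A x ≤ κ * rangeWeight α A x + ε) :
    (rangeStep ω)^[n] (rangeWeight α) {0} 0 ≤ κ ^ j + ε / (1 - κ) := by
  have h1 : (rangeStep ω)^[n] (rangeWeight α) {0} 0 ≤ (rangeStep ω)^[j * T] (rangeWeight α) {0} 0 := by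
    conv_lhs => rw [show n = j * T + (n - j * T) by omega, Function.iterate_add_apply]
    exact rangeStep_iterate_mono (n := n) (fun A x _ => rangeStep_iterate_le hα hα1 _ _ _ _) (m := 0) (by omega)
      (reachable_zero ω)
  refine h1.trans ?_
  clear h1
  induction j with
  | zero =>
    have h2 : 0 ≤ ε / (1 - κ) := div_nonneg hε (by linarith)
    simp only [Nat.zero_mul, Function.iterate_zero, id, rangeWeight, Finset.card_singleton, pow_one, pow_zero]
    linarith
  | succ j ih =>
    rw [Nat.succ_mul] at hj
    rw [Nat.succ_mul, Function.iterate_add_apply]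
    have h2 := ih (by omega)
    calc _ ≤ (rangeStep ω)^[j * T] (fun A x => κ * rangeWeight α A x + ε) {0} 0 :=
          rangeStep_iterate_mono (n := n) hblock (m := 0) (by omega) (reachable_zero ω)
      _ ≤ κ * (rangeStep ω)^[j * T] (rangeWeight α) {0} 0 + ε := rangeStep_iterate_affine_le hε _ _ _
      _ ≤ κ * (κ ^ j + ε / (1 - κ)) + ε := by gcongr
      _ = _ := by
        have : 1 - κ ≠ 0 := by linarith
        field_simp
        ring

lemma step_nonneg (ω : Config d) (x y : Zd d) : 0 ≤ step ω x y := by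
  unfold step; split_ifs <;> positivity

lemma pathW_nonneg {n : ℕ} (ω : Config d) (γ : Fin (n + 1) → Zd d) : 0 ≤ pathW ω γ :=
  Finset.prod_nonneg fun _ _ => step_nonneg _ _ _

lemma pathW_cons {n : ℕ} (ω : Config d) (x : Zd d) (γ : Fin (n + 1) → Zd d) :
    pathW ω (Fin.cons x γ : Fin (n + 2) → Zd d) = step ω x (γ 0) * pathW ω γ := by
  rw [pathW, Fin.prod_univ_succ]
  rfl

open Classical in
lemma tsum_paths {α : ℝ} (hα : 0 ≤ α) (ω : Config d) (n : ℕ) (A : Finset (Zd d)) (x : Zd d) (hx : x ∈ A) :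
    ∑' γ : Fin (n + 1) → Zd d, (if γ 0 = x then
      ENNReal.ofReal (pathW ω γ * α ^ ((A : Set (Zd d)) ∪ Set.range γ).ncard) else 0) =
    ENNReal.ofReal ((rangeStep ω)^[n] (rangeWeight α) A x) := by
  induction n generalizing A x with
  | zero =>
    rw [tsum_eq_single (fun _ => x)]
    · have h1 : (A : Set (Zd d)) ∪ Set.range (fun _ : Fin (0 + 1) => x) = A := by
        rw [Set.range_const, Set.union_eq_left, Set.singleton_subset_iff]; exact_mod_cast hx
      rw [if_pos rfl, h1, Set.ncard_coe_finset]
      simp [pathW, rangeWeight]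
    · intro γ hγ
      refine if_neg fun h => hγ ?_
      funext i; rw [Fin.fin_one_eq_zero i]; exact h
  | succ n ih =>
    have h1 : ∀ (y : Zd d) (γ : Fin (n + 1) → Zd d), (A : Set (Zd d)) ∪ Set.range (Fin.cons y γ : Fin (n + 2) → Zd d) =
        insert y ((A : Set (Zd d)) ∪ Set.range γ) := by
      intro y γ
      rw [Fin.range_cons, Set.union_insert]
    rw [← (Fin.consEquiv fun _ => Zd d).tsum_eq, ENNReal.tsum_prod', tsum_eq_single x]
    · simp only [Fin.consEquiv_apply, Fin.cons_zero, if_true]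
      change ∑' γ : Fin (n + 1) → Zd d, ENNReal.ofReal (pathW ω (Fin.cons x γ : Fin (n + 2) → Zd d) *
        α ^ ((A : Set (Zd d)) ∪ Set.range (Fin.cons x γ : Fin (n + 2) → Zd d)).ncard) = _
      simp only [pathW_cons, h1]
      have h2 : ∀ γ : Fin (n + 1) → Zd d, ENNReal.ofReal (step ω x (γ 0) * pathW ω γ *
          α ^ (insert x ((A : Set (Zd d)) ∪ Set.range γ)).ncard) =
          ∑ y ∈ nbr ω x, ENNReal.ofReal (nu ω x : ℝ)⁻¹ * (if γ 0 = y then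
            ENNReal.ofReal (pathW ω γ * α ^ (((insert y A : Finset (Zd d)) : Set (Zd d)) ∪ Set.range γ).ncard)
              else 0) := by
        intro γ
        by_cases hγ : openAdj ω x (γ 0)
        · rw [Finset.sum_eq_single (γ 0)]
          · have h3 : insert x ((A : Set (Zd d)) ∪ Set.range γ) =
                ((insert (γ 0) A : Finset (Zd d)) : Set (Zd d)) ∪ Set.range γ := by
              have hx' : x ∈ (A : Set (Zd d)) ∪ Set.range γ := Or.inl hx
              have h0 : γ 0 ∈ (A : Set (Zd d)) ∪ Set.range γ := Or.inr ⟨0, rfl⟩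
              rw [Finset.coe_insert, Set.insert_union, Set.insert_eq_of_mem hx', Set.insert_eq_of_mem h0]
            rw [if_pos rfl, h3, ← ENNReal.ofReal_mul (by positivity), step, if_pos hγ, mul_assoc]
          · intro y _ hy
            rw [if_neg hy.symm, mul_zero]
          · intro h; exact absurd (mem_nbr.2 hγ) h
        · rw [step, if_neg hγ, zero_mul, zero_mul, ENNReal.ofReal_zero]
          symm
          refine Finset.sum_eq_zero fun y hy => ?_
          rw [if_neg fun h : γ 0 = y => hγ (h ▸ mem_nbr.1 hy), mul_zero]
      simp only [h2]
      rw [Summable.tsum_finsetSum fun _ _ => ENNReal.summable]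
      simp only [ENNReal.tsum_mul_left]
      rw [Finset.sum_congr rfl fun y _ => by rw [ih (insert y A) y (Finset.mem_insert_self _ _)]]
      rw [Function.iterate_succ_apply', rangeStep, avg, ENNReal.ofReal_mul (by positivity),
        ENNReal.ofReal_sum_of_nonneg fun y _ => rangeStep_iterate_nonneg hα _ _ _ _, Finset.mul_sum]
    · intro y hy
      rw [ENNReal.tsum_eq_zero]
      intro γ
      rw [if_neg]
      exact hy

lemma LaplaceN_eq {α : ℝ} (hα : 0 ≤ α) (ω : Config d) (n : ℕ) :
    LaplaceN ω α n = (rangeStep ω)^[n] (rangeWeight α) {0} 0 := by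
  classical
  have h := tsum_paths hα ω n {0} 0 (Finset.mem_singleton_self _)
  rw [← ENNReal.toReal_ofReal (rangeStep_iterate_nonneg hα ω n {0} 0), ← h, ENNReal.tsum_toReal_eq, LaplaceN]
  · refine tsum_congr fun γ => ?_
    by_cases hγ : γ 0 = 0
    · rw [Set.indicator_of_mem (show γ ∈ {γ : Fin (n + 1) → Zd d | γ 0 = 0} from hγ), if_pos hγ,
        ENNReal.toReal_ofReal (mul_nonneg (pathW_nonneg _ _) (pow_nonneg hα _)), visits, Finset.coe_singleton,
        Set.union_eq_right.2 (Set.singleton_subset_iff.2 (Set.mem_range.2 ⟨0, hγ⟩))]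
    · rw [Set.indicator_of_notMem (show γ ∉ {γ : Fin (n + 1) → Zd d | γ 0 = 0} from hγ), if_neg hγ,
        ENNReal.toReal_zero]
  · intro γ
    split_ifs
    · exact ENNReal.ofReal_ne_top
    · exact ENNReal.zero_ne_top

end

section

/-! ### Decay of the Laplace functional -/

variable {d : ℕ}

/-- The exponential decay of the Laplace functional over one block of time. -/
lemma rangeStep_block (hd : 2 ≤ d) {ω : Config d} (hinf : (cluster ω).Infinite) {C n ℓ : ℕ} (hC : 0 < C)
    (hℓ : 2 ≤ ℓ) (hn : n ≤ (ℓ + 1) ^ (d + 2))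
    (hI : ∀ B ⊆ cluster ω, B ⊆ Bx 0 n → B.Nonempty → (∀ x ∈ B, ∀ y ∈ B, Conn ω B x y) →
      n ≤ B.ncard ^ (4 * (d + 2)) → B.ncard ^ (d - 1) ≤ C * (bdry ω B).ncard ^ d)
    {α : ℝ} (hα : 0 ≤ α) (hα1 : α ≤ 1) {A : Finset (Zd d)} {x : Zd d} (h : Reachable ω n A x) :
    (rangeStep ω)^[2 * (8 * d * (3 ^ d) ^ 2 * C ^ 2 + 2 * 3 ^ d * C) * ℓ ^ 2] (rangeWeight α) A x ≤
      (α + (1 - α) * (1 / 2)) * rangeWeight α A x + α ^ ℓ ^ d := by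
  have hA0 : 0 ≤ α ^ A.card := pow_nonneg hα _
  rcases le_or_gt A.card (ℓ ^ d) with hA | hA
  · have h1 := stay_le_half (d := d) (by omega) (ω := ω) (S := A) (K := C) (ℓ := ℓ) (by exact_mod_cast hC)
      (by exact_mod_cast (by omega : 1 ≤ ℓ)) (by exact_mod_cast hA)
      (fun B hB _ => by
        have h2 := iso_scale hd hinf hC hℓ hn hI (B := (B : Set (Zd d)))
          ((Finset.coe_subset.2 hB).trans h.2.1) ((Finset.coe_subset.2 hB).trans h.2.2)
          (by rw [Set.ncard_coe_finset]; exact (Finset.card_le_card hB).trans hA)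
        rwa [Set.ncard_coe_finset] at h2)
      (T := 2 * (8 * d * (3 ^ d) ^ 2 * C ^ 2 + 2 * 3 ^ d * C) * ℓ ^ 2)
      (by push_cast; exact le_of_eq (by ring)) x
    refine (rangeStep_iterate_le_stay hα hα1 _ subset_rfl h.1).trans ?_
    have h3 : (1 - α) * stay ω (A : Set (Zd d)) (2 * (8 * d * (3 ^ d) ^ 2 * C ^ 2 + 2 * 3 ^ d * C) * ℓ ^ 2) x ≤
        (1 - α) * (1 / 2) := mul_le_mul_of_nonneg_left h1 (by linarith)
    calc _ ≤ α ^ A.card * (α + (1 - α) * (1 / 2)) := by gcongr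
      _ = (α + (1 - α) * (1 / 2)) * rangeWeight α A x + 0 := by rw [rangeWeight]; ring
      _ ≤ _ := by gcongr; positivity
  · refine (rangeStep_iterate_le hα hα1 _ _ _ _).trans ?_
    calc α ^ A.card ≤ α ^ ℓ ^ d := pow_le_pow_of_le_one hα hα1 hA.le
      _ = 0 + α ^ ℓ ^ d := (zero_add _).symm
      _ ≤ _ := by
        gcongr
        exact mul_nonneg (by linarith) hA0

lemma exists_root (k n : ℕ) (hk : k ≠ 0) : ∃ ℓ : ℕ, ℓ ^ k ≤ n ∧ n < (ℓ + 1) ^ k := by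
  classical
  have h : ∃ m, n < (m + 1) ^ k := ⟨n, (Nat.lt_succ_self n).trans_le (Nat.le_self_pow hk _)⟩
  refine ⟨Nat.find h, ?_, Nat.find_spec h⟩
  rcases hℓ : Nat.find h with - | m
  · simp [hk]
  · have := Nat.find_min h (m := m) (by omega)
    omega

/-- Comparison of the decay over `ℓ ^ d` blocks with a stretched exponential. -/
lemma exists_exp_bound (hd : 0 < d) {α : ℝ} (hα : α ∈ Set.Ioo (0 : ℝ) 1) {K : ℕ} (hK : 0 < K) :
    ∃ c > (0 : ℝ), ∃ L : ℕ, ∀ ℓ ≥ L, ∀ n : ℕ, n ≤ (ℓ + 1) ^ (d + 2) →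
      (α + (1 - α) * (1 / 2)) ^ (ℓ ^ d / K) + α ^ ℓ ^ d / (1 - (α + (1 - α) * (1 / 2))) ≤
        Real.exp (-c * (n : ℝ) ^ ((d : ℝ) / ((d : ℝ) + 2))) := by
  obtain ⟨hα0, hα1⟩ := hα
  set κ := α + (1 - α) * (1 / 2) with hκ
  have hκ0 : 0 < κ := by rw [hκ]; linarith
  have hκ1 : κ < 1 := by rw [hκ]; linarith
  have hακ : α ≤ κ := by rw [hκ]; linarith
  have hlog : 0 < -Real.log κ := neg_pos.2 (Real.log_neg hκ0 hκ1)
  have hK' : (0 : ℝ) < K := by exact_mod_cast hK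
  set b := -Real.log κ / K with hb
  have hb0 : 0 < b := div_pos hlog hK'
  have hM0 : 0 < (1 + 1 / (1 - κ)) * κ⁻¹ := by
    have : 0 < 1 - κ := by linarith
    positivity
  obtain ⟨L, hL⟩ := exists_nat_ge (Real.log ((1 + 1 / (1 - κ)) * κ⁻¹) / (b / 2))
  refine ⟨b / 2 / 2 ^ d, by positivity, L + 1, fun ℓ hℓ n hn => ?_⟩
  have hℓ1 : (1 : ℝ) ≤ ℓ := by exact_mod_cast (by omega : 1 ≤ ℓ)
  have h1 : κ ^ (ℓ ^ d / K) ≤ κ⁻¹ * Real.exp (-b * (ℓ : ℝ) ^ d) := by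
    have h2 : (ℓ : ℝ) ^ d / K - 1 ≤ (ℓ ^ d / K : ℕ) := by
      have h3 := Nat.lt_div_mul_add (a := ℓ ^ d) hK
      have h4 : (ℓ : ℝ) ^ d ≤ (ℓ ^ d / K : ℕ) * K + K := by exact_mod_cast h3.le
      rw [sub_le_iff_le_add, div_le_iff₀ hK']
      linarith
    rw [← Real.rpow_natCast, Real.rpow_def_of_pos hκ0, ← Real.exp_log (inv_pos.2 hκ0), ← Real.exp_add,
      Real.exp_le_exp, Real.log_inv]
    have h5 := mul_le_mul_of_nonneg_left h2 hlog.le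
    have h6 : b * (ℓ : ℝ) ^ d = -Real.log κ * ((ℓ : ℝ) ^ d / K) := by rw [hb]; ring
    linarith
  have h2 : α ^ ℓ ^ d ≤ κ ^ (ℓ ^ d / K) :=
    (pow_le_pow_left₀ hα0.le hακ _).trans (pow_le_pow_of_le_one hκ0.le hκ1.le (Nat.div_le_self _ _))
  have h3 : (n : ℝ) ^ ((d : ℝ) / ((d : ℝ) + 2)) ≤ 2 ^ d * (ℓ : ℝ) ^ d := by
    have h4 : (n : ℝ) ≤ ((ℓ : ℝ) + 1) ^ (d + 2) := by exact_mod_cast hn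
    calc (n : ℝ) ^ ((d : ℝ) / ((d : ℝ) + 2))
        ≤ (((ℓ : ℝ) + 1) ^ (d + 2)) ^ ((d : ℝ) / ((d : ℝ) + 2)) :=
          Real.rpow_le_rpow (by positivity) h4 (by positivity)
      _ = ((ℓ : ℝ) + 1) ^ d := by
          rw [← Real.rpow_natCast, ← Real.rpow_mul (by positivity), ← Real.rpow_natCast]
          congr 1
          push_cast
          field_simp
      _ ≤ (2 * (ℓ : ℝ)) ^ d := by gcongr; linarith
      _ = _ := mul_pow _ _ _
  have h4 : Real.log ((1 + 1 / (1 - κ)) * κ⁻¹) ≤ b / 2 * (ℓ : ℝ) ^ d := by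
    rw [div_le_iff₀ (by positivity)] at hL
    have h5 : (L : ℝ) ≤ (ℓ : ℝ) ^ d := by
      have : L ≤ ℓ ^ d := (by omega : L ≤ ℓ).trans (Nat.le_self_pow (by omega) _)
      exact_mod_cast this
    calc _ ≤ L * (b / 2) := hL
      _ ≤ _ := by rw [mul_comm]; gcongr
  have h5 : b / 2 / 2 ^ d * (n : ℝ) ^ ((d : ℝ) / ((d : ℝ) + 2)) ≤ b / 2 * (ℓ : ℝ) ^ d := by
    calc _ ≤ b / 2 / 2 ^ d * (2 ^ d * (ℓ : ℝ) ^ d) := by gcongr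
      _ = _ := by field_simp
  have h1κ : 0 < 1 - κ := by linarith
  calc κ ^ (ℓ ^ d / K) + α ^ ℓ ^ d / (1 - κ)
      ≤ κ ^ (ℓ ^ d / K) + κ ^ (ℓ ^ d / K) / (1 - κ) := by gcongr
    _ = (1 + 1 / (1 - κ)) * κ ^ (ℓ ^ d / K) := by ring
    _ ≤ (1 + 1 / (1 - κ)) * (κ⁻¹ * Real.exp (-b * (ℓ : ℝ) ^ d)) := by gcongr
    _ = Real.exp (Real.log ((1 + 1 / (1 - κ)) * κ⁻¹) + -b * (ℓ : ℝ) ^ d) := by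
        rw [Real.exp_add, Real.exp_log hM0]; ring
    _ ≤ _ := by
        rw [Real.exp_le_exp]
        linarith

lemma bern_infinite_ne_zero {p : unitInterval} (hp : pc d < p) :
    bern (fun _ => p) {ω : Config d | (cluster ω).Infinite} ≠ 0 := by
  intro h
  refine hp.not_ge (le_csSup ⟨1, fun _ hq => hq.2.1⟩ ⟨p.2.1, p.2.2, fun Q hQ => ?_⟩)
  rw [hQ.eq_bern]
  exact h

end

/-- upper bound for the Laplace transform of the number of visited points. -/
theorem stmt12 (d : ℕ) (hd : 2 ≤ d) (p : ℝ) (hp : pc d < p) (hp1 : p ≤ 1)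
    (α : ℝ) (hα : α ∈ Set.Ioo (0 : ℝ) 1) :
    ∃ c > (0 : ℝ),
      ∀ Q : Measure (Config d), IsBernoulli p Q →
        ∀ᵐ ω ∂Q, (cluster ω).Infinite →
          ∃ N : ℕ, ∀ n ≥ N,
            LaplaceN ω α n ≤ Real.exp (-c * (n : ℝ) ^ ((d : ℝ) / ((d : ℝ) + 2))) := by
  have hpc : 0 ≤ pc d := Real.sSup_nonneg fun _ hq => hq.1
  obtain ⟨p', hp', hpp'⟩ := exists_between hp
  lift p to unitInterval using ⟨hpc.trans hp.le, hp1⟩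
  lift p' to unitInterval using ⟨hpc.trans hp'.le, hpp'.le.trans hp1⟩
  obtain ⟨C, hC, hiso⟩ := isoperimetry_of_conn hd hpp' (bern_infinite_ne_zero hp') (bern_infinite_ne_zero hp)
  have hK : 0 < 2 * (8 * d * (3 ^ d) ^ 2 * C ^ 2 + 2 * 3 ^ d * C) := by positivity
  obtain ⟨c, hc, L, hL⟩ := exists_exp_bound (d := d) (by omega) hα hK
  refine ⟨c, hc, fun Q hQ => ?_⟩
  rw [hQ.eq_bern]
  filter_upwards [hiso (4 * (d + 2))] with ω hω hinf
  obtain ⟨N, hN⟩ := hω hinf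
  refine ⟨max N ((max L 2) ^ (d + 2)), fun n hn => ?_⟩
  obtain ⟨ℓ, hℓn, hnℓ⟩ := exists_root (d + 2) n (by omega)
  have hLℓ : max L 2 ≤ ℓ := Nat.lt_succ_iff.1
    (lt_of_pow_lt_pow_left₀ (d + 2) (Nat.zero_le _) (((le_max_right _ _).trans hn).trans_lt hnℓ))
  rw [LaplaceN_eq hα.1.le]
  refine (rangeStep_iterate_le_of_block hα.1.le hα.2.le ?_ ?_ (pow_nonneg hα.1.le _) ?_ fun A x hA =>
    rangeStep_block hd hinf hC ((le_max_right _ _).trans hLℓ) hnℓ.le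
      (hN n ((le_max_left _ _).trans hn)) hα.1.le hα.2.le hA).trans (hL ℓ ((le_max_left _ _).trans hLℓ) n hnℓ.le)
  · linarith [hα.1, hα.2]
  · linarith [hα.2]
  · calc _ = (ℓ ^ d / (2 * (8 * d * (3 ^ d) ^ 2 * C ^ 2 + 2 * 3 ^ d * C)) *
          (2 * (8 * d * (3 ^ d) ^ 2 * C ^ 2 + 2 * 3 ^ d * C))) * ℓ ^ 2 := by ring
      _ ≤ ℓ ^ d * ℓ ^ 2 := Nat.mul_le_mul_right _ (Nat.div_mul_le_self _ _)
      _ = ℓ ^ (d + 2) := (pow_add _ _ _).symm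
      _ ≤ n := hℓn

end Perco
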